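/- arXiv:1908.01388 — 2 statements merged into one kernel-verified Lean document; each statement's English description precedes it below -/
import Mathlib

section
/- Let (X,d) be a complete separable metric space with at least two points, let 0 < q < 1, and let c(x,y) := d(x,y)^q. Write B_w(x) := { y ∈ X : d(x,y) ≤ w }. Suppose there are a σ-finite Borel measure μ on X and a constant Ψ > 0 such that: (i) 0 < μ(B_w(x)) < ∞ for every x ∈ X and w > 0; (ii) μ(B_w(x) \ B_w(y)) / μ(B_w(x)) ≤ Ψ·d(x,y)/w for all x, y ∈ X and all w > 0; and (iii) limsup_{w→∞} sup{ μ(B_w(x))/μ(B_w(y)) : x, y ∈ X, d(x,y) ≤ w } < ∞ (equivalently, there exist W > 0 and C < ∞ with μ(B_w(x)) ≤ C·μ(B_w(y)) whenever w ≥ W and d(x,y) ≤ w). Then r*_c(P(X)) < 7.56 · (2.47·Ψ)^q / (1 − q). -/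
open MeasureTheory ENNReal

noncomputable section

/-- The optimal transport cost `C*_c(P,Q)` between two Borel measures for the cost `c`:
the infimum of `∫ c dγ` over couplings `γ` of `(P, Q)`. -/
def Cstar {X : Type*} [MeasurableSpace X] (c : X → X → ℝ) (P Q : Measure X) : ℝ≥0∞ :=
  ⨅ γ ∈ {γ : Measure (X × X) |
      IsProbabilityMeasure γ ∧ γ.map Prod.fst = P ∧ γ.map Prod.snd = Q},
    ∫⁻ z, ENNReal.ofReal (c z.1 z.2) ∂γ

/-- The standard probability space: `[0,1]` with Lebesgue measure. -/
def stdSpace : Measure ℝ := volume.restrict (Set.Icc (0 : ℝ) 1)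

/-- `f` is a coupling of the family of probability measures `P` on the standard
probability space `([0,1], Lebesgue)`: each `f a` is measurable with law `P a`. -/
structure IsCoupling {X A : Type*} [MeasurableSpace X]
    (P : A → Measure X) (f : A → ℝ → X) : Prop where
  measurable : ∀ a, Measurable (f a)
  law : ∀ a, stdSpace.map (f a) = P a

/-- The pairwise coupling ratio `r_c({X_α})` of a coupling `f` of the family `P`:
the least `r ≥ 1` such that `E[c(X_a, X_b)] ≤ r ⬝ C*_c(P_a, P_b)` for all `a, b`
(`∞` if no such `r` exists). -/
def couplingRatio {X A : Type*} [MeasurableSpace X]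
    (c : X → X → ℝ) (P : A → Measure X) (f : A → ℝ → X) : ℝ≥0∞ :=
  sInf {r : ℝ≥0∞ | 1 ≤ r ∧ ∀ a b : A,
    ∫⁻ u, ENNReal.ofReal (c (f a u) (f b u)) ∂stdSpace ≤ r * Cstar c (P a) (P b)}

/-- The optimal pairwise coupling ratio `r*_c({P_α})` of a family of probability
measures: the infimum of `r_c({X_α})` over all couplings of the family. -/
def optRatio {X A : Type*} [MeasurableSpace X]
    (c : X → X → ℝ) (P : A → Measure X) : ℝ≥0∞ :=
  ⨅ (f : A → ℝ → X) (_ : IsCoupling P f), couplingRatio c P f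

/-! ### Rejection sampling -/

/-- The first term of the sequence `ω` lying in `A` (junk value `ω 0` if there is none). -/
def firstHit {E : Type*} (A : Set E) (ω : ℕ → E) : E := ω (sInf {n | ω n ∈ A})

lemma firstHit_mem_iff {E : Type*} {A C : Set E} (hCA : C ⊆ A) (ω : ℕ → E) :
    firstHit A ω ∈ C ↔ ∃ n, (∀ k < n, ω k ∉ A) ∧ ω n ∈ C := by
  constructor
  · intro h
    exact ⟨_, fun k hk => Nat.notMem_of_lt_sInf hk, h⟩
  · rintro ⟨n, hn, hC⟩
    have : sInf {n | ω n ∈ A} = n := by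
      refine le_antisymm (Nat.sInf_le (hCA hC)) (le_csInf ⟨n, hCA hC⟩ fun k hk => ?_)
      by_contra! hlt
      exact hn k hlt hk
    rw [firstHit, this]
    exact hC

lemma firstHit_eq_of_mem_inter {E : Type*} {A B : Set E} {ω : ℕ → E}
    (h : firstHit (A ∪ B) ω ∈ A ∩ B) : firstHit A ω = firstHit B ω := by
  set N := sInf {n | ω n ∈ A ∪ B} with hN
  have hlt : ∀ k < N, ω k ∉ A ∪ B := fun k hk => Nat.notMem_of_lt_sInf hk
  have key : ∀ D : Set E, D ⊆ A ∪ B → ω N ∈ D → sInf {n | ω n ∈ D} = N := by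
    intro D hD hND
    refine le_antisymm (Nat.sInf_le hND) (le_csInf ⟨N, hND⟩ fun k hk => ?_)
    by_contra! hkN
    exact hlt k hkN (hD hk)
  rw [firstHit, firstHit, key A Set.subset_union_left h.1, key B Set.subset_union_right h.2]

lemma measurable_firstHit {E : Type*} [MeasurableSpace E] {A : Set E} (hA : MeasurableSet A) :
    Measurable (firstHit A) := by
  have hN : Measurable fun ω : ℕ → E => sInf {n | ω n ∈ A} := by
    refine measurable_of_Iic fun m => ?_
    have : (fun ω : ℕ → E => sInf {n | ω n ∈ A}) ⁻¹' Set.Iic m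
        = (⋃ n ∈ Set.Iic m, {ω | ω n ∈ A}) ∪ ⋂ n, {ω | ω n ∈ A}ᶜ := by
      ext ω
      simp only [Set.mem_preimage, Set.mem_Iic, Set.mem_union, Set.mem_iUnion, Set.mem_iInter,
        Set.mem_compl_iff, Set.mem_ofPred_eq, exists_prop]
      constructor
      · intro h
        by_cases hne : ∃ n, ω n ∈ A
        · exact Or.inl ⟨_, h, Nat.sInf_mem (s := {n | ω n ∈ A}) hne⟩
        · exact Or.inr (by simpa using hne)
      · rintro (⟨n, hn, hA⟩ | h)
        · exact (Nat.sInf_le (s := {n | ω n ∈ A}) hA).trans hn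
        · have : {n | ω n ∈ A} = ∅ := by ext n; simpa using h n
          rw [this]; simp
    rw [this]
    have hm : ∀ n, MeasurableSet {ω : ℕ → E | ω n ∈ A} := fun n => measurable_pi_apply n hA
    exact (MeasurableSet.biUnion (Set.to_countable _) fun n _ => hm n).union
      (MeasurableSet.iInter fun n => (hm n).compl)
  intro C hC
  have : firstHit A ⁻¹' C = ⋃ n, ({ω : ℕ → E | sInf {n | ω n ∈ A} = n} ∩ {ω | ω n ∈ C}) := by
    ext ω
    simp [firstHit]
  rw [this]
  exact MeasurableSet.iUnion fun n =>
    (hN (measurableSet_singleton n)).inter (measurable_pi_apply n hC)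

lemma infinitePi_firstHit_mem {E : Type*} [MeasurableSpace E] (ρ : Measure E)
    [IsProbabilityMeasure ρ] {A C : Set E} (hA : MeasurableSet A) (hC : MeasurableSet C)
    (hCA : C ⊆ A) :
    Measure.infinitePi (fun _ : ℕ => ρ) {ω | firstHit A ω ∈ C} = ρ C / ρ A := by
  have hset : {ω : ℕ → E | firstHit A ω ∈ C}
      = ⋃ n, {ω | (∀ k < n, ω k ∉ A) ∧ ω n ∈ C} := by
    ext ω
    simp only [Set.mem_ofPred_eq, firstHit_mem_iff hCA, Set.mem_iUnion]
  have hbox : ∀ n, {ω : ℕ → E | (∀ k < n, ω k ∉ A) ∧ ω n ∈ C}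
      = (↑(Finset.range (n + 1)) : Set ℕ).pi (fun k => if k < n then Aᶜ else C) := by
    intro n
    ext ω
    simp only [Set.mem_ofPred_eq, Set.mem_pi, Finset.coe_range, Set.mem_Iio]
    constructor
    · rintro ⟨h1, h2⟩ k hk
      split_ifs with h
      · exact h1 k h
      · obtain rfl : k = n := by omega
        exact h2
    · intro h
      refine ⟨fun k hk => ?_, ?_⟩
      · simpa [hk] using h k (by omega)
      · simpa using h n (by omega)
  have hmeas : ∀ n k : ℕ, MeasurableSet (if k < n then Aᶜ else C) := by
    intro n k
    split_ifs
    exacts [hA.compl, hC]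
  rw [hset, measure_iUnion]
  · have hterm : ∀ n, Measure.infinitePi (fun _ : ℕ => ρ)
        {ω | (∀ k < n, ω k ∉ A) ∧ ω n ∈ C} = (1 - ρ A) ^ n * ρ C := by
      intro n
      rw [hbox, Measure.infinitePi_pi _ (fun k _ => hmeas n k), Finset.prod_range_succ]
      congr 1
      · rw [Finset.prod_congr rfl (g := fun _ => 1 - ρ A)]
        · simp
        · intro k hk
          rw [if_pos (Finset.mem_range.1 hk), prob_compl_eq_one_sub hA]
      · simp
    simp_rw [hterm]
    rw [ENNReal.tsum_mul_right, ENNReal.tsum_geometric,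
      ENNReal.sub_sub_cancel ENNReal.one_ne_top prob_le_one, mul_comm, div_eq_mul_inv]
  · intro m n hmn
    rw [Function.onFun, Set.disjoint_left]
    rintro ω ⟨h1, h2⟩ ⟨h3, h4⟩
    rcases lt_or_gt_of_ne hmn with h | h
    · exact h3 m h (hCA h2)
    · exact h1 n h (hCA h4)
  · intro n
    rw [hbox]
    exact MeasurableSet.pi (Set.to_countable _) fun k _ => hmeas n k

/-! ### Discrete expectations and the `ℓ¹` distance -/

/-- The expectation of `f` under the discrete law `p`. -/
def expect {α : Type*} (p : PMF α) (f : α → ℝ≥0∞) : ℝ≥0∞ := ∑' a, p a * f a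

section expect

variable {α β : Type*}

lemma expect_mono_of_support (p : PMF α) {f g : α → ℝ≥0∞} (h : ∀ a, p a ≠ 0 → f a ≤ g a) :
    expect p f ≤ expect p g := by
  refine ENNReal.tsum_le_tsum fun a => ?_
  by_cases ha : p a = 0
  · simp [ha]
  · gcongr
    exact h a ha

lemma expect_mono (p : PMF α) {f g : α → ℝ≥0∞} (h : ∀ a, f a ≤ g a) :
    expect p f ≤ expect p g :=
  expect_mono_of_support p fun a _ => h a

lemma expect_add (p : PMF α) (f g : α → ℝ≥0∞) :
    expect p (fun a => f a + g a) = expect p f + expect p g := by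
  simp only [expect, mul_add, ENNReal.tsum_add]

lemma expect_finset_sum {κ : Type*} (s : Finset κ) (p : PMF α) (f : κ → α → ℝ≥0∞) :
    expect p (fun a => ∑ k ∈ s, f k a) = ∑ k ∈ s, expect p (f k) := by
  simp only [expect, Finset.mul_sum]
  exact Summable.tsum_finsetSum fun _ _ => ENNReal.summable

lemma expect_const_mul (p : PMF α) (c : ℝ≥0∞) (f : α → ℝ≥0∞) :
    expect p (fun a => c * f a) = c * expect p f := by
  simp only [expect, ← ENNReal.tsum_mul_left]
  exact tsum_congr fun a => by ring

lemma expect_const (p : PMF α) (c : ℝ≥0∞) : expect p (fun _ => c) = c := by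
  simp [expect, ENNReal.tsum_mul_right, p.tsum_coe]

lemma expect_pure (a : α) (f : α → ℝ≥0∞) : expect (PMF.pure a) f = f a := by
  rw [expect, tsum_eq_single a]
  · simp
  · intro b hb
    simp [hb]

lemma expect_bind (p : PMF α) (K : α → PMF β) (f : β → ℝ≥0∞) :
    expect (p.bind K) f = expect p fun a => expect (K a) f := by
  simp only [expect, PMF.bind_apply, ← ENNReal.tsum_mul_left, ← ENNReal.tsum_mul_right]
  rw [ENNReal.tsum_comm]
  exact tsum_congr fun a => tsum_congr fun b => by ring

lemma expect_map (p : PMF α) (g : α → β) (f : β → ℝ≥0∞) :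
    expect (p.map g) f = expect p (f ∘ g) := by
  rw [PMF.map, expect_bind]
  simp [expect_pure, Function.comp_def]

lemma expect_indicator [MeasurableSpace α] [MeasurableSingletonClass α] (p : PMF α) (s : Set α)
    [DecidablePred (· ∈ s)] :
    expect p (fun a => if a ∈ s then 1 else 0) = p.toMeasure s := by
  rw [PMF.toMeasure_apply_eq_tsum, expect]
  refine tsum_congr fun a => ?_
  by_cases h : a ∈ s <;> simp [h]

lemma expect_single [DecidableEq α] (p : PMF α) (a : α) :
    expect p (fun x => if x = a then 1 else 0) = p a := by
  rw [expect, tsum_eq_single a]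
  · simp
  · intro b hb
    simp [hb]

end expect

/-- The absolute difference in `[0,∞]`. -/
def adiff (a b : ℝ≥0∞) : ℝ≥0∞ := (a - b) + (b - a)

lemma adiff_comm (a b : ℝ≥0∞) : adiff a b = adiff b a := add_comm _ _

lemma min_add_adiff (a b : ℝ≥0∞) : min a b + adiff a b = max a b := by
  rcases le_total a b with h | h
  · simp [adiff, h, tsub_eq_zero_of_le h]
  · simp [adiff, h, tsub_eq_zero_of_le h]

lemma le_add_adiff (a b : ℝ≥0∞) : a ≤ b + adiff a b := by
  calc a ≤ b + (a - b) := le_add_tsub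
    _ ≤ b + adiff a b := by gcongr; exact le_self_add

lemma adiff_le_of_le {a b c : ℝ≥0∞} (h1 : a ≤ b + c) (h2 : b ≤ a + c) : adiff a b ≤ c := by
  rcases le_total a b with h | h
  · simpa [adiff, h, tsub_eq_zero_of_le h, add_comm] using h2
  · simpa [adiff, h, tsub_eq_zero_of_le h, add_comm] using h1

/-- The `ℓ¹` distance of two discrete laws (twice the total variation distance). -/
def l1 {α : Type*} (p q : PMF α) : ℝ≥0∞ := ∑' a, adiff (p a) (q a)

lemma l1_comm {α : Type*} (p q : PMF α) : l1 p q = l1 q p :=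
  tsum_congr fun _ => adiff_comm _ _

lemma l1_le_two {α : Type*} (p q : PMF α) : l1 p q ≤ 2 := by
  calc l1 p q ≤ ∑' a, (p a + q a) :=
        ENNReal.tsum_le_tsum fun a => add_le_add tsub_le_self tsub_le_self
    _ = 2 := by rw [ENNReal.tsum_add, p.tsum_coe, q.tsum_coe]; norm_num

/-! ### Simultaneous coupling of finitely many discrete laws -/

section PoissonCoupling

variable {α : Type*}

/-- The subset of `α × ℝ` with sections `S`. -/
def strip (S : α → Set ℝ) : Set (α × ℝ) := {e | e.2 ∈ S e.1}

variable [Countable α] [MeasurableSpace α] [MeasurableSingletonClass α]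

lemma measurableSet_strip {S : α → Set ℝ} (hS : ∀ a, MeasurableSet (S a)) :
    MeasurableSet (strip S) := by
  have : strip S = ⋃ a, {a} ×ˢ S a := by
    ext ⟨a, t⟩
    simp [strip]
  rw [this]
  exact MeasurableSet.iUnion fun a => (measurableSet_singleton a).prod (hS a)

lemma measure_strip {S : α → Set ℝ} (hS : ∀ a, MeasurableSet (S a)) :
    (Measure.count.prod volume) (strip S) = ∑' a, volume (S a) := by
  rw [Measure.prod_apply (measurableSet_strip hS), lintegral_count]
  rfl

lemma measure_strip_Ico (f : α → ℝ≥0∞) (hf : ∀ a, f a ≠ ∞) :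
    (Measure.count.prod volume) (strip fun a => Set.Ico 0 (f a).toReal) = ∑' a, f a := by
  rw [measure_strip fun _ => measurableSet_Ico]
  refine tsum_congr fun a => ?_
  rw [Real.volume_Ico, sub_zero, ENNReal.ofReal_toReal (hf a)]

end PoissonCoupling

theorem exists_pmf_coupling {ι α : Type*} [Finite ι] [Countable α] [DecidableEq α]
    (p : ι → PMF α) :
    ∃ G : PMF (ι → α), (∀ i, G.map (fun t => t i) = p i) ∧
      ∀ i j, expect G (fun t => if t i = t j then 0 else 1) ≤ l1 (p i) (p j) := by
  cases isEmpty_or_nonempty ι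
  · exact ⟨PMF.pure isEmptyElim, fun i => isEmptyElim i, fun i => isEmptyElim i⟩
  let _ : MeasurableSpace α := ⊤
  have hne : ∀ i a, p i a ≠ ∞ := fun i a => PMF.apply_ne_top _ _
  set L : Measure (α × ℝ) := Measure.count.prod volume with hL
  set A : ι → Set (α × ℝ) := fun i => strip fun a => Set.Ico 0 (p i a).toReal with hA
  have hAm : ∀ i, MeasurableSet (A i) := fun i => measurableSet_strip fun _ => measurableSet_Ico
  have hA1 : ∀ i, L (A i) = 1 := fun i => by rw [hL, hA, measure_strip_Ico _ (hne i), (p i).tsum_coe]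
  set U := ⋃ i, A i with hU
  have hUm : MeasurableSet U := MeasurableSet.iUnion hAm
  have hU0 : L U ≠ 0 := by
    have i := Classical.arbitrary ι
    have : 1 ≤ L U := by rw [← hA1 i]; exact measure_mono (Set.subset_iUnion A i)
    exact (zero_lt_one.trans_le this).ne'
  have hUt : L U ≠ ∞ := by
    have := Fintype.ofFinite ι
    refine ne_top_of_le_ne_top ?_ (measure_iUnion_le A)
    rw [tsum_fintype]
    simp [hA1]
  set ρ := ProbabilityTheory.cond L U with hρ
  have : IsProbabilityMeasure ρ := ProbabilityTheory.cond_isProbabilityMeasure_of_finite hU0 hUt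
  have hratio : ∀ C D : Set (α × ℝ), C ⊆ D → D ⊆ U → ρ C / ρ D = L C / L D := by
    intro C D hCD hDU
    rw [hρ, ProbabilityTheory.cond_apply hUm, ProbabilityTheory.cond_apply hUm,
      Set.inter_eq_self_of_subset_right hDU, Set.inter_eq_self_of_subset_right (hCD.trans hDU)]
    exact ENNReal.mul_div_mul_left _ _ (ENNReal.inv_ne_zero.2 hUt) (ENNReal.inv_ne_top.2 hU0)
  set M := Measure.infinitePi (fun _ : ℕ => ρ) with hM
  set T : (ℕ → α × ℝ) → ι → α := fun ω i => (firstHit (A i) ω).1 with hT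
  have hTm : Measurable T :=
    measurable_pi_lambda _ fun i => measurable_fst.comp (measurable_firstHit (hAm i))
  have : IsProbabilityMeasure (M.map T) := Measure.isProbabilityMeasure_map hTm.aemeasurable
  refine ⟨(M.map T).toPMF, fun i => ?_, fun i j => ?_⟩
  · ext a
    have h1 : ((M.map T).toPMF.map (fun t => t i)) a = (M.map T) {t | t i = a} := by
      conv_rhs => rw [← Measure.toPMF_toMeasure (M.map T)]
      rw [← PMF.toMeasure_apply_singleton _ a (measurableSet_singleton a),
        PMF.toMeasure_map_apply _ _ _ (measurable_pi_apply i) (measurableSet_singleton a)]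
      rfl
    set C : Set (α × ℝ) := strip fun b => Set.Ico 0 (if b = a then p i b else 0).toReal with hC
    have hCm : MeasurableSet C := measurableSet_strip fun _ => measurableSet_Ico
    have hCA : C ⊆ A i := by
      rintro ⟨b, t⟩ h
      simp only [hC, strip, Set.mem_ofPred_eq] at h
      simp only [hA, strip, Set.mem_ofPred_eq]
      split_ifs at h with hb
      · exact h
      · simp at h
    have hCiff : ∀ e ∈ A i, e ∈ C ↔ e.1 = a := by
      rintro ⟨b, t⟩ h
      simp only [hA, strip, Set.mem_ofPred_eq] at h
      simp only [hC, strip, Set.mem_ofPred_eq]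
      by_cases hb : b = a
      · simpa [hb] using hb ▸ h
      · simp [hb]
    have hLC : L C = p i a := by
      rw [hL, hC, measure_strip_Ico _ (fun b => by split_ifs <;> simp [hne]), tsum_eq_single a]
      · simp
      · intro b hb; simp [hb]
    have hfull : M {ω | firstHit (A i) ω ∈ A i} = 1 := by
      rw [hM, infinitePi_firstHit_mem ρ (hAm i) (hAm i) subset_rfl, hratio _ _ subset_rfl
        (Set.subset_iUnion A i), hA1]
      simp
    have hCval : M {ω | firstHit (A i) ω ∈ C} = p i a := by
      rw [hM, infinitePi_firstHit_mem ρ (hAm i) hCm hCA, hratio _ _ hCA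
        (Set.subset_iUnion A i), hA1, hLC]
      simp
    have hSm : MeasurableSet {t : ι → α | t i = a} :=
      measurableSet_eq_fun (measurable_pi_apply i) measurable_const
    rw [h1, Measure.map_apply hTm hSm, ← hCval]
    have hae : ∀ᵐ ω ∂M, firstHit (A i) ω ∈ A i := by
      exact (prob_compl_eq_zero_iff (measurable_firstHit (hAm i) (hAm i))).2 hfull
    refine measure_congr ?_
    filter_upwards [hae] with ω hω
    exact propext (hCiff _ hω).symm
  · set m := L (A i ∩ A j) with hm
    set x := L (A i ∪ A j) with hx
    have hmin : m = ∑' a, min (p i a) (p j a) := by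
      rw [hm, hL, ← measure_strip_Ico _ (fun a => ne_top_of_le_ne_top (hne i a) (min_le_left _ _))]
      congr 1
      ext ⟨a, t⟩
      simp only [hA, strip, Set.mem_inter_iff, Set.mem_ofPred_eq, Set.mem_Ico]
      rw [ENNReal.toReal_min (hne i a) (hne j a), lt_min_iff]
      tauto
    have hmax : x = ∑' a, max (p i a) (p j a) := by
      rw [hx, hL, ← measure_strip_Ico _ (fun a => by
        rcases le_total (p i a) (p j a) with h | h <;> simp [h, hne])]
      congr 1
      ext ⟨a, t⟩
      simp only [hA, strip, Set.mem_union, Set.mem_ofPred_eq, Set.mem_Ico]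
      rw [ENNReal.toReal_max (hne i a) (hne j a), lt_max_iff]
      tauto
    have hmx : m + l1 (p i) (p j) = x := by
      rw [hmin, hmax, l1, ← ENNReal.tsum_add]
      exact tsum_congr fun a => min_add_adiff _ _
    have hx1 : 1 ≤ x := by rw [← hA1 i]; exact measure_mono Set.subset_union_left
    have hxt : x ≠ ∞ := by
      refine ne_top_of_le_ne_top ?_ (measure_union_le (μ := L) (A i) (A j))
      simp [hA1]
    have hsub : A i ∪ A j ⊆ U :=
      Set.union_subset (Set.subset_iUnion A i) (Set.subset_iUnion A j)
    have hlow : m / x ≤ M {ω | T ω i = T ω j} := by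
      rw [hm, hx, ← hratio _ _ (Set.inter_subset_left.trans Set.subset_union_left) hsub,
        ← infinitePi_firstHit_mem ρ ((hAm i).union (hAm j)) ((hAm i).inter (hAm j))
          (Set.inter_subset_left.trans Set.subset_union_left)]
      refine measure_mono fun ω hω => ?_
      simp only [Set.mem_ofPred_eq, hT]
      rw [firstHit_eq_of_mem_inter hω]
    have hSm : MeasurableSet {t : ι → α | t i = t j} :=
      measurableSet_eq_fun (measurable_pi_apply i) (measurable_pi_apply j)
    have hval : expect (M.map T).toPMF (fun t => if t i = t j then 0 else 1)
        = 1 - M {ω | T ω i = T ω j} := by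
      have h2 : (fun t : ι → α => if t i = t j then (0 : ℝ≥0∞) else 1)
          = fun t => if t ∈ {t : ι → α | t i = t j}ᶜ then 1 else 0 := by
        ext t
        by_cases h : t i = t j <;> simp [h]
      rw [h2, expect_indicator, Measure.toPMF_toMeasure, prob_compl_eq_one_sub hSm,
        Measure.map_apply hTm hSm]
      rfl
    rw [hval]
    have hx0 : x ≠ 0 := (zero_lt_one.trans_le hx1).ne'
    rw [tsub_le_iff_right]
    calc (1 : ℝ≥0∞) = (m + l1 (p i) (p j)) / x := by rw [hmx, ENNReal.div_self hx0 hxt]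
      _ = m / x + l1 (p i) (p j) / x := ENNReal.add_div
      _ ≤ M {ω | T ω i = T ω j} + l1 (p i) (p j) := by
        gcongr
        exact ENNReal.div_le_of_le_mul (le_mul_of_one_le_right zero_le hx1)
      _ = _ := add_comm _ _

/-! ### Kernels and the `ℓ¹` distance -/

lemma adiff_triangle (a b c : ℝ≥0∞) : adiff a c ≤ adiff a b + adiff b c := by
  refine adiff_le_of_le ?_ ?_
  · calc a ≤ b + adiff a b := le_add_adiff _ _
      _ ≤ (c + adiff b c) + adiff a b := by gcongr; exact le_add_adiff _ _
      _ = _ := by ring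
  · calc c ≤ b + adiff c b := le_add_adiff _ _
      _ ≤ (a + adiff b a) + adiff c b := by gcongr; exact le_add_adiff _ _
      _ = _ := by rw [adiff_comm b a, adiff_comm c b]; ring

lemma mul_adiff {x : ℝ≥0∞} (hx : x ≠ ∞) (a b : ℝ≥0∞) :
    x * adiff a b = adiff (x * a) (x * b) := by
  rw [adiff, adiff, mul_add, ENNReal.mul_sub fun _ _ => hx, ENNReal.mul_sub fun _ _ => hx]

section Kernels

variable {α β : Type*}

lemma min_mul_l1_le {x y : ℝ≥0∞} (hx : x ≠ ∞) (hy : y ≠ ∞) (κ κ' : PMF β) :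
    min x y * l1 κ κ' ≤ (∑' b, adiff (x * κ b) (y * κ' b)) + adiff x y := by
  have key : ∀ (x y : ℝ≥0∞) (κ κ' : PMF β), x ≠ ∞ → 
      x * l1 κ κ' ≤ (∑' b, adiff (x * κ b) (y * κ' b)) + adiff x y := by
    intro x y κ κ' hx
    calc x * l1 κ κ' = ∑' b, adiff (x * κ b) (x * κ' b) := by
          rw [l1, ← ENNReal.tsum_mul_left]
          exact tsum_congr fun b => mul_adiff hx _ _
      _ ≤ ∑' b, (adiff (x * κ b) (y * κ' b) + adiff x y * κ' b) := by
          refine ENNReal.tsum_le_tsum fun b => (adiff_triangle _ (y * κ' b) _).trans ?_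
          gcongr
          rw [adiff_comm x y, mul_comm (adiff y x), mul_adiff (PMF.apply_ne_top _ _), mul_comm y,
            mul_comm x]
      _ = _ := by rw [ENNReal.tsum_add, ENNReal.tsum_mul_left, κ'.tsum_coe, mul_one]
  rcases le_total x y with h | h
  · rw [min_eq_left h]
    exact key x y κ κ' hx
  · rw [min_eq_right h, l1_comm, adiff_comm x y]
    refine (key y x κ' κ hy).trans_eq ?_
    simp only [adiff_comm]

lemma adiff_expect_le (p : PMF α) (f g : α → ℝ≥0∞) :
    adiff (expect p f) (expect p g) ≤ expect p fun a => adiff (f a) (g a) := by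
  refine adiff_le_of_le ?_ ?_
  · rw [← expect_add]
    exact expect_mono p fun a => le_add_adiff _ _
  · rw [← expect_add]
    exact expect_mono p fun a => by rw [adiff_comm]; exact le_add_adiff _ _

lemma l1_bind_le (γ : PMF (α × α)) (K : α → PMF β) :
    l1 ((γ.map Prod.fst).bind K) ((γ.map Prod.snd).bind K)
      ≤ expect γ fun z => l1 (K z.1) (K z.2) := by
  have h : ∀ (g : α × α → α) b, ((γ.map g).bind K) b = expect γ fun z => K (g z) b := by
    intro g b
    rw [PMF.bind_apply]
    exact expect_map γ g fun a => K a b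
  calc l1 ((γ.map Prod.fst).bind K) ((γ.map Prod.snd).bind K)
      ≤ ∑' b, expect γ fun z => adiff (K z.1 b) (K z.2 b) := by
        refine ENNReal.tsum_le_tsum fun b => ?_
        rw [h, h]
        exact adiff_expect_le _ _ _
    _ = _ := by
        simp only [expect, l1, ← ENNReal.tsum_mul_left]
        exact ENNReal.tsum_comm

/-- The product of two discrete laws. -/
def pmfProd (κ : PMF α) (ζ : PMF β) : PMF (α × β) := κ.bind fun a => ζ.map (Prod.mk a)

lemma pmfBindPair_apply (κ : PMF α) (ζ : α → PMF β) (a : α) (b : β) :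
    (κ.bind fun a => (ζ a).map (Prod.mk a)) (a, b) = κ a * ζ a b := by
  classical
  rw [PMF.bind_apply, tsum_eq_single a]
  · rw [PMF.map_apply, tsum_eq_single b]
    · simp
    · intro b' hb'
      simp [hb'.symm]
  · intro a' ha'
    rw [PMF.map_apply]
    simp [ha'.symm]

lemma pmfProd_apply (κ : PMF α) (ζ : PMF β) (a : α) (b : β) :
    pmfProd κ ζ (a, b) = κ a * ζ b :=
  pmfBindPair_apply κ (fun _ => ζ) a b

lemma pmfProd_map_fst (κ : PMF α) (ζ : PMF β) : (pmfProd κ ζ).map Prod.fst = κ := by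
  rw [pmfProd, PMF.map_bind]
  simp only [PMF.map_comp]
  exact (congrArg κ.bind (funext fun a => PMF.map_const ζ a)).trans κ.bind_pure

lemma l1_pmfProd_le (κ κ' : PMF α) (ζ ζ' : PMF β) :
    l1 (pmfProd κ ζ) (pmfProd κ' ζ') ≤ l1 κ κ' + l1 ζ ζ' := by
  have hle : ∀ a b, adiff (pmfProd κ ζ (a, b)) (pmfProd κ' ζ' (a, b))
      ≤ κ a * adiff (ζ b) (ζ' b) + adiff (κ a) (κ' a) * ζ' b := by
    intro a b
    rw [pmfProd_apply, pmfProd_apply]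
    refine (adiff_triangle _ (κ a * ζ' b) _).trans_eq ?_
    rw [mul_adiff (PMF.apply_ne_top _ _), mul_comm (adiff _ _), mul_adiff (PMF.apply_ne_top _ _),
      mul_comm (ζ' b), mul_comm (ζ' b)]
  rw [l1, ENNReal.tsum_prod (f := fun a b => adiff (pmfProd κ ζ (a, b)) (pmfProd κ' ζ' (a, b)))]
  refine (ENNReal.tsum_le_tsum fun a => ENNReal.tsum_le_tsum fun b => hle a b).trans_eq ?_
  simp only [ENNReal.tsum_add, ENNReal.tsum_mul_left, ENNReal.tsum_mul_right, ζ'.tsum_coe,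
    κ.tsum_coe, l1]
  ring

/-- Conditional laws of a discrete law on a product. -/
lemma exists_pmf_cond (p : PMF (α × β)) :
    ∃ κ : α → PMF β, ∀ a b, (p.map Prod.fst) a * κ a b = p (a, b) := by
  classical
  have hfst : ∀ a, (p.map Prod.fst) a = ∑' b, p (a, b) := by
    intro a
    rw [PMF.map_apply, ENNReal.tsum_prod (f := fun x y => if a = x then p (x, y) else 0),
      tsum_eq_single a]
    · simp
    · intro b hb
      simp [hb.symm]
  have h : ∀ a, ∃ κ : PMF β, ∀ b, (p.map Prod.fst) a * κ b = p (a, b) := by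
    intro a
    by_cases h0 : ∑' b, p (a, b) = 0
    · obtain ⟨z, -⟩ := p.support_nonempty
      refine ⟨PMF.pure z.2, fun b => ?_⟩
      rw [hfst, h0, zero_mul, (ENNReal.tsum_eq_zero.1 h0 b)]
    · have ht : ∑' b, p (a, b) ≠ ∞ := by rw [← hfst]; exact PMF.apply_ne_top _ _
      refine ⟨PMF.normalize (fun b => p (a, b)) h0 ht, fun b => ?_⟩
      rw [hfst, PMF.normalize_apply, mul_comm, mul_assoc, ENNReal.inv_mul_cancel h0 ht, mul_one]
  choose κ hκ using h
  exact ⟨κ, hκ⟩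

end Kernels

/-- Extending a coupling of the first marginals of laws `p i` on `H × B` to a coupling of the `p i`. -/
theorem exists_pmf_coupling_extension {ι H B : Type*} [Finite ι] [Countable B]
    [DecidableEq H] [DecidableEq B]
    (p : ι → PMF (H × B)) (π : PMF (ι → H))
    (hπ : ∀ i, π.map (fun t => t i) = (p i).map Prod.fst) :
    ∃ π' : PMF (ι → H × B), π'.map (fun t i => (t i).1) = π ∧
      (∀ i, π'.map (fun t => t i) = p i) ∧
      ∀ i j, expect π' (fun t => if (t i).1 = (t j).1 ∧ (t i).2 ≠ (t j).2 then 1 else 0)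
        ≤ l1 (p i) (p j) + l1 ((p i).map Prod.fst) ((p j).map Prod.fst) := by
  choose κ hκ using fun i => exists_pmf_cond (p i)
  choose G hG1 hG2 using fun t : ι → H => exists_pmf_coupling fun i => κ i (t i)
  refine ⟨π.bind fun t => (G t).map fun b i => (t i, b i), ?_, fun i => ?_, fun i j => ?_⟩
  · rw [PMF.map_bind]
    simp only [PMF.map_comp]
    have : ∀ t : ι → H, (G t).map ((fun (s : ι → H × B) i => (s i).1) ∘ fun b i => (t i, b i))
        = PMF.pure t := fun t => PMF.map_const (G t) t
    simp [this]
  · rw [PMF.map_bind]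
    simp only [PMF.map_comp]
    have : ∀ t : ι → H, (G t).map ((fun s : ι → H × B => s i) ∘ fun b i => (t i, b i))
        = (κ i (t i)).map (Prod.mk (t i)) := by
      intro t
      rw [← hG1 t i, PMF.map_comp]
      rfl
    simp only [this]
    have h2 : (π.bind fun t => (κ i (t i)).map (Prod.mk (t i)))
        = (π.map fun t => t i).bind fun h => (κ i h).map (Prod.mk h) := by
      rw [PMF.bind_map]
      rfl
    rw [h2, hπ]
    ext ⟨h, b⟩
    rw [pmfBindPair_apply, hκ]
  · rw [expect_bind]
    simp only [expect_map, Function.comp_def]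
    set P := (p i).map Prod.fst with hP
    set Q := (p j).map Prod.fst with hQ
    have hstep : ∀ t : ι → H, expect (G t)
          (fun b => if t i = t j ∧ b i ≠ b j then 1 else 0)
        ≤ ∑' h, (if t i = h ∧ t j = h then 1 else 0) * l1 (κ i h) (κ j h) := by
      intro t
      by_cases h : t i = t j
      · rw [tsum_eq_single (t i)]
        · simp only [h, and_self, if_true, one_mul, true_and]
          refine le_trans (le_of_eq ?_) ((hG2 t i j).trans_eq (by rw [h]))
          congr 1
          ext b
          by_cases hb : b i = b j <;> simp [hb]
        · intro b hb
          simp [hb.symm]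
      · simp [h, expect_const]
    calc _ ≤ expect π fun t => ∑' h, (if t i = h ∧ t j = h then 1 else 0) * l1 (κ i h) (κ j h) :=
          expect_mono _ hstep
      _ = ∑' h, (expect π fun t => if t i = h ∧ t j = h then 1 else 0) * l1 (κ i h) (κ j h) := by
          simp only [expect, ← ENNReal.tsum_mul_left, ← ENNReal.tsum_mul_right]
          rw [ENNReal.tsum_comm]
          exact tsum_congr fun _ => tsum_congr fun _ => by ring
      _ ≤ ∑' h, min (P h) (Q h) * l1 (κ i h) (κ j h) := by
          refine ENNReal.tsum_le_tsum fun h => ?_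
          gcongr
          refine le_min ?_ ?_
          · rw [hP, ← hπ, ← expect_single, expect_map]
            refine expect_mono _ fun t => ?_
            by_cases h1 : t i = h <;> by_cases h2 : t j = h <;> simp [h1, h2]
          · rw [hQ, ← hπ, ← expect_single, expect_map]
            refine expect_mono _ fun t => ?_
            by_cases h1 : t i = h <;> by_cases h2 : t j = h <;> simp [h1, h2]
      _ ≤ ∑' h, ((∑' b, adiff (P h * κ i h b) (Q h * κ j h b)) + adiff (P h) (Q h)) :=
          ENNReal.tsum_le_tsum fun h =>
            min_mul_l1_le (PMF.apply_ne_top _ _) (PMF.apply_ne_top _ _) _ _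
      _ = _ := by
          simp only [hP, hQ, hκ]
          rw [ENNReal.tsum_add]
          congr 1
          rw [l1, ENNReal.tsum_prod (f := fun a b => adiff (p i (a, b)) (p j (a, b)))]

/-! ### The hierarchical coupling -/

/-- The expected `ℓ¹` distance, capped at `2`, of the first `l` kernels under `γ`. -/
def kernelDist {A B : Type*} (ζ : ℕ → A → PMF B) (l : ℕ) (γ : PMF (A × A)) : ℝ≥0∞ :=
  expect γ fun z => min 2 (∑ j ∈ Finset.range l, l1 (ζ j z.1) (ζ j z.2))

lemma l1_le_kernelDist {A B H : Type*} {ζ : ℕ → A → PMF B} {l : ℕ} {K : A → PMF H}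
    (hK : ∀ x x', l1 (K x) (K x') ≤ ∑ j ∈ Finset.range l, l1 (ζ j x) (ζ j x'))
    (γ : PMF (A × A)) :
    l1 ((γ.map Prod.fst).bind K) ((γ.map Prod.snd).bind K) ≤ kernelDist ζ l γ :=
  (l1_bind_le γ K).trans (expect_mono γ fun _ => le_min (l1_le_two _ _) (hK _ _))

lemma support_of_map_eq {α β : Type*} {p : PMF α} {f : α → β} {q : PMF β} (h : p.map f = q)
    {a : α} (ha : p a ≠ 0) : q (f a) ≠ 0 := by
  rw [← h, ← PMF.mem_support_iff, PMF.mem_support_map_iff]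
  exact ⟨a, ha, rfl⟩

section Chain

variable {ι : Type*} {A B : Type} [Finite ι] [Countable B]

open Classical in
theorem exists_hierarchical_coupling_aux (p : ι → PMF A) (C : A → A → ℝ≥0∞) (c : ℕ → ℝ≥0∞)
    (ζ : ℕ → A → PMF B) (h0 : ∀ x x', C x x' ≤ c 0)
    (hζ : ∀ l b x x', ζ l x b ≠ 0 → ζ l x' b ≠ 0 → C x x' ≤ c (l + 1)) (l : ℕ) :
    ∃ (H : Type) (_ : Countable H) (K : A → PMF H) (D : H → H → ℝ≥0∞) (π : PMF (ι → H)),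
      (∀ i, π.map (fun t => t i) = (p i).bind K) ∧
      (∀ x x' h h', K x h ≠ 0 → K x' h' ≠ 0 → C x x' ≤ D h h' + if h = h' then c l else 0) ∧
      (∀ x x', l1 (K x) (K x') ≤ ∑ j ∈ Finset.range l, l1 (ζ j x) (ζ j x')) ∧
      ∀ i j, ∀ γ : PMF (A × A), γ.map Prod.fst = p i → γ.map Prod.snd = p j →
        expect π (fun t => D (t i) (t j)) ≤
          ∑ k ∈ Finset.range l, c k * (kernelDist ζ (k + 1) γ + kernelDist ζ k γ) := by
  induction l with
  | zero =>
    refine ⟨Unit, inferInstance, fun _ => PMF.pure (), fun _ _ => 0, PMF.pure fun _ => (),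
      fun i => ?_, fun x x' h h' _ _ => ?_, fun x x' => ?_, fun i j γ _ _ => ?_⟩
    · rw [PMF.pure_map, PMF.bind_const]
    · simpa using h0 x x'
    · simp [l1, adiff]
    · simp [expect]
  | succ l ih =>
    obtain ⟨H, hH, K, D, π, hπ, hD, hK, hE⟩ := ih
    set K' : A → PMF (H × B) := fun x => pmfProd (K x) (ζ l x) with hK'
    have hK'l1 : ∀ x x', l1 (K' x) (K' x') ≤ ∑ j ∈ Finset.range (l + 1), l1 (ζ j x) (ζ j x') := by
      intro x x'
      rw [Finset.sum_range_succ]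
      exact (l1_pmfProd_le _ _ _ _).trans (by gcongr; exact hK x x')
    have hfst : ∀ q : PMF A, (q.bind K').map Prod.fst = q.bind K := by
      intro q
      rw [PMF.map_bind]
      simp only [hK', pmfProd_map_fst]
    obtain ⟨π', hπ'1, hπ'2, hπ'3⟩ := exists_pmf_coupling_extension (fun i => (p i).bind K') π
      (fun i => by rw [hπ, hfst])
    refine ⟨H × B, inferInstance, K', fun h h' => D h.1 h'.1 +
      if h.1 = h'.1 ∧ h.2 ≠ h'.2 then c l else 0, π', hπ'2, ?_, hK'l1, ?_⟩
    · rintro x x' ⟨h, b⟩ ⟨h', b'⟩ hh hh'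
      rw [hK', pmfProd_apply, mul_ne_zero_iff] at hh hh'
      have hDx := hD x x' h h' hh.1 hh'.1
      by_cases hhh : h = h'
      · by_cases hb : b = b'
        · subst hhh hb
          simpa using (hζ l b x x' hh.2 hh'.2).trans le_add_self
        · simpa [hhh, hb] using hDx
      · simpa [hhh] using hDx
    · intro i j γ hγ1 hγ2
      rw [expect_add, Finset.sum_range_succ]
      have e1 : expect π' (fun t => D (t i).1 (t j).1) = expect π (fun t => D (t i) (t j)) := by
        rw [← hπ'1, expect_map]
        rfl
      rw [e1]
      refine add_le_add (hE i j γ hγ1 hγ2) ?_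
      calc expect π' (fun t => if (t i).1 = (t j).1 ∧ (t i).2 ≠ (t j).2 then c l else 0)
          = c l * expect π'
              (fun t => if (t i).1 = (t j).1 ∧ (t i).2 ≠ (t j).2 then 1 else 0) := by
            rw [← expect_const_mul]
            simp only [mul_ite, mul_one, mul_zero]
        _ ≤ c l * (kernelDist ζ (l + 1) γ + kernelDist ζ l γ) := by
            gcongr
            refine (hπ'3 i j).trans ?_
            rw [hfst, hfst, ← hγ1, ← hγ2]
            exact add_le_add (l1_le_kernelDist hK'l1 γ) (l1_le_kernelDist hK γ)

theorem exists_hierarchical_coupling [Countable A] (p : ι → PMF A) (C : A → A → ℝ≥0∞) (c : ℕ → ℝ≥0∞)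
    (ζ : ℕ → A → PMF B) (h0 : ∀ x x', C x x' ≤ c 0)
    (hζ : ∀ l b x x', ζ l x b ≠ 0 → ζ l x' b ≠ 0 → C x x' ≤ c (l + 1)) (L : ℕ) :
    ∃ π : PMF (ι → A), (∀ i, π.map (fun t => t i) = p i) ∧
      ∀ i j, ∀ γ : PMF (A × A), γ.map Prod.fst = p i → γ.map Prod.snd = p j →
        expect π (fun t => C (t i) (t j)) ≤
          ∑ k ∈ Finset.range L, c k * (kernelDist ζ (k + 1) γ + kernelDist ζ k γ) + c L := by
  classical
  obtain ⟨H, hH, K, D, π, hπ, hD, -, hE⟩ := exists_hierarchical_coupling_aux p C c ζ h0 hζ L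
  set q : ι → PMF (H × A) := fun i => ((p i).bind fun x => (K x).map (Prod.mk x)).map Prod.swap
    with hq
  have hfst : ∀ i, (q i).map Prod.fst = (p i).bind K := by
    intro i
    rw [hq, PMF.map_comp, PMF.map_bind]
    simp only [PMF.map_comp]
    exact congrArg (p i).bind (funext fun a => (K a).map_id)
  have hsnd : ∀ i, (q i).map Prod.snd = p i := by
    intro i
    rw [hq, PMF.map_comp, PMF.map_bind]
    simp only [PMF.map_comp]
    exact (congrArg (p i).bind (funext fun a => PMF.map_const (K a) a)).trans (p i).bind_pure
  have hsupp : ∀ i z, q i z ≠ 0 → K z.2 z.1 ≠ 0 := by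
    intro i z hz
    rw [hq, ← PMF.mem_support_iff, PMF.mem_support_map_iff] at hz
    obtain ⟨⟨x, h⟩, hxh, rfl⟩ := hz
    rw [PMF.mem_support_iff, pmfBindPair_apply, mul_ne_zero_iff] at hxh
    exact hxh.2
  obtain ⟨π', hπ'1, hπ'2, -⟩ := exists_pmf_coupling_extension q π fun i => by rw [hπ, hfst]
  refine ⟨π'.map fun t i => (t i).2, fun i => ?_, fun i j γ hγ1 hγ2 => ?_⟩
  · rw [← hsnd, ← hπ'2, PMF.map_comp, PMF.map_comp]
    rfl
  · rw [expect_map]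
    calc expect π' ((fun t => C (t i) (t j)) ∘ fun t i => (t i).2)
        ≤ expect π' (fun t => D (t i).1 (t j).1 + c L) := by
          refine expect_mono_of_support _ fun t ht => ?_
          refine (hD _ _ _ _ (hsupp i _ (support_of_map_eq (hπ'2 i) ht))
            (hsupp j _ (support_of_map_eq (hπ'2 j) ht))).trans ?_
          gcongr
          split_ifs <;> simp
      _ = expect π (fun t => D (t i) (t j)) + c L := by
          rw [expect_add, expect_const, ← hπ'1, expect_map]
          rfl
      _ ≤ _ := by
          gcongr
          exact hE i j γ hγ1 hγ2

end Chain

/-! ### Sums over geometric scales -/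

lemma sum_geom_below_le {β b : ℝ} (hβ0 : 0 ≤ β) (hβ1 : β < 1) (hb : 0 ≤ b) (N : ℕ) :
    ∀ x : ℝ, 0 ≤ x →
      ∑ n ∈ Finset.range N, (if x * β ^ n ≤ b then x * β ^ n else 0) ≤ b / (1 - β) := by
  have h1β : 0 < 1 - β := sub_pos.2 hβ1
  induction N with
  | zero => intro x _; simpa using div_nonneg hb h1β.le
  | succ N ih =>
    intro x hx
    by_cases hxb : x ≤ b
    · calc ∑ n ∈ Finset.range (N + 1), (if x * β ^ n ≤ b then x * β ^ n else 0)
          ≤ ∑ n ∈ Finset.range (N + 1), x * β ^ n := by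
            refine Finset.sum_le_sum fun n _ => ?_
            split_ifs
            · exact le_rfl
            · positivity
        _ = x * ∑ n ∈ Finset.range (N + 1), β ^ n := by rw [Finset.mul_sum]
        _ ≤ b * (1 - β)⁻¹ := by
            gcongr
            rw [← tsum_geometric_of_lt_one hβ0 hβ1]
            exact (summable_geometric_of_lt_one hβ0 hβ1).sum_le_tsum _ fun _ _ => by positivity
        _ = b / (1 - β) := (div_eq_mul_inv _ _).symm
    · rw [Finset.sum_range_succ']
      have := ih (x * β) (by positivity)
      simp only [pow_succ', ← mul_assoc, pow_zero, mul_one, if_neg hxb, add_zero]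
      exact this

lemma sum_geom_above_le {β b : ℝ} (hβ0 : 0 < β) (hβ1 : β < 1) (hb : 0 ≤ b) (N : ℕ)
    {x : ℝ} (hx : 0 ≤ x) :
    ∑ n ∈ Finset.range N, (if x * β⁻¹ ^ n ≤ b then x * β⁻¹ ^ n else 0) ≤ b / (1 - β) := by
  rw [← Finset.sum_range_reflect]
  refine le_trans (le_of_eq ?_)
    (sum_geom_below_le hβ0.le hβ1 hb N (x * β⁻¹ ^ (N - 1)) (by positivity))
  refine Finset.sum_congr rfl fun n hn => ?_
  have hn' := Finset.mem_range.1 hn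
  have : x * β⁻¹ ^ (N - 1 - n) = x * β⁻¹ ^ (N - 1) * β ^ n := by
    rw [pow_sub₀ _ (inv_ne_zero hβ0.ne') (by omega), inv_pow β n, inv_inv, mul_assoc]
  rw [this]

lemma sum_rpow_mul_min_le {q ρ W a : ℝ} (hq0 : 0 < q) (hq1 : q < 1) (hρ : 1 < ρ) (hW : 0 < W)
    (ha : 0 ≤ a) (N : ℕ) :
    ∑ n ∈ Finset.range N, (W * ρ⁻¹ ^ n) ^ q * min 1 (a / (W * ρ⁻¹ ^ n))
      ≤ a ^ q * (1 / (1 - ρ ^ (-q)) + 1 / (1 - ρ ^ (-(1 - q)))) := by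
  have hρ0 : 0 < ρ := one_pos.trans hρ
  have hβ1 : ρ ^ (-q) < 1 := Real.rpow_lt_one_of_one_lt_of_neg hρ (by linarith)
  have hβ2 : ρ ^ (-(1 - q)) < 1 := Real.rpow_lt_one_of_one_lt_of_neg hρ (by linarith)
  rcases ha.eq_or_lt with rfl | ha
  · simp [Real.zero_rpow hq0.ne']
  have hv : ∀ n : ℕ, 0 < W * ρ⁻¹ ^ n := fun n => by positivity
  have hpow : ∀ (s : ℝ) (n : ℕ), (W * ρ⁻¹ ^ n) ^ s = W ^ s * (ρ ^ (-s)) ^ n := by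
    intro s n
    rw [Real.mul_rpow hW.le (by positivity), ← Real.rpow_natCast, ← Real.rpow_natCast,
      ← Real.rpow_mul (by positivity), ← Real.rpow_mul hρ0.le, Real.inv_rpow hρ0.le,
      ← Real.rpow_neg hρ0.le]
    congr 2
    ring
  have hterm : ∀ n : ℕ, (W * ρ⁻¹ ^ n) ^ q * min 1 (a / (W * ρ⁻¹ ^ n))
      ≤ (if W ^ q * (ρ ^ (-q)) ^ n ≤ a ^ q then W ^ q * (ρ ^ (-q)) ^ n else 0)
        + a * (if W ^ (q - 1) * ((ρ ^ (-(1 - q)))⁻¹) ^ n ≤ a ^ (q - 1)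
            then W ^ (q - 1) * ((ρ ^ (-(1 - q)))⁻¹) ^ n else 0) := by
    intro n
    have hinv : (ρ ^ (-(1 - q)))⁻¹ = ρ ^ (-(q - 1)) := by
      rw [← Real.rpow_neg hρ0.le]; congr 1; ring
    rw [hinv, ← hpow, ← hpow]
    set v := W * ρ⁻¹ ^ n with hvdef
    have hv0 : 0 < v := hv n
    by_cases hva : v ≤ a
    · rw [if_pos (Real.rpow_le_rpow hv0.le hva hq0.le)]
      have h1 : v ^ q * min 1 (a / v) ≤ v ^ q :=
        mul_le_of_le_one_right (by positivity) (min_le_left _ _)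
      refine h1.trans (le_add_of_nonneg_right ?_)
      split_ifs <;> positivity
    · push Not at hva
      rw [if_pos (c := v ^ (q - 1) ≤ a ^ (q - 1))
        (Real.rpow_le_rpow_of_nonpos ha hva.le (by linarith))]
      have h1 : v ^ q * min 1 (a / v) ≤ a * v ^ (q - 1) := by
        calc v ^ q * min 1 (a / v) ≤ v ^ q * (a / v) := by gcongr; exact min_le_right _ _
          _ = a * v ^ (q - 1) := by rw [Real.rpow_sub_one hv0.ne']; ring
      refine h1.trans (le_add_of_nonneg_left ?_)
      split_ifs <;> positivity
  calc ∑ n ∈ Finset.range N, (W * ρ⁻¹ ^ n) ^ q * min 1 (a / (W * ρ⁻¹ ^ n))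
      ≤ _ := Finset.sum_le_sum fun n _ => hterm n
    _ ≤ a ^ q / (1 - ρ ^ (-q)) + a * (a ^ (q - 1) / (1 - ρ ^ (-(1 - q)))) := by
        rw [Finset.sum_add_distrib, ← Finset.mul_sum]
        gcongr
        · exact sum_geom_below_le (by positivity) hβ1 (by positivity) N _ (by positivity)
        · exact sum_geom_above_le (by positivity) hβ2 (by positivity) N (by positivity)
    _ = _ := by
        rw [Real.rpow_sub_one ha.ne']
        field_simp

lemma one_div_one_sub_exp_neg_le {t : ℝ} (ht : 0 < t) : 1 / (1 - Real.exp (-t)) ≤ 1 + 1 / t := by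
  have h1 : Real.exp (-t) ≤ 1 / (1 + t) := by
    rw [Real.exp_neg, ← one_div]
    exact one_div_le_one_div_of_le (by linarith) (by linarith [Real.add_one_le_exp t])
  have h2 : 1 - 1 / (1 + t) = t / (1 + t) := by field_simp; ring
  calc 1 / (1 - Real.exp (-t)) ≤ 1 / (t / (1 + t)) :=
        one_div_le_one_div_of_le (by positivity) (by linarith)
    _ = 1 + 1 / t := by field_simp; ring

lemma sum_geom_le_last {r : ℝ} (hr : 1 < r) (k : ℕ) :
    ∑ i ∈ Finset.range (k + 1), r ^ i ≤ r / (r - 1) * r ^ k := by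
  have h : 0 < r - 1 := sub_pos.2 hr
  rw [geom_sum_eq hr.ne', div_mul_eq_mul_div]
  gcongr
  rw [pow_succ']
  linarith

lemma sum_range_mul_add {m : ℕ} (F : ℕ → ℝ) (L : ℕ) :
    ∑ j ∈ Finset.range m, ∑ k ∈ Finset.range L, F (m * k + j)
      = ∑ n ∈ Finset.range (m * L), F n := by
  induction L with
  | zero => simp
  | succ L ih =>
    simp only [Finset.sum_range_succ, Finset.sum_add_distrib, ih, Nat.mul_succ,
      Finset.sum_range_add]

/-- The cost bound at each level of the hierarchy with scales `w`. -/
def levelCost (q M : ℝ) (w : ℕ → ℝ) : ℕ → ℝ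
  | 0 => M
  | k + 1 => (2.002 * w k) ^ q

/-- The bound on the capped `ℓ¹` distance accumulated in the first `k` levels. -/
def levelDist (Ψ D : ℝ) (w : ℕ → ℝ) (k : ℕ) : ℝ :=
  min 2 (∑ i ∈ Finset.range k, 2 * Ψ * D / w i)

lemma sum_levelCost_le {q Ψ M D w0 r : ℝ} (hΨ : 0 < Ψ) (hM : 0 ≤ M) (hD : 0 ≤ D)
    (hw0 : 0 < w0) (hr : 1 < r) (L : ℕ) :
    ∑ k ∈ Finset.range (L + 1), levelCost q M (fun i => w0 * r⁻¹ ^ i) k *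
        (levelDist Ψ D (fun i => w0 * r⁻¹ ^ i) (k + 1) + levelDist Ψ D (fun i => w0 * r⁻¹ ^ i) k)
      ≤ 2 * M * min 1 (r / (r - 1) * Ψ * D / w0)
        + 2.002 ^ q * 2 * (r ^ q + 1) * ∑ k ∈ Finset.range (L + 1),
          (w0 * r⁻¹ ^ k) ^ q * min 1 (r / (r - 1) * Ψ * D / (w0 * r⁻¹ ^ k)) := by
  have hr0 : 0 < r := one_pos.trans hr
  have hr1 : 0 < r - 1 := sub_pos.2 hr
  set w : ℕ → ℝ := fun i => w0 * r⁻¹ ^ i with hw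
  have hwpos : ∀ i, 0 < w i := fun i => by positivity
  set a := r / (r - 1) * Ψ * D with ha
  have ha0 : 0 ≤ a := by positivity
  set g : ℕ → ℝ := fun k => min 1 (a / w k) with hg
  have hg0 : ∀ k, 0 ≤ g k := fun k => le_min zero_le_one (div_nonneg ha0 (hwpos k).le)
  have hdist : ∀ k, levelDist Ψ D w (k + 1) ≤ 2 * g k := by
    intro k
    have hsum : ∑ i ∈ Finset.range (k + 1), 2 * Ψ * D / w i ≤ 2 * (a / w k) := by
      have h1 : ∀ i, 2 * Ψ * D / w i = 2 * Ψ * D / w0 * r ^ i := by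
        intro i
        simp only [hw, inv_pow]
        field_simp
      calc ∑ i ∈ Finset.range (k + 1), 2 * Ψ * D / w i
          = 2 * Ψ * D / w0 * ∑ i ∈ Finset.range (k + 1), r ^ i := by
            rw [Finset.mul_sum]; exact Finset.sum_congr rfl fun i _ => h1 i
        _ ≤ 2 * Ψ * D / w0 * (r / (r - 1) * r ^ k) := by
            gcongr
            exact sum_geom_le_last hr k
        _ = 2 * (a / w k) := by
            simp only [hw, ha, inv_pow]
            field_simp
    rw [levelDist, hg, mul_min_of_nonneg _ _ zero_le_two, mul_one]
    exact min_le_min le_rfl hsum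
  have hdist0 : levelDist Ψ D w 0 = 0 := by simp [levelDist]
  have hK : (0 : ℝ) ≤ 2.002 ^ q := by positivity
  have hstep : ∀ k, w k ^ q = r ^ q * w (k + 1) ^ q := by
    intro k
    rw [← Real.mul_rpow hr0.le (hwpos _).le]
    congr 1
    simp only [hw, pow_succ]
    field_simp
  set G := ∑ k ∈ Finset.range (L + 1), w k ^ q * g k with hG
  have hG1 : ∑ k ∈ Finset.range L, w k ^ q * g k ≤ G := by
    rw [hG, Finset.sum_range_succ]
    have := hwpos L
    have := hg0 L
    exact le_add_of_nonneg_right (by positivity)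
  have hG2 : ∑ k ∈ Finset.range L, w (k + 1) ^ q * g (k + 1) ≤ G := by
    rw [hG, Finset.sum_range_succ']
    have := hwpos 0
    have := hg0 0
    exact le_add_of_nonneg_right (by positivity)
  rw [Finset.sum_range_succ', hdist0, add_zero, add_comm]
  refine add_le_add ?_ ?_
  · change M * _ ≤ _
    calc M * levelDist Ψ D w (0 + 1) ≤ M * (2 * g 0) := by gcongr; exact hdist 0
      _ = 2 * M * min 1 (a / w0) := by simp only [hg, hw]; simp; ring
  · calc ∑ k ∈ Finset.range L, levelCost q M w (k + 1) *
          (levelDist Ψ D w (k + 1 + 1) + levelDist Ψ D w (k + 1))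
        ≤ ∑ k ∈ Finset.range L, 2.002 ^ q * 2 *
            (r ^ q * (w (k + 1) ^ q * g (k + 1)) + w k ^ q * g k) := by
          refine Finset.sum_le_sum fun k _ => ?_
          have h1 : levelCost q M w (k + 1) = 2.002 ^ q * w k ^ q := by
            rw [levelCost, Real.mul_rpow (by norm_num) (hwpos k).le]
          rw [h1]
          have := hwpos k
          calc 2.002 ^ q * w k ^ q * (levelDist Ψ D w (k + 1 + 1) + levelDist Ψ D w (k + 1))
              ≤ 2.002 ^ q * w k ^ q * (2 * g (k + 1) + 2 * g k) := by
                gcongr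
                exacts [hdist _, hdist _]
            _ = 2.002 ^ q * 2 * (w k ^ q * g (k + 1) + w k ^ q * g k) := by ring
            _ = _ := by
                congr 2
                rw [hstep k]
                ring
      _ = 2.002 ^ q * 2 * (r ^ q * ∑ k ∈ Finset.range L, w (k + 1) ^ q * g (k + 1)
            + ∑ k ∈ Finset.range L, w k ^ q * g k) := by
          rw [← Finset.mul_sum, Finset.sum_add_distrib, ← Finset.mul_sum]
      _ ≤ 2.002 ^ q * 2 * (r ^ q * G + G) := by gcongr
      _ = 2.002 ^ q * 2 * (r ^ q + 1) * G := by ring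

lemma log_scale_gt : 5 / 3 < Real.log 5.3 := by
  rw [Real.lt_log_iff_exp_lt (by norm_num)]
  have h1 : Real.exp (5 / 3) ^ 3 < 5.3 ^ 3 := by
    rw [← Real.exp_nat_mul]
    have : ((3 : ℕ) : ℝ) * (5 / 3) = (5 : ℕ) * 1 := by norm_num
    rw [this, Real.exp_nat_mul]
    calc Real.exp 1 ^ 5 < 2.7182818286 ^ 5 := by
          gcongr
          exact Real.exp_one_lt_d9
      _ < 5.3 ^ 3 := by norm_num
  exact lt_of_pow_lt_pow_left₀ 3 (by norm_num) h1

/-- The choice of scales: `m` interleaved geometric sequences of `L` scales. -/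
theorem exists_scales {q Ψ : ℝ} (hq0 : 0 < q) (hq1 : q < 1) (hΨ : 0 < Ψ) :
    ∃ R : ℝ, 0 ≤ R ∧ R < 7.56 * (2.47 * Ψ) ^ q / (1 - q) ∧ ∀ M δ : ℝ, 0 ≤ M → 0 < δ →
      ∃ (m : ℕ) (w : ℕ → ℕ → ℝ) (L : ℕ), 0 < m ∧ (∀ j k, 0 < w j k) ∧
        (∀ j < m, levelCost q M (w j) L ≤ δ) ∧
        ∀ D : ℝ, 0 ≤ D → ∑ j ∈ Finset.range m, ∑ k ∈ Finset.range L,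
          levelCost q M (w j) k * (levelDist Ψ D (w j) (k + 1) + levelDist Ψ D (w j) k)
            ≤ m * (R * D ^ q) := by
  have h1q : 0 < 1 - q := sub_pos.2 hq1
  set τ := Real.log 5.3 with hτ
  have hτ53 : 5 / 3 < τ := log_scale_gt
  have hτ0 : 0 < τ := by linarith
  set B := (2.47 * Ψ) ^ q with hB
  have hB0 : 0 < B := by positivity
  have hlt : B * 12.6 * (1 / ((1 - q) * τ)) < 7.56 * B / (1 - q) := by
    rw [show B * 12.6 * (1 / ((1 - q) * τ)) = B / (1 - q) * (12.6 / τ) by field_simp,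
      show 7.56 * B / (1 - q) = B / (1 - q) * 7.56 by ring]
    gcongr
    rw [div_lt_iff₀ hτ0]
    linarith
  obtain ⟨m, hm0, hm⟩ : ∃ m : ℕ, 0 < m ∧
      B * 12.6 * (2 / m + 1 / ((1 - q) * τ)) < 7.56 * B / (1 - q) := by
    have ht : Filter.Tendsto (fun m : ℕ => B * 12.6 * (2 / (m : ℝ) + 1 / ((1 - q) * τ)))
        Filter.atTop (nhds (B * 12.6 * (0 + 1 / ((1 - q) * τ)))) :=
      ((tendsto_const_div_atTop_nhds_zero_nat 2).add_const _).const_mul _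
    rw [zero_add] at ht
    obtain ⟨m, h1, h2⟩ := ((ht.eventually_lt_const hlt).and (Filter.eventually_gt_atTop 0)).exists
    exact ⟨m, h2, h1⟩
  obtain ⟨R, hR1, hR2⟩ := exists_between hm
  have hm0' : (0 : ℝ) < m := by exact_mod_cast hm0
  set η := R - B * 12.6 * (2 / m + 1 / ((1 - q) * τ)) with hη
  have hη0 : 0 < η := sub_pos.2 hR1
  refine ⟨R, le_trans (by positivity) hR1.le, hR2, fun M δ hM hδ => ?_⟩
  set ρ := Real.exp (τ / (q * m)) with hρ
  have hρ1 : 1 < ρ := Real.one_lt_exp_iff.2 (by positivity)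
  have hρ0 : 0 < ρ := Real.exp_pos _
  set r := ρ ^ m with hr
  have hrq : r ^ q = 5.3 := by
    rw [hr, hρ, ← Real.exp_nat_mul, ← Real.exp_mul]
    rw [show (m : ℝ) * (τ / (q * m)) * q = τ by field_simp]
    exact Real.exp_log (by norm_num)
  have hr53 : 5.3 ≤ r := by
    rw [hr, hρ, ← Real.exp_nat_mul, show (m : ℝ) * (τ / (q * m)) = τ / q by field_simp]
    calc (5.3 : ℝ) = Real.exp τ := (Real.exp_log (by norm_num)).symm
      _ ≤ _ := Real.exp_le_exp.2 (le_div_self hτ0.le hq0 hq1.le)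
  have hr1 : 1 < r := by linarith
  have hr10 : 0 < r - 1 := by linarith
  set S := r / (r - 1) with hS
  have hS0 : 0 < S := by positivity
  have hS2 : 2.002 * S ≤ 2.47 := by
    rw [hS, ← mul_div_assoc, div_le_iff₀ hr10]
    linarith
  obtain ⟨W, hW0, hW⟩ : ∃ W : ℝ, 0 < W ∧ 2 * M * (S * Ψ) ^ q / (W * ρ⁻¹ ^ m) ^ q ≤ η := by
    have hlim : Filter.Tendsto (fun W : ℝ => 2 * M * (S * Ψ) ^ q / (W * ρ⁻¹ ^ m) ^ q)
        Filter.atTop (nhds 0) :=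
      Filter.Tendsto.const_div_atTop ((tendsto_rpow_atTop hq0).comp
        (Filter.tendsto_id.atTop_mul_const (by positivity))) _
    obtain ⟨W, h1, h2⟩ :=
      ((hlim.eventually_le_const hη0).and (Filter.eventually_gt_atTop 0)).exists
    exact ⟨W, h2, h1⟩
  set w : ℕ → ℕ → ℝ := fun j k => (W * ρ⁻¹ ^ j) * r⁻¹ ^ k with hw
  have hwn : ∀ j k, w j k = W * ρ⁻¹ ^ (m * k + j) := by
    intro j k
    simp only [hw, hr]
    rw [pow_add, pow_mul, inv_pow ρ m]
    ring
  obtain ⟨L, hL⟩ : ∃ L : ℕ, (2.002 * (W * r⁻¹ ^ L)) ^ q ≤ δ := by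
    have h0 : Filter.Tendsto (fun L : ℕ => 2.002 * (W * r⁻¹ ^ L)) Filter.atTop
        (nhds (2.002 * (W * 0))) :=
      ((tendsto_pow_atTop_nhds_zero_of_lt_one (by positivity)
        (inv_lt_one_of_one_lt₀ hr1)).const_mul _).const_mul _
    have h1 := h0.rpow_const (p := q) (Or.inr hq0.le)
    rw [mul_zero, mul_zero, Real.zero_rpow hq0.ne'] at h1
    exact (h1.eventually_le_const hδ).exists
  refine ⟨m, w, L + 1, hm0, fun j k => by positivity, fun j _ => ?_, fun D hD => ?_⟩
  · change (2.002 * w j L) ^ q ≤ δ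
    refine le_trans ?_ hL
    gcongr
    simp only [hw]
    gcongr
    exact mul_le_of_le_one_right hW0.le
      (pow_le_one₀ (by positivity) (inv_le_one_of_one_le₀ hρ1.le))
  · set a := S * Ψ * D with ha
    have ha0 : 0 ≤ a := by positivity
    have haq : a ^ q = (S * Ψ) ^ q * D ^ q := Real.mul_rpow (by positivity) hD
    have hfirst : ∀ j ∈ Finset.range m,
        2 * M * min 1 (a / (W * ρ⁻¹ ^ j)) ≤ η * D ^ q := by
      intro j hj
      have hjm := (Finset.mem_range.1 hj).le
      have hmin : min 1 (a / (W * ρ⁻¹ ^ j)) ≤ (a / (W * ρ⁻¹ ^ m)) ^ q := by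
        have hle : a / (W * ρ⁻¹ ^ j) ≤ a / (W * ρ⁻¹ ^ m) := by
          exact div_le_div_of_nonneg_left ha0 (by positivity) (mul_le_mul_of_nonneg_left
            (pow_le_pow_of_le_one (by positivity) (inv_le_one_of_one_le₀ hρ1.le) hjm) hW0.le)
        refine (min_le_min le_rfl hle).trans ?_
        have hx : 0 ≤ a / (W * ρ⁻¹ ^ m) := by positivity
        rcases le_total 1 (a / (W * ρ⁻¹ ^ m)) with h | h
        · exact (min_le_left _ _).trans (Real.one_le_rpow h hq0.le)
        · refine (min_le_right _ _).trans ?_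
          exact Real.self_le_rpow_of_le_one hx h hq1.le
      calc 2 * M * min 1 (a / (W * ρ⁻¹ ^ j)) ≤ 2 * M * (a / (W * ρ⁻¹ ^ m)) ^ q := by gcongr
        _ = 2 * M * (S * Ψ) ^ q / (W * ρ⁻¹ ^ m) ^ q * D ^ q := by
          rw [Real.div_rpow ha0 (by positivity), haq]; ring
        _ ≤ _ := by gcongr
    have hsum : ∑ j ∈ Finset.range m, ∑ k ∈ Finset.range (L + 1),
        (w j k) ^ q * min 1 (a / w j k) ≤ a ^ q * (2 + m / ((1 - q) * τ)) := by
      simp only [hwn]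
      rw [sum_range_mul_add fun n => (W * ρ⁻¹ ^ n) ^ q * min 1 (a / (W * ρ⁻¹ ^ n))]
      refine (sum_rpow_mul_min_le hq0 hq1 hρ1 hW0 ha0 _).trans ?_
      refine mul_le_mul_of_nonneg_left ?_ (by positivity)
      have e1 : ρ ^ (-q) = Real.exp (-(τ / m)) := by
        rw [hρ, ← Real.exp_mul]; congr 1; field_simp
      have e2 : ρ ^ (-(1 - q)) = Real.exp (-((1 - q) * τ / (q * m))) := by
        rw [hρ, ← Real.exp_mul]; congr 1; field_simp
      rw [e1, e2]
      refine (add_le_add (one_div_one_sub_exp_neg_le (by positivity))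
        (one_div_one_sub_exp_neg_le (by positivity))).trans_eq ?_
      field_simp
      ring
    calc _ ≤ ∑ j ∈ Finset.range m, (η * D ^ q + 2.002 ^ q * 12.6 * ∑ k ∈ Finset.range (L + 1),
          (w j k) ^ q * min 1 (a / w j k)) := by
          refine Finset.sum_le_sum fun j hj => ?_
          have := sum_levelCost_le (q := q) (w0 := W * ρ⁻¹ ^ j) hΨ hM hD (by positivity) hr1 L
          refine this.trans ?_
          refine add_le_add (hfirst j hj) (le_of_eq ?_)
          rw [hrq, show (2.002 : ℝ) ^ q * 2 * (5.3 + 1) = 2.002 ^ q * 12.6 by ring]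
      _ = m * (η * D ^ q) + 2.002 ^ q * 12.6 * ∑ j ∈ Finset.range m,
            ∑ k ∈ Finset.range (L + 1), (w j k) ^ q * min 1 (a / w j k) := by
          simp only [Finset.sum_add_distrib, Finset.sum_const, Finset.card_range, nsmul_eq_mul,
            ← Finset.mul_sum]
      _ ≤ m * (η * D ^ q) + 2.002 ^ q * 12.6 * (a ^ q * (2 + m / ((1 - q) * τ))) := by gcongr
      _ = m * (η * D ^ q) + (2.002 * S * Ψ) ^ q * (12.6 * (2 + m / ((1 - q) * τ))) * D ^ q := by
          rw [haq, mul_assoc 2.002 S Ψ, Real.mul_rpow (x := 2.002) (y := S * Ψ) (by norm_num)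
            (by positivity)]
          ring
      _ ≤ m * (η * D ^ q) + B * (12.6 * (2 + m / ((1 - q) * τ))) * D ^ q := by
          gcongr
          rw [hB]
          gcongr
      _ = m * (R * D ^ q) := by
          rw [hη]
          field_simp
          ring

/-! ### Discretized uniform laws on balls -/

lemma l1_eq_two_mul_tsum_sub {α : Type*} (p q : PMF α) : l1 p q = 2 * ∑' a, (p a - q a) := by
  have h : ∀ p q : PMF α, ∑' a, (p a - q a) + 1 = ∑' a, max (p a) (q a) := by
    intro p q
    rw [← q.tsum_coe, ← ENNReal.tsum_add]
    exact tsum_congr fun a => tsub_add_eq_max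
  have hsymm : ∑' a, (p a - q a) = ∑' a, (q a - p a) := by
    refine (ENNReal.add_left_inj ENNReal.one_ne_top).1 ?_
    rw [h, h]
    simp only [max_comm]
  simp only [l1, adiff]
  rw [ENNReal.tsum_add, ← hsymm, two_mul]

lemma toPMF_map_apply {Ω : Type*} [MeasurableSpace Ω] {ν : Measure Ω} [IsProbabilityMeasure ν]
    {α : Type*} [Countable α] [MeasurableSpace α] [MeasurableSingletonClass α]
    {g : Ω → α} (hg : Measurable g) [IsProbabilityMeasure (ν.map g)] (a : α) :
    (ν.map g).toPMF a = ν (g ⁻¹' {a}) := by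
  rw [Measure.toPMF_apply, Measure.map_apply hg (measurableSet_singleton a)]

lemma expect_toPMF_map {Ω : Type*} [MeasurableSpace Ω] {ν : Measure Ω} [IsProbabilityMeasure ν]
    {α : Type*} [Countable α] [MeasurableSpace α] [MeasurableSingletonClass α]
    {g : Ω → α} (hg : Measurable g) [IsProbabilityMeasure (ν.map g)] (f : α → ℝ≥0∞) :
    expect (ν.map g).toPMF f = ∫⁻ ω, f (g ω) ∂ν := by
  rw [← lintegral_map (measurable_of_countable f) hg, lintegral_countable', expect]
  refine tsum_congr fun a => ?_
  rw [Measure.toPMF_apply, mul_comm]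

lemma lintegral_pmf_toMeasure {α : Type*} [Countable α] [MeasurableSpace α]
    [MeasurableSingletonClass α] (p : PMF α) (f : α → ℝ≥0∞) :
    ∫⁻ a, f a ∂p.toMeasure = expect p f := by
  rw [lintegral_countable', expect]
  refine tsum_congr fun a => ?_
  rw [PMF.toMeasure_apply_singleton _ _ (measurableSet_singleton a), mul_comm]

section Geometry

variable {X : Type*} [MetricSpace X] [TopologicalSpace.SeparableSpace X] [Nonempty X]
  [MeasurableSpace X] [BorelSpace X]

lemma exists_measurable_denseSeq_index (X : Type*) [MetricSpace X]
    [TopologicalSpace.SeparableSpace X] [Nonempty X] [MeasurableSpace X] [BorelSpace X]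
    {ε : ℝ} (hε : 0 < ε) :
    ∃ idx : X → ℕ, Measurable idx ∧ ∀ x, dist x (TopologicalSpace.denseSeq X (idx x)) ≤ ε := by
  classical
  have h : ∀ x : X, ∃ n, dist x (TopologicalSpace.denseSeq X n) ≤ ε := fun x => by
    obtain ⟨n, hn⟩ := (TopologicalSpace.denseRange_denseSeq X).exists_dist_lt x hε
    exact ⟨n, hn.le⟩
  exact ⟨fun x => Nat.find (h x), measurable_find h fun k =>
    measurableSet_le (measurable_id.dist measurable_const) measurable_const,
    fun x => Nat.find_spec (h x)⟩

lemma cond_sub_le {Ω : Type*} [MeasurableSpace Ω] {μ : Measure Ω} {A B E : Set Ω}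
    (hA : MeasurableSet A) (hB : MeasurableSet B) (hle : μ B ≤ μ A) :
    ProbabilityTheory.cond μ A E - ProbabilityTheory.cond μ B E
      ≤ ProbabilityTheory.cond μ A (Bᶜ ∩ E) := by
  rw [tsub_le_iff_left, ProbabilityTheory.cond_apply hA, ProbabilityTheory.cond_apply hB,
    ProbabilityTheory.cond_apply hA]
  have h1 : μ (A ∩ E) ≤ μ (B ∩ E) + μ (A ∩ (Bᶜ ∩ E)) := by
    refine (measure_mono fun x hx => ?_).trans (measure_union_le _ _)
    by_cases hxB : x ∈ B
    · exact Or.inl ⟨hxB, hx.2⟩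
    · exact Or.inr ⟨hx.1, hxB, hx.2⟩
  calc (μ A)⁻¹ * μ (A ∩ E) ≤ (μ A)⁻¹ * μ (B ∩ E) + (μ A)⁻¹ * μ (A ∩ (Bᶜ ∩ E)) := by
        rw [← mul_add]; gcongr
    _ ≤ _ := by gcongr

lemma exists_ball_kernel (μ : Measure X) {Ψ : ℝ}
    (hball : ∀ (x : X) (w : ℝ), 0 < w →
      0 < μ (Metric.closedBall x w) ∧ μ (Metric.closedBall x w) < ⊤)
    (hdiff : ∀ (x y : X) (w : ℝ), 0 < w →
      μ (Metric.closedBall x w \ Metric.closedBall y w) / μ (Metric.closedBall x w)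
        ≤ ENNReal.ofReal (Ψ * dist x y / w)) {w : ℝ} (hw : 0 < w) :
    ∃ ζ : X → PMF ℕ, (∀ x n, ζ x n ≠ 0 → dist x (TopologicalSpace.denseSeq X n) ≤ 1.001 * w) ∧
      ∀ x y, l1 (ζ x) (ζ y) ≤ ENNReal.ofReal (2 * Ψ * dist x y / w) := by
  obtain ⟨idx, hidx, hdist⟩ := exists_measurable_denseSeq_index X (ε := 0.001 * w) (by positivity)
  have hB : ∀ x : X, MeasurableSet (Metric.closedBall x w) := fun x =>
    Metric.isClosed_closedBall.measurableSet
  set ν : X → Measure X := fun x => ProbabilityTheory.cond μ (Metric.closedBall x w) with hν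
  have hνp : ∀ x, IsProbabilityMeasure (ν x) := fun x =>
    ProbabilityTheory.cond_isProbabilityMeasure_of_finite (hball x w hw).1.ne' (hball x w hw).2.ne
  have hmp : ∀ x, IsProbabilityMeasure ((ν x).map idx) := fun x =>
    Measure.isProbabilityMeasure_map hidx.aemeasurable
  refine ⟨fun x => ((ν x).map idx).toPMF, fun x n hn => ?_, fun x y => ?_⟩
  · rw [toPMF_map_apply hidx, hν, ProbabilityTheory.cond_apply (hB x)] at hn
    obtain ⟨z, hz1, hz2⟩ := nonempty_of_measure_ne_zero (mul_ne_zero_iff.1 hn).2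
    have h1 : idx z = n := hz2
    have h2 : dist z x ≤ w := hz1
    calc dist x (TopologicalSpace.denseSeq X n)
        ≤ dist x z + dist z (TopologicalSpace.denseSeq X (idx z)) := h1 ▸ dist_triangle _ _ _
      _ ≤ w + 0.001 * w := add_le_add (by rwa [dist_comm]) (hdist z)
      _ = 1.001 * w := by ring
  · have key : ∀ x y, μ (Metric.closedBall y w) ≤ μ (Metric.closedBall x w) →
        l1 ((ν x).map idx).toPMF ((ν y).map idx).toPMF
          ≤ ENNReal.ofReal (2 * Ψ * dist x y / w) := by
      intro x y hxy
      rw [l1_eq_two_mul_tsum_sub]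
      have hle : ∑' n, (((ν x).map idx).toPMF n - ((ν y).map idx).toPMF n)
          ≤ ENNReal.ofReal (Ψ * dist x y / w) := by
        calc ∑' n, (((ν x).map idx).toPMF n - ((ν y).map idx).toPMF n)
            ≤ ∑' n, ν x ((Metric.closedBall y w)ᶜ ∩ idx ⁻¹' {n}) := by
              refine ENNReal.tsum_le_tsum fun n => ?_
              rw [toPMF_map_apply hidx, toPMF_map_apply hidx]
              exact cond_sub_le (hB x) (hB y) hxy
          _ = ν x (Metric.closedBall y w)ᶜ := by
              rw [← measure_iUnion]
              · congr 1
                ext z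
                simp
              · intro a b hab
                rw [Function.onFun, Set.disjoint_left]
                rintro z ⟨-, h1⟩ ⟨-, h2⟩
                exact hab ((show idx z = a from h1).symm.trans h2)
              · exact fun n => (hB y).compl.inter (hidx (measurableSet_singleton n))
          _ = μ (Metric.closedBall x w \ Metric.closedBall y w) / μ (Metric.closedBall x w) := by
              rw [hν, ProbabilityTheory.cond_apply (hB x), mul_comm, ← div_eq_mul_inv,
                Set.sdiff_eq]
          _ ≤ _ := hdiff x y w hw
      calc 2 * ∑' n, (((ν x).map idx).toPMF n - ((ν y).map idx).toPMF n)
          ≤ 2 * ENNReal.ofReal (Ψ * dist x y / w) := by gcongr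
        _ = ENNReal.ofReal 2 * ENNReal.ofReal (Ψ * dist x y / w) := by norm_num
        _ = _ := by
          rw [← ENNReal.ofReal_mul zero_le_two]
          congr 1
          ring
    rcases le_total (μ (Metric.closedBall y w)) (μ (Metric.closedBall x w)) with h | h
    · exact key x y h
    · rw [l1_comm, dist_comm]
      exact key y x h

end Geometry

lemma levelCost_nonneg {q M : ℝ} (hM : 0 ≤ M) {w : ℕ → ℝ} (hw : ∀ k, 0 < w k) (k : ℕ) :
    0 ≤ levelCost q M w k := by
  cases k with
  | zero => exact hM
  | succ k => exact Real.rpow_nonneg (mul_nonneg (by norm_num) (hw k).le) _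

lemma levelDist_nonneg {Ψ D : ℝ} (hΨ : 0 ≤ Ψ) (hD : 0 ≤ D) {w : ℕ → ℝ} (hw : ∀ k, 0 < w k)
    (k : ℕ) : 0 ≤ levelDist Ψ D w k :=
  le_min zero_le_two (Finset.sum_nonneg fun i _ =>
    div_nonneg (mul_nonneg (mul_nonneg zero_le_two hΨ) hD) (hw i).le)

section Scales

variable {X : Type*} [MetricSpace X] [TopologicalSpace.SeparableSpace X] [Nonempty X]
  [MeasurableSpace X] [BorelSpace X]

open TopologicalSpace in
/-- Finitely many laws on the dense sequence of `X` can be coupled, up to truncation and a small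
error, with pairwise coupling ratio at most `R`. -/
def HasDiscreteCouplings (X : Type*) [MetricSpace X] [SeparableSpace X] [Nonempty X]
    (q R : ℝ) : Prop :=
  ∀ M δ : ℝ, 0 ≤ M → 0 < δ → ∀ {ι : Type} [Finite ι] (p : ι → PMF ℕ),
    ∃ π : PMF (ι → ℕ), (∀ i, π.map (fun t => t i) = p i) ∧
      ∀ i j, ∀ γ : PMF (ℕ × ℕ), γ.map Prod.fst = p i → γ.map Prod.snd = p j →
        expect π (fun t => ENNReal.ofReal
          (min (dist (denseSeq X (t i)) (denseSeq X (t j)) ^ q) M))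
        ≤ expect γ (fun z => ENNReal.ofReal
          (R * dist (denseSeq X z.1) (denseSeq X z.2) ^ q)) + ENNReal.ofReal δ

open TopologicalSpace in
lemma exists_hasDiscreteCouplings (μ : Measure X) {q Ψ : ℝ} (hq0 : 0 < q) (hq1 : q < 1) (hΨ : 0 < Ψ)
    (hball : ∀ (x : X) (w : ℝ), 0 < w →
      0 < μ (Metric.closedBall x w) ∧ μ (Metric.closedBall x w) < ⊤)
    (hdiff : ∀ (x y : X) (w : ℝ), 0 < w →
      μ (Metric.closedBall x w \ Metric.closedBall y w) / μ (Metric.closedBall x w)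
        ≤ ENNReal.ofReal (Ψ * dist x y / w)) :
    ∃ R : ℝ, 0 ≤ R ∧ R < 7.56 * (2.47 * Ψ) ^ q / (1 - q) ∧ HasDiscreteCouplings X q R := by
  obtain ⟨R, hR0, hRT, hR⟩ := exists_scales hq0 hq1 hΨ
  refine ⟨R, hR0, hRT, fun M δ hM hδ ι _ p => ?_⟩
  obtain ⟨m, w, L, hm, hw, hlast, hsum⟩ := hR M δ hM hδ
  choose ζ hζs hζl using fun j k => exists_ball_kernel μ hball hdiff (hw j k)
  set C : ℕ → ℕ → ℝ≥0∞ := fun n n' =>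
    ENNReal.ofReal (min (dist (denseSeq X n) (denseSeq X n') ^ q) M) with hC
  have hcpl := fun j => exists_hierarchical_coupling p C
    (fun k => ENNReal.ofReal (levelCost q M (w j) k)) (fun l n => ζ j l (denseSeq X n))
    (fun x x' => ENNReal.ofReal_le_ofReal (min_le_right _ _))
    (fun l b x x' hx hx' => ENNReal.ofReal_le_ofReal <| (min_le_left _ _).trans <|
      Real.rpow_le_rpow dist_nonneg (by
        have h1 := hζs j l _ b hx
        have h2 := hζs j l _ b hx'
        have h3 := dist_triangle_right (denseSeq X x) (denseSeq X x') (denseSeq X b)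
        linarith) hq0.le) L
  choose π hπm hπ using hcpl
  have : Nonempty (Fin m) := ⟨⟨0, hm⟩⟩
  have hm' : (m : ℝ≥0∞) ≠ 0 := by exact_mod_cast hm.ne'
  have hmt : (m : ℝ≥0∞) ≠ ∞ := ENNReal.natCast_ne_top m
  refine ⟨(PMF.uniformOfFintype (Fin m)).bind fun j => π j, fun i => ?_, fun i j γ h1 h2 => ?_⟩
  · rw [PMF.map_bind]
    simp only [hπm, PMF.bind_const]
  have hdistpt : ∀ (s k : ℕ) (z : ℕ × ℕ),
      min 2 (∑ l ∈ Finset.range k, l1 (ζ s l (denseSeq X z.1)) (ζ s l (denseSeq X z.2)))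
        ≤ ENNReal.ofReal (levelDist Ψ (dist (denseSeq X z.1) (denseSeq X z.2)) (w s) k) := by
    intro s k z
    rw [levelDist, ENNReal.ofReal_min, ENNReal.ofReal_sum_of_nonneg fun l _ =>
      div_nonneg (mul_nonneg (mul_nonneg zero_le_two hΨ.le) dist_nonneg) (hw s l).le]
    exact min_le_min (by simp) (Finset.sum_le_sum fun l _ => hζl s l _ _)
  have hone : ∀ s ∈ Finset.range m, expect (π s) (fun t => C (t i) (t j)) ≤
      expect γ (fun z => ∑ k ∈ Finset.range L, ENNReal.ofReal (levelCost q M (w s) k *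
        (levelDist Ψ (dist (denseSeq X z.1) (denseSeq X z.2)) (w s) (k + 1) +
          levelDist Ψ (dist (denseSeq X z.1) (denseSeq X z.2)) (w s) k)))
        + ENNReal.ofReal δ := by
    intro s hs
    refine (hπ s i j γ h1 h2).trans (add_le_add ?_
      (ENNReal.ofReal_le_ofReal (hlast s (Finset.mem_range.1 hs))))
    rw [expect_finset_sum]
    refine Finset.sum_le_sum fun k _ => ?_
    rw [kernelDist, kernelDist, ← expect_add, ← expect_const_mul]
    refine expect_mono _ fun z => ?_
    rw [ENNReal.ofReal_mul (levelCost_nonneg hM (hw s) k), ENNReal.ofReal_add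
      (levelDist_nonneg hΨ.le dist_nonneg (hw s) _) (levelDist_nonneg hΨ.le dist_nonneg (hw s) _)]
    gcongr
    · exact hdistpt s (k + 1) z
    · exact hdistpt s k z
  rw [expect_bind, expect, tsum_fintype]
  simp only [PMF.uniformOfFintype_apply, Fintype.card_fin, ← Finset.mul_sum]
  rw [Fin.sum_univ_eq_sum_range (fun s => expect (π s) fun t => C (t i) (t j)) m]
  have htot : ∑ s ∈ Finset.range m, expect (π s) (fun t => C (t i) (t j)) ≤
      m * (expect γ (fun z => ENNReal.ofReal
        (R * dist (denseSeq X z.1) (denseSeq X z.2) ^ q)) + ENNReal.ofReal δ) := by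
    refine (Finset.sum_le_sum hone).trans ?_
    rw [Finset.sum_add_distrib, Finset.sum_const, Finset.card_range, nsmul_eq_mul, mul_add,
      ← expect_finset_sum, ← expect_const_mul]
    gcongr
    refine expect_mono _ fun z => ?_
    have hnn : ∀ s k, 0 ≤ levelCost q M (w s) k *
        (levelDist Ψ (dist (denseSeq X z.1) (denseSeq X z.2)) (w s) (k + 1) +
          levelDist Ψ (dist (denseSeq X z.1) (denseSeq X z.2)) (w s) k) := fun s k =>
      mul_nonneg (levelCost_nonneg hM (hw s) k) (add_nonneg
        (levelDist_nonneg hΨ.le dist_nonneg (hw s) _) (levelDist_nonneg hΨ.le dist_nonneg (hw s) _))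
    simp only [← ENNReal.ofReal_sum_of_nonneg fun k _ => hnn _ k]
    rw [← ENNReal.ofReal_sum_of_nonneg fun s _ => Finset.sum_nonneg fun k _ => hnn s k,
      ← ENNReal.ofReal_natCast m, ← ENNReal.ofReal_mul (by positivity)]
    exact ENNReal.ofReal_le_ofReal (hsum _ dist_nonneg)
  calc (m : ℝ≥0∞)⁻¹ * ∑ s ∈ Finset.range m, expect (π s) (fun t => C (t i) (t j))
      ≤ (m : ℝ≥0∞)⁻¹ * (m * (expect γ (fun z => ENNReal.ofReal
        (R * dist (denseSeq X z.1) (denseSeq X z.2) ^ q)) + ENNReal.ofReal δ)) := by gcongr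
    _ = _ := by rw [← mul_assoc, ENNReal.inv_mul_cancel hm' hmt, one_mul]

end Scales

lemma PMF.map_toPMF_map {Ω α β : Type*} [MeasurableSpace Ω] {ν : Measure Ω}
    [IsProbabilityMeasure ν] [Countable α] [MeasurableSpace α] [MeasurableSingletonClass α]
    [Countable β] [MeasurableSpace β] [MeasurableSingletonClass β]
    {g : Ω → α} (hg : Measurable g) (f : α → β) {h : Ω → β} (hf : ∀ ω, f (g ω) = h ω)
    [IsProbabilityMeasure (ν.map g)] [IsProbabilityMeasure (ν.map h)] :
    (ν.map g).toPMF.map f = (ν.map h).toPMF := by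
  obtain rfl : f ∘ g = h := funext hf
  refine PMF.toMeasure_injective ?_
  rw [← PMF.toMeasure_map _ _ (measurable_of_countable f), Measure.toPMF_toMeasure,
    Measure.toPMF_toMeasure, Measure.map_map (measurable_of_countable f) hg]

lemma ofReal_dist_rpow_le {X : Type*} [PseudoMetricSpace X] {q ε : ℝ} (hq0 : 0 < q) (hq1 : q < 1)
    {x y x' y' : X} (hε : 0 ≤ ε) (hx : dist x x' ≤ ε) (hy : dist y y' ≤ ε) :
    ENNReal.ofReal (dist x' y' ^ q) ≤
      ENNReal.ofReal (dist x y ^ q) + ENNReal.ofReal ((2 * ε) ^ q) := by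
  rw [← ENNReal.ofReal_add (by positivity) (by positivity)]
  refine ENNReal.ofReal_le_ofReal ?_
  refine le_trans ?_ (Real.rpow_add_le_add_rpow dist_nonneg (by positivity) hq0.le hq1.le)
  refine Real.rpow_le_rpow dist_nonneg ?_ hq0.le
  have h1 := dist_triangle4 x' x y y'
  rw [dist_comm x' x] at h1
  linarith

section Approx

variable {X : Type*} [MetricSpace X] [TopologicalSpace.SeparableSpace X] [Nonempty X]
  [MeasurableSpace X] [BorelSpace X]

open TopologicalSpace in
lemma HasDiscreteCouplings.exists_approx {q R : ℝ} (h : HasDiscreteCouplings X q R)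
    (hq0 : 0 < q) (hq1 : q < 1) (hR : 0 ≤ R) {M ε δ : ℝ} (hM : 0 ≤ M) (hε : 0 < ε) (hδ : 0 < δ)
    {ι : Type} [Finite ι] (P : ι → Measure X) [∀ i, IsProbabilityMeasure (P i)] :
    ∃ f : X → X, Measurable f ∧ (∀ x, dist x (f x) ≤ ε) ∧ ∃ π : Measure (ι → X),
      IsProbabilityMeasure π ∧ (∀ i, π.map (fun t => t i) = (P i).map f) ∧
      ∀ i j, ∀ γ : Measure (X × X), IsProbabilityMeasure γ → γ.map Prod.fst = P i →
        γ.map Prod.snd = P j →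
        ∫⁻ t, ENNReal.ofReal (min (dist (t i) (t j) ^ q) M) ∂π ≤
          ENNReal.ofReal R * (∫⁻ z, ENNReal.ofReal (dist z.1 z.2 ^ q) ∂γ
            + ENNReal.ofReal ((2 * ε) ^ q)) + ENNReal.ofReal δ := by
  obtain ⟨idx, hidx, hdist⟩ := exists_measurable_denseSeq_index X hε
  have hp : ∀ i, IsProbabilityMeasure ((P i).map idx) := fun i =>
    Measure.isProbabilityMeasure_map hidx.aemeasurable
  obtain ⟨π, hπm, hπ⟩ := h M δ hM hδ fun i => ((P i).map idx).toPMF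
  have hd : Measurable (denseSeq X) := measurable_of_countable _
  have hD : Measurable fun (t : ι → ℕ) (i : ι) => denseSeq X (t i) :=
    measurable_pi_lambda _ fun i => hd.comp (measurable_pi_apply i)
  refine ⟨fun x => denseSeq X (idx x), hd.comp hidx, hdist,
    π.toMeasure.map fun t i => denseSeq X (t i),
    Measure.isProbabilityMeasure_map hD.aemeasurable, fun i => ?_, fun i j γ _ h1 h2 => ?_⟩
  · rw [Measure.map_map (measurable_pi_apply i) hD]
    have h3 := congr_arg (fun p : PMF ℕ => p.toMeasure.map (denseSeq X)) (hπm i)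
    simp only [Measure.toPMF_toMeasure] at h3
    rw [← PMF.toMeasure_map _ _ (measurable_pi_apply i),
      Measure.map_map hd (measurable_pi_apply i), Measure.map_map hd hidx] at h3
    exact h3
  · have hpair : Measurable fun z : X × X => (idx z.1, idx z.2) :=
      (hidx.comp measurable_fst).prodMk (hidx.comp measurable_snd)
    have hγp : IsProbabilityMeasure (γ.map fun z => (idx z.1, idx z.2)) :=
      Measure.isProbabilityMeasure_map hpair.aemeasurable
    have e1 : (P i).map idx = γ.map fun z => idx z.1 := by
      rw [← h1, Measure.map_map hidx measurable_fst]; rfl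
    have e2 : (P j).map idx = γ.map fun z => idx z.2 := by
      rw [← h2, Measure.map_map hidx measurable_snd]; rfl
    have i1 : IsProbabilityMeasure (γ.map fun z => idx z.1) := e1 ▸ hp i
    have i2 : IsProbabilityMeasure (γ.map fun z => idx z.2) := e2 ▸ hp j
    have key := hπ i j (γ.map fun z => (idx z.1, idx z.2)).toPMF
      ((PMF.map_toPMF_map hpair Prod.fst fun _ => rfl).trans (by simp only [e1]))
      ((PMF.map_toPMF_map hpair Prod.snd fun _ => rfl).trans (by simp only [e2]))
    have hmeas : Measurable fun t : ι → X =>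
        ENNReal.ofReal (min (dist (t i) (t j) ^ q) M) := by
      have : Measurable fun t : ι → X => dist (t i) (t j) :=
        (measurable_pi_apply i).dist (measurable_pi_apply j)
      exact ((this.pow_const q).min measurable_const).ennreal_ofReal
    rw [lintegral_map hmeas hD, lintegral_pmf_toMeasure]
    refine key.trans (add_le_add_left ?_ _)
    rw [expect_toPMF_map hpair]
    simp only [ENNReal.ofReal_mul hR]
    rw [lintegral_const_mul' _ _ ENNReal.ofReal_ne_top]
    gcongr
    calc _ ≤ ∫⁻ z, (ENNReal.ofReal (dist z.1 z.2 ^ q) + ENNReal.ofReal ((2 * ε) ^ q)) ∂γ :=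
          lintegral_mono fun z => ofReal_dist_rpow_le hq0 hq1 hε.le (hdist z.1) (hdist z.2)
      _ = _ := by rw [lintegral_add_right _ measurable_const]; simp

end Approx

section WeakLimits

open Filter Topology

lemma tendsto_map_of_dist_le {X : Type*} [PseudoMetricSpace X] [MeasurableSpace X] [BorelSpace X]
    (P : ProbabilityMeasure X) {f : ℕ → X → X} (hf : ∀ n, Measurable (f n)) {ε : ℕ → ℝ}
    (hε : Tendsto ε atTop (𝓝 0)) (hd : ∀ n x, dist x (f n x) ≤ ε n) :
    Tendsto (fun n => P.map (hf n).aemeasurable) atTop (𝓝 P) := by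
  rw [ProbabilityMeasure.tendsto_iff_forall_lintegral_tendsto]
  intro g
  have hg : Measurable fun x => (g x : ℝ≥0∞) := g.continuous.measurable.coe_nnreal_ennreal
  have h1 : ∀ n, ∫⁻ x, (g x : ℝ≥0∞) ∂(P.map (hf n).aemeasurable : Measure X)
      = ∫⁻ x, (g (f n x) : ℝ≥0∞) ∂(P : Measure X) := fun n => by
    rw [ProbabilityMeasure.toMeasure_map, lintegral_map hg (hf n)]
  simp only [h1]
  refine tendsto_lintegral_of_dominated_convergence (fun _ => (nndist g 0 : ℝ≥0∞))
    (fun n => hg.comp (hf n)) (fun n => ae_of_all _ fun x => ?_) (by simp)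
    (ae_of_all _ fun x => ?_)
  · exact ENNReal.coe_le_coe.2 (BoundedContinuousFunction.NNReal.upper_bound g (f n x))
  · refine ENNReal.tendsto_coe.2 ((g.continuous.tendsto x).comp ?_)
    rw [tendsto_iff_dist_tendsto_zero]
    refine squeeze_zero (fun _ => dist_nonneg) (fun n => ?_) hε
    rw [dist_comm]
    exact hd n x

lemma exists_tendsto_subseq_of_marginals {X : Type*} [MetricSpace X] [CompleteSpace X]
    [SecondCountableTopology X] [MeasurableSpace X] [BorelSpace X]
    (π : ℕ → ProbabilityMeasure (ℕ → X)) (P : ℕ → ProbabilityMeasure X)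
    (h : ∀ i, Tendsto (fun n => (π n).map (measurable_pi_apply i).aemeasurable) atTop (𝓝 (P i))) :
    ∃ (ν : ProbabilityMeasure (ℕ → X)) (φ : ℕ → ℕ), StrictMono φ ∧ Tendsto (π ∘ φ) atTop (𝓝 ν) := by
  have htight : IsTightMeasureSet
      {((ρ : ProbabilityMeasure (ℕ → X)) : Measure (ℕ → X)) | ρ ∈ Set.range π} := by
    rw [isTightMeasureSet_iff_exists_isCompact_measure_compl_le]
    intro ε hε
    obtain ⟨δ, hδ0, hδ⟩ := ENNReal.exists_pos_sum_of_countable' hε.ne' ℕ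
    have hK : ∀ i, ∃ K : Set X, IsCompact K ∧
        ∀ n, ((π n).map (measurable_pi_apply i).aemeasurable : Measure X) Kᶜ ≤ δ i := by
      intro i
      have hc : IsCompact (closure (Set.range fun n =>
          (π n).map (measurable_pi_apply (δ := ℕ) (X := fun _ => X) i).aemeasurable)) :=
        (h i).isCompact_insert_range.closure_of_subset (Set.subset_insert _ _)
      obtain ⟨K, hK, hle⟩ := isTightMeasureSet_iff_exists_isCompact_measure_compl_le.1
        (isTightMeasureSet_of_isCompact_closure hc) (δ i) (hδ0 i)
      exact ⟨K, hK, fun n => hle _ ⟨_, ⟨n, rfl⟩, rfl⟩⟩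
    choose K hK hle using hK
    refine ⟨Set.pi Set.univ K, isCompact_univ_pi hK, ?_⟩
    rintro _ ⟨_, ⟨n, rfl⟩, rfl⟩
    have hsub : (Set.pi Set.univ K)ᶜ ⊆ ⋃ i, (fun t : ℕ → X => t i) ⁻¹' (K i)ᶜ := by
      intro t ht
      simpa [Set.mem_pi] using ht
    refine (measure_mono hsub).trans ((measure_iUnion_le _).trans
      ((ENNReal.tsum_le_tsum fun i => ?_).trans hδ.le))
    have := hle i n
    rwa [ProbabilityMeasure.toMeasure_map, Measure.map_apply (measurable_pi_apply i)
      (hK i).measurableSet.compl] at this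
  obtain ⟨ν, -, φ, hφ, hlim⟩ := (isCompact_closure_of_isTightMeasureSet htight).tendsto_subseq
    (x := π) fun n => subset_closure ⟨n, rfl⟩
  exact ⟨ν, φ, hφ, hlim⟩

lemma lintegral_le_of_tendsto_of_truncated {Ω : Type*} [TopologicalSpace Ω] [MeasurableSpace Ω]
    [OpensMeasurableSpace Ω] {π : ℕ → ProbabilityMeasure Ω} {ν : ProbabilityMeasure Ω}
    (h : Tendsto π atTop (𝓝 ν)) {g : Ω → ℝ} (hg : Continuous g) (hg0 : ∀ ω, 0 ≤ g ω)
    {b : ℕ → ℝ≥0∞} {b₀ : ℝ≥0∞} (hb : Tendsto b atTop (𝓝 b₀))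
    (hle : ∀ N : ℕ, ∀ᶠ n in atTop,
      ∫⁻ ω, ENNReal.ofReal (min (g ω) N) ∂(π n : Measure Ω) ≤ b n) :
    ∫⁻ ω, ENNReal.ofReal (g ω) ∂(ν : Measure Ω) ≤ b₀ := by
  have hN : ∀ N : ℕ, ∫⁻ ω, ENNReal.ofReal (min (g ω) N) ∂(ν : Measure Ω) ≤ b₀ := by
    intro N
    have hc : Continuous fun ω => (min (g ω) N).toNNReal :=
      continuous_real_toNNReal.comp (hg.min continuous_const)
    let G : BoundedContinuousFunction Ω NNReal :=
      BoundedContinuousFunction.mkOfBound ⟨_, hc⟩ (N : ℝ) fun x y => by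
        have hx : 0 ≤ min (g x) (N : ℝ) := le_min (hg0 x) N.cast_nonneg
        have hy : 0 ≤ min (g y) (N : ℝ) := le_min (hg0 y) N.cast_nonneg
        rw [NNReal.dist_eq, ContinuousMap.coe_mk, Real.coe_toNNReal _ hx, Real.coe_toNNReal _ hy,
          abs_le]
        constructor <;> linarith [min_le_right (g x) (N : ℝ), min_le_right (g y) (N : ℝ)]
    exact le_of_tendsto_of_tendsto
      (ProbabilityMeasure.tendsto_iff_forall_lintegral_tendsto.1 h G) hb (hle N)
  have hsup : ∀ ω, ENNReal.ofReal (g ω) = ⨆ N : ℕ, ENNReal.ofReal (min (g ω) N) := by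
    intro ω
    refine le_antisymm ?_ (iSup_le fun N => ENNReal.ofReal_le_ofReal (min_le_left _ _))
    obtain ⟨N, hN⟩ := exists_nat_ge (g ω)
    refine le_iSup_of_le N ?_
    rw [min_eq_left hN]
  simp only [hsup]
  rw [lintegral_iSup]
  · exact iSup_le hN
  · exact fun N => (hg.min continuous_const).measurable.ennreal_ofReal
  · exact fun N N' hNN ω => ENNReal.ofReal_le_ofReal (min_le_min_left _ (by exact_mod_cast hNN))

end WeakLimits

section Countable

variable {X : Type*} [MetricSpace X] [TopologicalSpace.SeparableSpace X] [Nonempty X]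
  [MeasurableSpace X] [BorelSpace X]

open Filter Topology in
lemma HasDiscreteCouplings.exists_countable_coupling [CompleteSpace X] {q R : ℝ}
    (h : HasDiscreteCouplings X q R) (hq0 : 0 < q) (hq1 : q < 1) (hR : 0 ≤ R)
    (P : ℕ → ProbabilityMeasure X) :
    ∃ π : Measure (ℕ → X), IsProbabilityMeasure π ∧ (∀ i, π.map (fun t => t i) = P i) ∧
      ∀ i j, ∀ γ : Measure (X × X), IsProbabilityMeasure γ → γ.map Prod.fst = P i →
        γ.map Prod.snd = P j →
        ∫⁻ t, ENNReal.ofReal (dist (t i) (t j) ^ q) ∂π ≤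
          ENNReal.ofReal R * ∫⁻ z, ENNReal.ofReal (dist z.1 z.2 ^ q) ∂γ := by
  have : SecondCountableTopology X := UniformSpace.secondCountable_of_separable X
  have hε : ∀ n : ℕ, 0 < 1 / ((n : ℝ) + 1) := fun n => by positivity
  choose f hf hd π hπ hπm hπc using fun n : ℕ =>
    h.exists_approx hq0 hq1 hR (M := n) n.cast_nonneg (hε n) (hε n)
      (fun i : Fin (n + 1) => (P i : Measure X))
  let cl : (n : ℕ) → ℕ → Fin (n + 1) := fun n i => ⟨min i n, by omega⟩
  have hcl : ∀ {n i}, i ≤ n → ((cl n i : Fin (n + 1)) : ℕ) = i := fun hin => min_eq_left hin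
  let ext : (n : ℕ) → (Fin (n + 1) → X) → ℕ → X := fun n t i => t (cl n i)
  have hext : ∀ n, Measurable (ext n) := fun n => measurable_pi_lambda _ fun i =>
    measurable_pi_apply _
  let ρ : ℕ → ProbabilityMeasure (ℕ → X) := fun n =>
    ⟨(π n).map (ext n), Measure.isProbabilityMeasure_map (hext n).aemeasurable⟩
  have hlim : ∀ i, Tendsto (fun n => (ρ n).map (measurable_pi_apply i).aemeasurable) atTop
      (𝓝 (P i)) := by
    intro i
    refine (tendsto_map_of_dist_le (P i) hf tendsto_one_div_add_atTop_nhds_zero_nat hd).congr' ?_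
    filter_upwards [eventually_ge_atTop i] with n hn
    refine Subtype.ext ?_
    change (P i : Measure X).map (f n) = ((π n).map (ext n)).map (fun t => t i)
    rw [Measure.map_map (measurable_pi_apply i) (hext n)]
    have := hπm n (cl n i)
    rw [hcl hn] at this
    exact this.symm
  obtain ⟨ν, φ, hφ, hν⟩ := exists_tendsto_subseq_of_marginals ρ P hlim
  refine ⟨ν, inferInstance, fun i => ?_, fun i j γ hγ h1 h2 => ?_⟩
  · have h3 := ProbabilityMeasure.tendsto_map_of_tendsto_of_continuous _ _ hν
      (continuous_apply i : Continuous fun t : ℕ → X => t i)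
    have h4 := tendsto_nhds_unique h3 ((hlim i).comp hφ.tendsto_atTop)
    simpa using congr_arg (fun m : ProbabilityMeasure X => (m : Measure X)) h4
  · let b : ℝ → ℝ≥0∞ := fun e => ENNReal.ofReal R *
      (∫⁻ z, ENNReal.ofReal (dist z.1 z.2 ^ q) ∂γ + ENNReal.ofReal ((2 * e) ^ q))
        + ENNReal.ofReal e
    have hb : Tendsto b (𝓝 0) (𝓝 (ENNReal.ofReal R *
        ∫⁻ z, ENNReal.ofReal (dist z.1 z.2 ^ q) ∂γ)) := by
      have hbc : Continuous b := by
        have h5 : Continuous fun e : ℝ => ENNReal.ofReal ((2 * e) ^ q) :=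
          ENNReal.continuous_ofReal.comp
            ((continuous_const.mul continuous_id).rpow_const fun _ => Or.inr hq0.le)
        exact ((ENNReal.continuous_const_mul ENNReal.ofReal_ne_top).comp
          (continuous_const.add h5)).add ENNReal.continuous_ofReal
      have h0 : b 0 = ENNReal.ofReal R * ∫⁻ z, ENNReal.ofReal (dist z.1 z.2 ^ q) ∂γ := by
        simp [b, Real.zero_rpow hq0.ne']
      exact h0 ▸ hbc.tendsto 0
    refine lintegral_le_of_tendsto_of_truncated hν (g := fun t => dist (t i) (t j) ^ q)
      (((continuous_apply i).dist (continuous_apply j)).rpow_const fun _ => Or.inr hq0.le)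
      (fun t => by positivity)
      (hb.comp (tendsto_one_div_add_atTop_nhds_zero_nat.comp hφ.tendsto_atTop)) fun N => ?_
    filter_upwards [eventually_ge_atTop (max N (max i j))] with k hk
    have hn : max N (max i j) ≤ φ k := hk.trans (hφ.id_le k)
    have hi : i ≤ φ k := by omega
    have hj : j ≤ φ k := by omega
    have hN : (N : ℝ) ≤ φ k := by exact_mod_cast (by omega : N ≤ φ k)
    have hmeas : ∀ K : ℝ, Measurable fun t : ℕ → X =>
        ENNReal.ofReal (min (dist (t i) (t j) ^ q) K) := fun K => by
      have : Measurable fun t : ℕ → X => dist (t i) (t j) :=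
        (measurable_pi_apply i).dist (measurable_pi_apply j)
      exact ((this.pow_const q).min measurable_const).ennreal_ofReal
    refine (lintegral_mono fun t => ENNReal.ofReal_le_ofReal (min_le_min_left _ hN)).trans ?_
    change ∫⁻ t, _ ∂((π (φ k)).map (ext (φ k))) ≤ _
    rw [lintegral_map (hmeas _) (hext _)]
    refine hπc (φ k) (cl _ i) (cl _ j) γ hγ ?_ ?_
    · rw [hcl hi]; exact h1
    · rw [hcl hj]; exact h2

end Countable

instance : IsProbabilityMeasure stdSpace := ⟨by simp [stdSpace]⟩

lemma exists_stdSpace_map_eq {Z : Type*} [MeasurableSpace Z] [StandardBorelSpace Z] [Nonempty Z]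
    (π : Measure Z) [IsProbabilityMeasure π] :
    ∃ F : ℝ → Z, Measurable F ∧ stdSpace.map F = π := by
  obtain ⟨f, hf, hfπ⟩ := π.exists_measurable_map_eq
  have hproj : Measurable (Set.projIcc (0 : ℝ) 1 zero_le_one) := continuous_projIcc.measurable
  have hstd : stdSpace.map (Set.projIcc (0 : ℝ) 1 zero_le_one) = volume := by
    have h := (measurePreserving_subtype_coe (μa := (volume : Measure ℝ))
      (measurableSet_Icc (a := (0 : ℝ)) (b := 1))).map_eq
    rw [stdSpace, ← h, Measure.map_map hproj measurable_subtype_coe]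
    have : Set.projIcc (0 : ℝ) 1 zero_le_one ∘ ((↑) : Set.Icc (0 : ℝ) 1 → ℝ) = id :=
      funext fun x => Set.projIcc_val zero_le_one x
    rw [this, Measure.map_id]
    rfl
  exact ⟨f ∘ Set.projIcc 0 1 zero_le_one, hf.comp hproj, by
    rw [← Measure.map_map hf hproj, hstd, hfπ]⟩

section Wasserstein

variable {Y : Type*} [MetricSpace Y] [MeasurableSpace Y]

lemma Cstar_dist_lt_iff {P Q : Measure Y} {b : ℝ≥0∞} :
    Cstar dist P Q < b ↔ ∃ γ : Measure (Y × Y), IsProbabilityMeasure γ ∧ γ.map Prod.fst = P ∧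
      γ.map Prod.snd = Q ∧ ∫⁻ z, edist z.1 z.2 ∂γ < b := by
  simp only [Cstar, iInf_lt_iff, ← edist_dist, exists_prop, Set.mem_ofPred_eq, and_assoc]

variable [BorelSpace Y] [SecondCountableTopology Y]

lemma Cstar_dist_map_le {Ω : Type*} [MeasurableSpace Ω] (ρ : Measure Ω) [IsProbabilityMeasure ρ]
    {f g : Ω → Y} (hf : Measurable f) (hg : Measurable g) :
    Cstar dist (ρ.map f) (ρ.map g) ≤ ∫⁻ ω, edist (f ω) (g ω) ∂ρ := by
  have hfg : Measurable fun ω => (f ω, g ω) := hf.prodMk hg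
  refine (iInf₂_le (ρ.map fun ω => (f ω, g ω)) ⟨Measure.isProbabilityMeasure_map hfg.aemeasurable,
    by rw [Measure.map_map measurable_fst hfg]; rfl,
    by rw [Measure.map_map measurable_snd hfg]; rfl⟩).trans_eq ?_
  simp only [← edist_dist]
  rw [lintegral_map measurable_edist hfg]

lemma Cstar_dist_comm_le (P Q : Measure Y) : Cstar dist P Q ≤ Cstar dist Q P := by
  refine le_of_forall_gt fun b hb => ?_
  obtain ⟨γ, h1, rfl, rfl, hγ⟩ := Cstar_dist_lt_iff.1 hb
  refine (Cstar_dist_map_le γ measurable_snd measurable_fst).trans_lt ?_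
  simpa only [edist_comm] using hγ

lemma Cstar_dist_comm (P Q : Measure Y) : Cstar dist P Q = Cstar dist Q P :=
  le_antisymm (Cstar_dist_comm_le P Q) (Cstar_dist_comm_le Q P)

lemma Cstar_dist_self (P : Measure Y) [IsProbabilityMeasure P] : Cstar dist P P = 0 := by
  have := Cstar_dist_map_le P (f := id) (g := id) measurable_id measurable_id
  simpa using this

lemma eq_of_Cstar_dist_eq_zero {P Q : Measure Y} [IsProbabilityMeasure P] [IsProbabilityMeasure Q]
    (h : Cstar dist P Q = 0) : P = Q := by
  have key : ∀ P Q : Measure Y, Cstar dist P Q = 0 → ∀ ε : ℝ≥0∞, 0 < ε → ε < ∞ → ∀ B,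
      MeasurableSet B → P B ≤ Q (Metric.thickening ε.toReal B) + ε := by
    intro P Q h ε hε hεt B hB
    have h0 : Cstar dist P Q < ε * ε := by
      rw [h]; exact ENNReal.mul_pos hε.ne' hε.ne'
    obtain ⟨γ, hγ, rfl, rfl, hb⟩ := Cstar_dist_lt_iff.1 h0
    rw [Measure.map_apply measurable_fst hB,
      Measure.map_apply measurable_snd Metric.isOpen_thickening.measurableSet]
    have hmk : γ {z | ε ≤ edist z.1 z.2} ≤ ε := by
      refine (meas_ge_le_lintegral_div measurable_edist.aemeasurable hε.ne' hεt.ne).trans ?_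
      exact ENNReal.div_le_of_le_mul hb.le
    refine (measure_mono fun z hz => ?_).trans ((measure_union_le _ _).trans (add_le_add_right hmk _))
    by_cases hd : ε ≤ edist z.1 z.2
    · exact Or.inr hd
    · refine Or.inl (Metric.mem_thickening_iff.2 ⟨z.1, hz, ?_⟩)
      rw [dist_comm, dist_edist]
      exact (ENNReal.toReal_lt_toReal (edist_ne_top _ _) hεt.ne).2 (not_le.1 hd)
  have h0 : levyProkhorovEDist P Q = 0 := by
    refine le_antisymm (levyProkhorovEDist_le_of_forall _ _ _ fun ε B hε hεt hB => ?_) bot_le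
    exact ⟨key P Q h ε hε hεt B hB, key Q P (Cstar_dist_comm Q P ▸ h) ε hε hεt B hB⟩
  let P' : ProbabilityMeasure Y := ⟨P, inferInstance⟩
  let Q' : ProbabilityMeasure Y := ⟨Q, inferInstance⟩
  have h1 : dist (LevyProkhorov.ofMeasure P') (LevyProkhorov.ofMeasure Q') = 0 := by
    change (levyProkhorovEDist P Q).toReal = 0
    rw [h0, ENNReal.toReal_zero]
  have h2 : P' = Q' := congr_arg LevyProkhorov.toMeasure (dist_eq_zero.1 h1)
  exact congr_arg (fun m : ProbabilityMeasure Y => (m : Measure Y)) h2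

variable [CompleteSpace Y] [Nonempty Y]

open ProbabilityTheory unitInterval in
lemma exists_measurable_map_prod_eq (γ : Measure (Y × Y)) [IsProbabilityMeasure γ] :
    ∃ g : Y × I → Y, Measurable g ∧
      ((γ.map Prod.fst).prod volume).map (fun ω => (ω.1, g ω)) = γ := by
  obtain ⟨f, hf, hfκ⟩ := γ.condKernel.exists_measurable_map_eq_unitInterval
  refine ⟨Function.uncurry f, hf, ?_⟩
  have hm : Measurable fun ω : Y × I => (ω.1, Function.uncurry f ω) := measurable_fst.prodMk hf
  conv_rhs => rw [← γ.disintegrate γ.condKernel]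
  have : IsProbabilityMeasure (γ.map Prod.fst) :=
    Measure.isProbabilityMeasure_map measurable_fst.aemeasurable
  ext s hs
  rw [Measure.map_apply hm hs, Measure.prod_apply (hm hs), Measure.compProd_apply hs]
  refine lintegral_congr fun y => ?_
  have hfy : Measurable (f y) := hf.comp measurable_prodMk_left
  rw [← hfκ y, Measure.map_apply hfy (measurable_prodMk_left hs)]
  rfl

open unitInterval in
lemma exists_map_of_Cstar_lt {P Q : Measure Y} {b : ℝ≥0∞} (h : Cstar dist P Q < b) :
    ∃ g : Y × I → Y, Measurable g ∧ (P.prod volume).map g = Q ∧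
      ∫⁻ ω, edist ω.1 (g ω) ∂(P.prod volume) < b := by
  obtain ⟨γ, hγ, rfl, rfl, hb⟩ := Cstar_dist_lt_iff.1 h
  obtain ⟨g, hg, hgγ⟩ := exists_measurable_map_prod_eq γ
  have hm : Measurable fun ω : Y × I => (ω.1, g ω) := measurable_fst.prodMk hg
  refine ⟨g, hg, ?_, ?_⟩
  · conv_rhs => rw [← hgγ, Measure.map_map measurable_snd hm]
    rfl
  · rw [← hgγ, lintegral_map measurable_edist hm] at hb
    simpa only [hgγ] using hb

lemma Cstar_dist_triangle (P Q S : Measure Y) [IsProbabilityMeasure Q] :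
    Cstar dist P S ≤ Cstar dist P Q + Cstar dist Q S := by
  rw [Cstar_dist_comm P Q]
  refine ENNReal.le_of_forall_pos_le_add fun ε hε hfin => ?_
  obtain ⟨h1, h2⟩ := ENNReal.add_lt_top.1 hfin
  have hε2 : ((ε : ℝ≥0∞) / 2) ≠ 0 := by simpa using hε.ne'
  obtain ⟨f, hf, rfl, hfb⟩ := exists_map_of_Cstar_lt (ENNReal.lt_add_right h1.ne hε2)
  obtain ⟨g, hg, rfl, hgb⟩ := exists_map_of_Cstar_lt (ENNReal.lt_add_right h2.ne hε2)
  refine (Cstar_dist_map_le _ hf hg).trans ?_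
  calc ∫⁻ ω, edist (f ω) (g ω) ∂(Q.prod volume)
      ≤ ∫⁻ ω, (edist ω.1 (f ω) + edist ω.1 (g ω)) ∂(Q.prod volume) :=
        lintegral_mono fun ω => edist_triangle_left _ _ _
    _ = _ := lintegral_add_left (measurable_fst.edist hf) _
    _ ≤ _ := add_le_add hfb.le hgb.le
    _ = _ := by rw [add_add_add_comm, ENNReal.add_halves]

end Wasserstein

section Extension

variable {Y : Type*} [MetricSpace Y] [MeasurableSpace Y] [BorelSpace Y]
  [SecondCountableTopology Y] [CompleteSpace Y] [Nonempty Y]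

/-- Every metric space is isometric to a subset of a separable normed space. -/
lemma exists_isometry_separable_normedSpace (Y : Type*) [MetricSpace Y]
    [SecondCountableTopology Y] :
    ∃ (V : Submodule ℝ (lp (fun _ : ℕ => ℝ) ∞)) (e : Y → V), TopologicalSpace.SeparableSpace V ∧
      Isometry e := by
  let V := Submodule.span ℝ (Set.range (kuratowskiEmbedding Y))
  have hV : TopologicalSpace.IsSeparable (V : Set (lp (fun _ : ℕ => ℝ) ∞)) :=
    (TopologicalSpace.isSeparable_range (kuratowskiEmbedding.isometry Y).continuous).span
  exact ⟨V, fun y => ⟨kuratowskiEmbedding Y y, Submodule.subset_span ⟨y, rfl⟩⟩,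
    hV.separableSpace, fun x y => kuratowskiEmbedding.isometry Y x y⟩

/-- A family in a separable metric space has a dense subsequence. -/
lemma exists_seq_edist_lt {T E : Type*} [Nonempty T] [PseudoEMetricSpace E]
    [TopologicalSpace.SeparableSpace E] (L : T → E) :
    ∃ t : ℕ → T, ∀ u, ∀ ε : ℝ≥0∞, 0 < ε → ∃ n, edist (L (t n)) (L u) < ε := by
  obtain ⟨D, hDL, hDc, hD⟩ := (TopologicalSpace.IsSeparable.of_separableSpace
    (Set.range L)).exists_countable_dense_subset
  have hDne : D.Nonempty := closure_nonempty_iff.1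
    ⟨_, hD ⟨Classical.arbitrary T, rfl⟩⟩
  obtain ⟨f, rfl⟩ := hDc.exists_eq_range hDne
  choose t ht using fun n => hDL ⟨n, rfl⟩
  refine ⟨t, fun u ε hε => ?_⟩
  obtain ⟨_, ⟨n, rfl⟩, hn⟩ := EMetric.mem_closure_iff.1 (hD ⟨u, rfl⟩) ε hε
  exact ⟨n, by rwa [ht n, edist_comm]⟩

/-- A finite-distance class of probability measures is separable for the transport cost. -/
lemma exists_dense_seq_of_Cstar (P₀ : ProbabilityMeasure Y) :
    ∃ s : ℕ → ProbabilityMeasure Y, ∀ P : ProbabilityMeasure Y, Cstar dist (P₀ : Measure Y) P < ∞ →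
      ∀ ε : ℝ≥0∞, 0 < ε → ∃ n, Cstar dist (s n : Measure Y) P < ε := by
  let T := {P : ProbabilityMeasure Y // Cstar dist (P₀ : Measure Y) P < ∞}
  choose g hg hgP hgfin using fun t : T => exists_map_of_Cstar_lt t.2
  set ρ : Measure (Y × unitInterval) := (P₀ : Measure Y).prod volume with hρ
  obtain ⟨V, e, hV, he⟩ := exists_isometry_separable_normedSpace Y
  have hLp : ∀ t : T, MemLp (fun ω => e (g t ω) - e ω.1) 1 ρ := fun t => by
    refine ⟨?_, ?_⟩
    · exact ((he.continuous.comp_stronglyMeasurable (hg t).stronglyMeasurable).sub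
        (he.continuous.comp_stronglyMeasurable measurable_fst.stronglyMeasurable)).aestronglyMeasurable
    · rw [eLpNorm_one_eq_lintegral_enorm]
      simp only [← edist_eq_enorm_sub, he.edist_eq]
      simpa only [edist_comm] using hgfin t
  let L : T → Lp V 1 ρ := fun t => (hLp t).toLp
  have hL : ∀ t u : T, Cstar dist (t.1 : Measure Y) u.1 ≤ edist (L t) (L u) := fun t u => by
    rw [Lp.edist_toLp_toLp, eLpNorm_one_eq_lintegral_enorm]
    simp only [Pi.sub_apply, sub_sub_sub_cancel_right, ← edist_eq_enorm_sub, he.edist_eq]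
    rw [← hgP t, ← hgP u]
    exact Cstar_dist_map_le ρ (hg t) (hg u)
  have : Fact ((1 : ℝ≥0∞) ≠ ∞) := ⟨ENNReal.one_ne_top⟩
  have hP₀ : Cstar dist (P₀ : Measure Y) P₀ < ∞ := by
    rw [Cstar_dist_self]; exact ENNReal.zero_lt_top
  have : Nonempty T := ⟨⟨P₀, hP₀⟩⟩
  obtain ⟨t, ht⟩ := exists_seq_edist_lt L
  refine ⟨fun n => (t n).1, fun P hP ε hε => ?_⟩
  obtain ⟨n, hn⟩ := ht ⟨P, hP⟩ ε hε
  exact ⟨n, (hL (t n) ⟨P, hP⟩).trans_lt hn⟩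

open Filter Topology in
lemma exists_limit_of_coupling {r : ℝ≥0∞} (hr : r ≠ ∞) {s : ℕ → ProbabilityMeasure Y}
    {F : ℕ → ℝ → Y} (hF : ∀ n, Measurable (F n)) (hlaw : ∀ n, stdSpace.map (F n) = s n)
    (hcost : ∀ n m, ∫⁻ u, edist (F n u) (F m u) ∂stdSpace ≤ r * Cstar dist (s n : Measure Y) (s m))
    (P : ProbabilityMeasure Y)
    (hP : ∀ ε : ℝ≥0∞, 0 < ε → ∃ n, Cstar dist (s n : Measure Y) P < ε) :
    ∃ Z : ℝ → Y, Measurable Z ∧ stdSpace.map Z = P ∧ ∀ ε : ℝ≥0∞, 0 < ε →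
      ∃ n, Cstar dist (s n : Measure Y) P ≤ ε ∧ ∫⁻ u, edist (F n u) (Z u) ∂stdSpace ≤ ε := by
  let δ : ℕ → ℝ≥0∞ := fun k => 2⁻¹ ^ k
  have hδ0 : ∀ k, 0 < δ k := fun k => ENNReal.pow_pos (by simp) k
  have hδsum : ∑' k, δ k ≠ ∞ := by
    simp only [δ, ENNReal.tsum_geometric, ENNReal.one_sub_inv_two, inv_inv]
    exact ENNReal.ofNat_ne_top
  have hδanti : ∀ k, δ (k + 1) ≤ δ k := fun k => by
    simp only [δ, pow_succ]
    exact mul_le_of_le_one_right' (by simp)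
  choose φ hφ using fun k => hP (δ k) (hδ0 k)
  let a : ℕ → ℝ → ℝ≥0∞ := fun k u => edist (F (φ k) u) (F (φ (k + 1)) u)
  have ham : ∀ k, Measurable (a k) := fun k => (hF _).edist (hF _)
  have hint : ∀ k, ∫⁻ u, a k u ∂stdSpace ≤ 2 * r * δ k := by
    intro k
    refine (hcost _ _).trans ?_
    rw [mul_comm 2 r, mul_assoc, two_mul]
    gcongr
    refine (Cstar_dist_triangle _ (P : Measure Y) _).trans (add_le_add (hφ k).le ?_)
    rw [Cstar_dist_comm]
    exact (hφ (k + 1)).le.trans (hδanti k)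
  have htail : Tendsto (fun k => ∑' i, 2 * r * δ (i + k)) atTop (𝓝 0) :=
    ENNReal.tendsto_sum_nat_add (fun k => 2 * r * δ k) (by
      rw [ENNReal.tsum_mul_left]
      exact ENNReal.mul_ne_top (ENNReal.mul_ne_top ENNReal.ofNat_ne_top hr) hδsum)
  have hsum : ∫⁻ u, ∑' k, a k u ∂stdSpace ≠ ∞ := by
    rw [lintegral_tsum fun k => (ham k).aemeasurable]
    refine ((ENNReal.tsum_le_tsum hint).trans_lt ?_).ne
    rw [ENNReal.tsum_mul_left]
    exact (ENNReal.mul_ne_top (ENNReal.mul_ne_top ENNReal.ofNat_ne_top hr) hδsum).lt_top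
  have hae : ∀ᵐ u ∂stdSpace, ∃ l, Tendsto (fun k => F (φ k) u) atTop (𝓝 l) := by
    filter_upwards [ae_lt_top (Measurable.tsum ham) hsum] with u hu
    exact cauchySeq_tendsto_of_complete
      (cauchySeq_of_edist_le_of_tsum_ne_top _ (fun _ => le_rfl) hu.ne)
  obtain ⟨Z, hZ, hlim⟩ := measurable_limit_of_tendsto_metrizable_ae
    (fun k => (hF (φ k)).aemeasurable) hae
  have hFZ : ∀ k, ∫⁻ u, edist (F (φ k) u) (Z u) ∂stdSpace ≤ ∑' i, 2 * r * δ (i + k) := by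
    intro k
    calc ∫⁻ u, edist (F (φ k) u) (Z u) ∂stdSpace ≤ ∫⁻ u, ∑' i, a (k + i) u ∂stdSpace := by
          refine lintegral_mono_ae ?_
          filter_upwards [hlim] with u hu
          exact edist_le_tsum_of_edist_le_of_tendsto (f := fun k => F (φ k) u) (fun k => a k u)
            (fun _ => le_rfl) hu k
      _ = ∑' i, ∫⁻ u, a (k + i) u ∂stdSpace := lintegral_tsum fun i => (ham _).aemeasurable
      _ ≤ _ := ENNReal.tsum_le_tsum fun i => by rw [add_comm i k]; exact hint _
  have hδ : Tendsto δ atTop (𝓝 0) := ENNReal.tendsto_pow_atTop_nhds_zero_of_lt_one (by simp)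
  have happrox : ∀ ε : ℝ≥0∞, 0 < ε → ∃ n, Cstar dist (s n : Measure Y) P ≤ ε ∧
      ∫⁻ u, edist (F n u) (Z u) ∂stdSpace ≤ ε := by
    intro ε hε
    obtain ⟨k, hk1, hk2⟩ := ((hδ.eventually_le_const hε).and (htail.eventually_le_const hε)).exists
    exact ⟨φ k, (hφ k).le.trans hk1, (hFZ k).trans hk2⟩
  refine ⟨Z, hZ, ?_, happrox⟩
  have hZp : IsProbabilityMeasure (stdSpace.map Z) := Measure.isProbabilityMeasure_map hZ.aemeasurable
  refine eq_of_Cstar_dist_eq_zero (le_antisymm (_root_.le_of_forall_pos_le_add fun ε hε => ?_) bot_le)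
  rw [zero_add]
  obtain ⟨n, h1, h2⟩ := happrox (ε / 2) (ENNReal.half_pos hε.ne')
  calc Cstar dist (stdSpace.map Z) P ≤ Cstar dist (stdSpace.map Z) (s n) + Cstar dist (s n : Measure Y) P :=
        Cstar_dist_triangle _ _ _
    _ ≤ ε / 2 + ε / 2 := by
        refine add_le_add ?_ h1
        rw [Cstar_dist_comm, ← hlaw n]
        exact (Cstar_dist_map_le stdSpace (hF n) hZ).trans h2
    _ = ε := ENNReal.add_halves ε

/-- A family of couplings of all countable families extends to each finite-distance class. -/
lemma exists_coupling_of_class {r : ℝ≥0∞} (hr : r ≠ ∞)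
    (h : ∀ P : ℕ → ProbabilityMeasure Y, ∃ π : Measure (ℕ → Y), IsProbabilityMeasure π ∧
      (∀ i, π.map (fun t => t i) = P i) ∧
      ∀ i j, ∫⁻ t, edist (t i) (t j) ∂π ≤ r * Cstar dist (P i : Measure Y) (P j))
    (P₀ : ProbabilityMeasure Y) :
    ∃ Z : ProbabilityMeasure Y → ℝ → Y,
      (∀ P : ProbabilityMeasure Y, Cstar dist (P₀ : Measure Y) P < ∞ →
        Measurable (Z P) ∧ stdSpace.map (Z P) = P) ∧
      ∀ P Q : ProbabilityMeasure Y, Cstar dist (P₀ : Measure Y) P < ∞ →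
        Cstar dist (P₀ : Measure Y) Q < ∞ →
        ∫⁻ u, edist (Z P u) (Z Q u) ∂stdSpace ≤ r * Cstar dist (P : Measure Y) Q := by
  classical
  obtain ⟨s, hs⟩ := exists_dense_seq_of_Cstar P₀
  obtain ⟨π, hπ, hπm, hπc⟩ := h s
  obtain ⟨F, hF, hFπ⟩ := exists_stdSpace_map_eq π
  have hFm : ∀ n, Measurable fun u => F u n := fun n => (measurable_pi_apply n).comp hF
  have hlaw : ∀ n, stdSpace.map (fun u => F u n) = s n := fun n => by
    rw [← hπm n, ← hFπ, Measure.map_map (measurable_pi_apply n) hF]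
    rfl
  have hcost : ∀ n m, ∫⁻ u, edist (F u n) (F u m) ∂stdSpace
      ≤ r * Cstar dist (s n : Measure Y) (s m) := fun n m => by
    refine le_of_eq_of_le ?_ (hπc n m)
    rw [← hFπ, lintegral_map ((measurable_pi_apply n).edist (measurable_pi_apply m)) hF]
  choose! Z hZ hZlaw hZa using fun P hP =>
    exists_limit_of_coupling (F := fun n u => F u n) hr hFm hlaw hcost P (hs P hP)
  refine ⟨Z, fun P hP => ⟨hZ P hP, hZlaw P hP⟩, fun P Q hP hQ => ?_⟩
  have hlin : ∀ ε : ℝ≥0∞, 0 < ε → ∫⁻ u, edist (Z P u) (Z Q u) ∂stdSpace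
      ≤ r * Cstar dist (P : Measure Y) Q + (2 + 2 * r) * ε := by
    intro ε hε
    obtain ⟨n, hn1, hn2⟩ := hZa P hP ε hε
    obtain ⟨m, hm1, hm2⟩ := hZa Q hQ ε hε
    have htri : Cstar dist (s n : Measure Y) (s m) ≤ ε + (Cstar dist (P : Measure Y) Q + ε) :=
      (Cstar_dist_triangle _ (P : Measure Y) _).trans <| add_le_add hn1 <|
        (Cstar_dist_triangle _ (Q : Measure Y) _).trans <| add_le_add le_rfl <| by
          rwa [Cstar_dist_comm]
    calc ∫⁻ u, edist (Z P u) (Z Q u) ∂stdSpace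
        ≤ ∫⁻ u, (edist (F u n) (Z P u) + (edist (F u n) (F u m) + edist (F u m) (Z Q u)))
          ∂stdSpace := lintegral_mono fun u => by
            refine (edist_triangle_left _ _ (F u n)).trans ?_
            gcongr
            exact edist_triangle _ _ _
      _ = ∫⁻ u, edist (F u n) (Z P u) ∂stdSpace + (∫⁻ u, edist (F u n) (F u m) ∂stdSpace +
          ∫⁻ u, edist (F u m) (Z Q u) ∂stdSpace) := by
            rw [lintegral_add_left ((hFm n).edist (hZ P hP)),
              lintegral_add_left ((hFm n).edist (hFm m))]
      _ ≤ ε + (r * (ε + (Cstar dist (P : Measure Y) Q + ε)) + ε) :=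
            add_le_add hn2 (add_le_add ((hcost n m).trans (by gcongr)) hm2)
      _ = _ := by ring
  have hlim : Filter.Tendsto (fun ε : ℝ≥0∞ => r * Cstar dist (P : Measure Y) Q + (2 + 2 * r) * ε)
      (nhdsWithin 0 (Set.Ioi 0)) (nhds (r * Cstar dist (P : Measure Y) Q + (2 + 2 * r) * 0)) := by
    have hc : (2 + 2 * r) ≠ ∞ := by finiteness
    exact Filter.Tendsto.mono_left ((continuous_const.add
      (ENNReal.continuous_const_mul hc)).tendsto 0) nhdsWithin_le_nhds
  rw [mul_zero, add_zero] at hlim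
  exact ge_of_tendsto hlim (by filter_upwards [self_mem_nhdsWithin] with ε hε using hlin ε hε)

theorem optRatio_dist_le {r : ℝ≥0∞} (hr1 : 1 ≤ r) (hr : r ≠ ∞)
    (h : ∀ P : ℕ → ProbabilityMeasure Y, ∃ π : Measure (ℕ → Y), IsProbabilityMeasure π ∧
      (∀ i, π.map (fun t => t i) = P i) ∧
      ∀ i j, ∫⁻ t, edist (t i) (t j) ∂π ≤ r * Cstar dist (P i : Measure Y) (P j)) :
    optRatio dist (fun P : ProbabilityMeasure Y => (P : Measure Y)) ≤ r := by
  choose Z hZ hZc using exists_coupling_of_class hr h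
  let S : Setoid (ProbabilityMeasure Y) :=
    { r := fun P Q => Cstar dist (P : Measure Y) Q < ∞
      iseqv :=
        { refl := fun P => by rw [Cstar_dist_self]; exact ENNReal.zero_lt_top
          symm := fun {P Q} hPQ => by rwa [Cstar_dist_comm]
          trans := fun {P Q U} h1 h2 => (Cstar_dist_triangle (P : Measure Y) Q U).trans_lt
            (ENNReal.add_lt_top.2 ⟨h1, h2⟩) } }
  let rep : ProbabilityMeasure Y → ProbabilityMeasure Y := fun P => (Quotient.mk S P).out
  have hrep : ∀ P, Cstar dist (rep P : Measure Y) P < ∞ := fun P => Quotient.mk_out (s := S) P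
  refine iInf₂_le_of_le (fun P => Z (rep P) P)
    ⟨fun P => (hZ _ P (hrep P)).1, fun P => (hZ _ P (hrep P)).2⟩ (sInf_le ⟨hr1, fun P Q => ?_⟩)
  simp only [← edist_dist]
  by_cases hPQ : Cstar dist (P : Measure Y) Q < ∞
  · have : rep P = rep Q := congr_arg Quotient.out (Quotient.sound (s := S) hPQ)
    rw [← this]
    exact hZc _ P Q (hrep P) (this ▸ hrep Q)
  · rw [not_lt_top_iff.1 hPQ, ENNReal.mul_top (zero_lt_one.trans_le hr1).ne']
    exact le_top

end Extension

/-- The snowflake metric `d ^ q`, compatible with the original uniformity. -/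
@[reducible]
def snowflakeMetricSpace (X : Type*) [m : MetricSpace X] {q : ℝ} (hq0 : 0 < q) (hq1 : q ≤ 1) :
    MetricSpace X :=
  (MetricSpace.induced (Metric.Snowflaking.toSnowflaking (α := q) (hα₀ := hq0) (hα₁ := hq1))
    (Equiv.injective _) inferInstance).replaceUniformity
    (congrArg _ (Metric.Snowflaking.uniformEquiv (X := X) (α := q) (hα₀ := hq0)
      (hα₁ := hq1)).symm.isUniformInducing.comap_uniformSpace.symm)

lemma snowflakeMetricSpace_dist {X : Type*} [m : MetricSpace X] {q : ℝ} (hq0 : 0 < q) (hq1 : q ≤ 1)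
    (x y : X) : (snowflakeMetricSpace X hq0 hq1).dist x y = dist x y ^ q :=
  Metric.Snowflaking.dist_toSnowflaking_toSnowflaking x y

lemma optRatio_dist_rpow_le {X : Type*} [MetricSpace X] [CompleteSpace X]
    [SecondCountableTopology X] [Nonempty X] [MeasurableSpace X] [BorelSpace X]
    {q R : ℝ} (hq0 : 0 < q) (hq1 : q < 1) (hR : 0 ≤ R) (h : HasDiscreteCouplings X q R) :
    optRatio (fun x y : X => dist x y ^ q)
        (fun P : ProbabilityMeasure X => (P : Measure X)) ≤ ENNReal.ofReal (max R 1) := by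
  have hr1 : 1 ≤ ENNReal.ofReal (max R 1) := by simp
  have hc : (fun x y : X => dist x y ^ q) = (snowflakeMetricSpace X hq0 hq1.le).dist := by
    ext x y
    exact (snowflakeMetricSpace_dist hq0 hq1.le x y).symm
  rw [hc]
  refine @optRatio_dist_le X (snowflakeMetricSpace X hq0 hq1.le) _ _ _ _ _ _ hr1 ofReal_ne_top ?_
  intro P
  obtain ⟨π, hπ, hlaw, hcost⟩ := h.exists_countable_coupling hq0 hq1 hR P
  refine ⟨π, hπ, hlaw, fun i j => ?_⟩
  simp only [@edist_dist X (snowflakeMetricSpace X hq0 hq1.le).toPseudoMetricSpace,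
    Cstar]
  rw [ENNReal.mul_iInf_of_ne (one_pos.trans_le hr1).ne' ofReal_ne_top]
  refine le_iInf fun γ => ?_
  rw [ENNReal.mul_iInf_of_ne (one_pos.trans_le hr1).ne' ofReal_ne_top]
  refine le_iInf fun hγ => ?_
  simp only [snowflakeMetricSpace_dist]
  refine (hcost i j γ hγ.1 hγ.2.1 hγ.2.2).trans ?_
  gcongr
  exact le_max_left _ _

lemma one_le_mul_of_measure_closedBall_diff_le {X : Type*} [MetricSpace X] [Nontrivial X]
    [MeasurableSpace X] (μ : Measure X) {Ψ : ℝ}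
    (hball : ∀ (x : X) (w : ℝ), 0 < w →
      0 < μ (Metric.closedBall x w) ∧ μ (Metric.closedBall x w) < ⊤)
    (hdiff : ∀ (x y : X) (w : ℝ), 0 < w →
      μ (Metric.closedBall x w \ Metric.closedBall y w) / μ (Metric.closedBall x w)
        ≤ ENNReal.ofReal (Ψ * dist x y / w)) : 1 ≤ 3 * Ψ := by
  obtain ⟨x, y, hxy⟩ := exists_pair_ne X
  have hd := dist_pos.2 hxy
  have hw : 0 < dist x y / 3 := by positivity
  have h := hdiff x y _ hw
  rw [(Metric.closedBall_disjoint_closedBall (by linarith)).sdiff_eq_left,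
    ENNReal.div_self (hball x _ hw).1.ne' (hball x _ hw).2.ne, ENNReal.one_le_ofReal] at h
  convert h using 1
  field_simp

lemma one_lt_snowflake_bound {q Ψ : ℝ} (hq0 : 0 < q) (hq1 : q < 1) (hΨ : 1 ≤ 3 * Ψ) :
    1 < 7.56 * (2.47 * Ψ) ^ q / (1 - q) := by
  have h : (0.82 : ℝ) ≤ (2.47 * Ψ) ^ q :=
    calc (0.82 : ℝ) = 0.82 ^ (1 : ℝ) := (Real.rpow_one _).symm
      _ ≤ 0.82 ^ q := Real.rpow_le_rpow_of_exponent_ge (by norm_num) (by norm_num) hq1.le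
      _ ≤ _ := Real.rpow_le_rpow (by norm_num) (by linarith) hq0.le
  rw [one_lt_div (by linarith)]
  linarith

/-- snowflake metric upper bound. Let `(X,d)` be a complete separable
metric space with at least two points, `0 < q < 1`, and `c(x,y) = d(x,y)^q`. Suppose a
σ-finite Borel measure `μ` and `Ψ > 0` satisfy: every closed ball `B_w(x)` (for `w > 0`)
has finite positive measure; `μ(B_w(x) \ B_w(y)) / μ(B_w(x)) ≤ Ψ d(x,y) / w` for all
`x, y` and `w > 0`; and `limsup_{w→∞} sup_{d(x,y) ≤ w} μ(B_w(x))/μ(B_w(y)) < ∞`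
(expressed as: there exist `W > 0` and a finite constant `C` with
`μ(B_w(x)) ≤ C μ(B_w(y))` whenever `w ≥ W` and `d(x,y) ≤ w`). Then the optimal pairwise
coupling ratio of the family of all Borel probability measures on `X` satisfies
`r*_c(P(X)) < 7.56 (2.47 Ψ)^q / (1 − q)`. -/
theorem snowflake_optRatio_lt {X : Type*} [MetricSpace X] [CompleteSpace X]
    [TopologicalSpace.SeparableSpace X] [Nontrivial X] [MeasurableSpace X] [BorelSpace X]
    (q : ℝ) (hq0 : 0 < q) (hq1 : q < 1)
    (μ : Measure X) [SigmaFinite μ] (Ψ : ℝ) (hΨ : 0 < Ψ)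
    (hball : ∀ (x : X) (w : ℝ), 0 < w →
      0 < μ (Metric.closedBall x w) ∧ μ (Metric.closedBall x w) < ⊤)
    (hdiff : ∀ (x y : X) (w : ℝ), 0 < w →
      μ (Metric.closedBall x w \ Metric.closedBall y w) / μ (Metric.closedBall x w)
        ≤ ENNReal.ofReal (Ψ * dist x y / w))
    (hlimsup : ∃ W > (0 : ℝ), ∃ C : NNReal, ∀ (x y : X) (w : ℝ), W ≤ w → dist x y ≤ w →
      μ (Metric.closedBall x w) ≤ (C : ℝ≥0∞) * μ (Metric.closedBall y w)) :
    optRatio (fun x y : X => dist x y ^ q)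
        (fun P : ProbabilityMeasure X => (P : Measure X))
      < ENNReal.ofReal (7.56 * (2.47 * Ψ) ^ q / (1 - q)) := by
  have := UniformSpace.secondCountable_of_separable X
  obtain ⟨R, hR0, hR, h⟩ := exists_hasDiscreteCouplings μ hq0 hq1 hΨ hball hdiff
  have hT := one_lt_snowflake_bound hq0 hq1
    (one_le_mul_of_measure_closedBall_diff_le μ hball hdiff)
  refine (optRatio_dist_rpow_le hq0 hq1 hR0 h).trans_lt ?_
  exact (ENNReal.ofReal_lt_ofReal_iff (one_pos.trans hT)).2 (max_lt hR hT)

end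
end

section
/- Let c(x,y) := ‖x − y‖_p^q on ℝⁿ, where p ∈ [1,∞] and q > 0. Then: (i) if n = 1 and q < 1, then r*_c(P(ℝ)) ≥ 2; (ii) if n ≥ 2 and q < 1, then r*_c(P(ℝⁿ)) ≥ max{ 2, 1/(1000·√(1 − q)) }; (iii) if n ≥ 2 and q ≥ 1, then r*_c(P(ℝⁿ)) = ∞. -/
open MeasureTheory ENNReal

noncomputable section

open Classical in
/-- The `ℓ_p` norm on `ℝⁿ` for an extended real exponent `p ∈ [1,∞]`:
`‖z‖_p = (∑ i |z i|^p)^{1/p}` for finite `p`, and `‖z‖_∞ = max_i |z i|`. -/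
def lpNorm (p : ℝ≥0∞) {n : ℕ} (z : Fin n → ℝ) : ℝ :=
  if p = ⊤ then ⨆ i, |z i| else (∑ i, |z i| ^ p.toReal) ^ (1 / p.toReal)

/-- `V_{m,p} = 2^m Γ(1 + 1/p)^m / Γ(1 + m/p)`: the volume of the unit `ℓ_p` ball in
`ℝ^m` (with the convention `1/p = 0` for `p = ∞`). -/
def unitBallVolume (p : ℝ≥0∞) (m : ℕ) : ℝ :=
  2 ^ m * Real.Gamma (1 + (p⁻¹).toReal) ^ m / Real.Gamma (1 + m * (p⁻¹).toReal)

/-- The optimal pairwise coupling ratio `r*_c(P(ℝⁿ))` of the family of all Borel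
probability measures on `ℝⁿ` for the cost `c(x,y) = ‖x − y‖_p^q`. -/
def lpOptRatio (n : ℕ) (p : ℝ≥0∞) (q : ℝ) : ℝ≥0∞ :=
  optRatio (fun x y : Fin n → ℝ => lpNorm p (x - y) ^ q)
    (fun P : ProbabilityMeasure (Fin n → ℝ) => (P : Measure (Fin n → ℝ)))

/-! ### Hole measures and the combinatorial form of a coupling -/

/-- The uniform distribution on the points `e x`, `x ≠ a`. -/
def holeMeasure {X ι : Type*} [MeasurableSpace X] [Fintype ι] [DecidableEq ι]
    (e : ι → X) (a : ι) : Measure X :=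
  ((Fintype.card ι - 1 : ℕ) : ℝ≥0∞)⁻¹ • ∑ x ∈ Finset.univ.erase a, Measure.dirac (e x)

section HoleMeasure

variable {X ι : Type*} [MeasurableSpace X] [Fintype ι] [DecidableEq ι]

lemma isProbabilityMeasure_holeMeasure (hι : 1 < Fintype.card ι) (e : ι → X) (a : ι) :
    IsProbabilityMeasure (holeMeasure e a) := by
  refine ⟨?_⟩
  have h0 : ((Fintype.card ι - 1 : ℕ) : ℝ≥0∞) ≠ 0 := by
    simp only [ne_eq, Nat.cast_eq_zero]; omega
  simp only [holeMeasure, Measure.smul_apply, Measure.finsetSum_apply, measure_univ,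
    Finset.sum_const, Finset.card_erase_of_mem (Finset.mem_univ a), Finset.card_univ,
    smul_eq_mul, nsmul_eq_mul, mul_one]
  exact ENNReal.inv_mul_cancel h0 (ENNReal.natCast_ne_top _)

lemma integral_holeMeasure [MeasurableSingletonClass X] (hι : 1 < Fintype.card ι)
    (e : ι → X) (a : ι) (g : X → ℝ) :
    ∫ y, g y ∂holeMeasure e a =
      (∑ x ∈ Finset.univ.erase a, g (e x)) / ((Fintype.card ι : ℝ) - 1) := by
  rw [holeMeasure, integral_smul_measure, integral_finsetSum_measure]
  · simp only [integral_dirac, ENNReal.toReal_inv, ENNReal.toReal_natCast, smul_eq_mul]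
    rw [Nat.cast_sub hι.le, Nat.cast_one, div_eq_inv_mul]
  · intro i _
    exact integrable_dirac (by simp)

lemma ae_mem_range_holeMeasure [MeasurableSingletonClass X] (e : ι → X) (a : ι) :
    ∀ᵐ y ∂holeMeasure e a, y ∈ Set.range e := by
  have hm : MeasurableSet (Set.range e)ᶜ := (Set.finite_range e).measurableSet.compl
  rw [ae_iff]
  change holeMeasure e a (Set.range e)ᶜ = 0
  simp [holeMeasure, Measure.finsetSum_apply, Measure.dirac_apply' _ hm]

/-- Transporting one hole measure to another costs at most one move of a single atom. -/
lemma Cstar_holeMeasure_le [MeasurableSingletonClass X] (hι : 1 < Fintype.card ι)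
    (c : X → X → ℝ) (hc0 : ∀ x, c x x = 0) (e : ι → X) (a b : ι) :
    Cstar c (holeMeasure e a) (holeMeasure e b) ≤
      ENNReal.ofReal (c (e b) (e a) / ((Fintype.card ι : ℝ) - 1)) := by
  have hk : 0 < (Fintype.card ι : ℝ) - 1 := by
    have : (1 : ℝ) < Fintype.card ι := by exact_mod_cast hι
    linarith
  set e₂ : ι → X × X := fun x => (e x, e (Equiv.swap a b x)) with he₂
  have hfst : (holeMeasure e₂ a).map Prod.fst = holeMeasure e a := by
    rw [holeMeasure, Measure.map_smul, Measure.map_finset_sum measurable_fst.aemeasurable]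
    simp only [Measure.map_dirac' measurable_fst]
    rfl
  have hsnd : (holeMeasure e₂ a).map Prod.snd = holeMeasure e b := by
    rw [holeMeasure, Measure.map_smul, Measure.map_finset_sum measurable_snd.aemeasurable]
    simp only [Measure.map_dirac' measurable_snd]
    rw [holeMeasure]
    congr 1
    refine Finset.sum_equiv (Equiv.swap a b) (fun i => ?_) (fun i _ => rfl)
    simp only [Finset.mem_erase, Finset.mem_univ, and_true, ne_eq]
    rw [Equiv.swap_apply_eq_iff, Equiv.swap_apply_right]
  refine (iInf₂_le (holeMeasure e₂ a)
    ⟨isProbabilityMeasure_holeMeasure hι e₂ a, hfst, hsnd⟩).trans ?_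
  rw [holeMeasure, lintegral_smul_measure, lintegral_finsetSum_measure]
  simp only [lintegral_dirac, he₂, smul_eq_mul]
  rw [div_eq_inv_mul, ENNReal.ofReal_mul (inv_nonneg.2 hk.le), ENNReal.ofReal_inv_of_pos hk]
  have hcast : ENNReal.ofReal ((Fintype.card ι : ℝ) - 1) = ((Fintype.card ι - 1 : ℕ) : ℝ≥0∞) := by
    rw [← ENNReal.ofReal_natCast, Nat.cast_sub hι.le, Nat.cast_one]
  rw [hcast]
  gcongr
  calc ∑ x ∈ Finset.univ.erase a, ENNReal.ofReal (c (e x) (e (Equiv.swap a b x)))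
      ≤ ∑ x ∈ Finset.univ.erase a, if x = b then ENNReal.ofReal (c (e b) (e a)) else 0 := by
        refine Finset.sum_le_sum fun x hx => ?_
        split_ifs with hxb
        · rw [hxb, Equiv.swap_apply_right]
        · rw [Equiv.swap_apply_of_ne_of_ne (Finset.ne_of_mem_erase hx) hxb, hc0]
          simp
    _ ≤ ∑ x, if x = b then ENNReal.ofReal (c (e b) (e a)) else 0 :=
        Finset.sum_le_sum_of_subset (Finset.subset_univ _)
    _ = ENNReal.ofReal (c (e b) (e a)) := by simp

/-- A coupling of all probability measures with finite ratio `r` gives a random self-map of any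
finite index set: `w φ` is the probability that, for every `a`, the hole measure at `a` is
represented by the point `e (φ a)`. -/
lemma exists_weights [MeasurableSingletonClass X] (hι : 1 < Fintype.card ι)
    (c : X → X → ℝ) (hc0 : ∀ x, c x x = 0) (hc : ∀ x y, 0 ≤ c x y)
    (e : ι → X) (he : Function.Injective e)
    {f : ProbabilityMeasure X → ℝ → X}
    (hf : IsCoupling (fun P : ProbabilityMeasure X => (P : Measure X)) f)
    {r : ℝ≥0∞} (hr : r ≠ ⊤)
    (h : ∀ P Q : ProbabilityMeasure X,
      ∫⁻ u, ENNReal.ofReal (c (f P u) (f Q u)) ∂stdSpace ≤ r * Cstar c (P : Measure X) Q) :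
    ∃ w : (ι → ι) → ℝ, (∀ φ, 0 ≤ w φ) ∧
      (∀ a (g : ι → ℝ), ∑ φ, w φ * g (φ a) =
        (∑ x ∈ Finset.univ.erase a, g x) / ((Fintype.card ι : ℝ) - 1)) ∧
      ∀ a b, ∑ φ, w φ * c (e (φ a)) (e (φ b)) ≤
        r.toReal * (c (e b) (e a) / ((Fintype.card ι : ℝ) - 1)) := by
  have hk : 0 < (Fintype.card ι : ℝ) - 1 := by
    have : (1 : ℝ) < Fintype.card ι := by exact_mod_cast hι
    linarith
  have : Nonempty ι := Fintype.card_pos_iff.1 (by omega)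
  let _ : MeasurableSpace ι := ⊤
  have : MeasurableSingletonClass ι := ⟨fun _ => trivial⟩
  have hemb : MeasurableEmbedding e :=
    ⟨he, measurable_of_finite e, fun s _ => (s.toFinite.image e).measurableSet⟩
  obtain ⟨inv, hinv, hinve⟩ := hemb.exists_measurable_extend (g := (id : ι → ι)) measurable_id
    (fun _ => inferInstance)
  have hinve' : ∀ x, inv (e x) = x := fun x => congrFun hinve x
  let P : ι → ProbabilityMeasure X := fun a =>
    ⟨holeMeasure e a, isProbabilityMeasure_holeMeasure hι e a⟩
  let Y : ℝ → ι → ι := fun u a => inv (f (P a) u)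
  have hY : Measurable Y := measurable_pi_lambda _ fun a => hinv.comp (hf.measurable (P a))
  have : IsFiniteMeasure stdSpace := by
    unfold stdSpace; infer_instance
  have hlaw : ∀ a, stdSpace.map (f (P a)) = holeMeasure e a := fun a => hf.law (P a)
  have hrange : ∀ a, ∀ᵐ u ∂stdSpace, e (Y u a) = f (P a) u := by
    intro a
    have h1 := ae_mem_range_holeMeasure e a
    rw [← hlaw a] at h1
    filter_upwards [ae_of_ae_map (hf.measurable (P a)).aemeasurable h1] with u hu
    obtain ⟨x, hx⟩ := hu
    simp only [Y, ← hx, hinve']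
  refine ⟨fun φ => (stdSpace.map Y).real {φ}, fun φ => measureReal_nonneg, ?_, ?_⟩
  · intro a g
    have h1 : ∫ φ, g (φ a) ∂(stdSpace.map Y) = ∑ φ, (stdSpace.map Y).real {φ} * g (φ a) := by
      rw [integral_fintype Integrable.of_finite]
      simp only [smul_eq_mul]
    rw [← h1, integral_map hY.aemeasurable (measurable_of_finite _).aestronglyMeasurable]
    have h2 : ∫ u, g (Y u a) ∂stdSpace = ∫ y, g (inv y) ∂(stdSpace.map (f (P a))) :=
      (integral_map (f := fun y => g (inv y)) (hf.measurable (P a)).aemeasurable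
        ((measurable_of_finite g).comp hinv).aestronglyMeasurable).symm
    rw [h2, hlaw, integral_holeMeasure hι]
    simp only [hinve']
  · intro a b
    have h1 := (h (P a) (P b)).trans
      (mul_le_mul_right (Cstar_holeMeasure_le hι c hc0 e a b) r)
    have h2 : ∫⁻ u, ENNReal.ofReal (c (f (P a) u) (f (P b) u)) ∂stdSpace =
        ENNReal.ofReal (∑ φ, (stdSpace.map Y).real {φ} * c (e (φ a)) (e (φ b))) := by
      have : ∫⁻ u, ENNReal.ofReal (c (f (P a) u) (f (P b) u)) ∂stdSpace =
          ∫⁻ u, ENNReal.ofReal (c (e (Y u a)) (e (Y u b))) ∂stdSpace := by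
        refine lintegral_congr_ae ?_
        filter_upwards [hrange a, hrange b] with u hu hv
        rw [hu, hv]
      rw [this, ← lintegral_map (μ := stdSpace) (g := Y)
        (f := fun φ => ENNReal.ofReal (c (e (φ a)) (e (φ b)))) (measurable_of_finite _) hY,
        lintegral_fintype, ENNReal.ofReal_sum_of_nonneg
          (fun φ _ => mul_nonneg measureReal_nonneg (hc _ _))]
      refine Finset.sum_congr rfl fun φ _ => ?_
      rw [ENNReal.ofReal_mul measureReal_nonneg, mul_comm, measureReal_def,
        ENNReal.ofReal_toReal (measure_ne_top _ _)]
    rw [h2, ← ENNReal.ofReal_toReal hr, ← ENNReal.ofReal_mul ENNReal.toReal_nonneg] at h1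
    exact (ENNReal.ofReal_le_ofReal_iff (mul_nonneg ENNReal.toReal_nonneg
      (div_nonneg (hc _ _) hk.le))).1 h1

end HoleMeasure

/-! ### The `ℓ_p` norm on `ℝⁿ` -/

section LpNorm

variable {p : ℝ≥0∞} {n : ℕ}

lemma one_le_toReal_of_ne_top (hp : 1 ≤ p) (h : p ≠ ⊤) : 1 ≤ p.toReal := by
  rw [← ENNReal.toReal_one]
  exact ENNReal.toReal_mono h hp

lemma lpNorm_nonneg (p : ℝ≥0∞) (z : Fin n → ℝ) : 0 ≤ lpNorm p z := by
  unfold _root_.lpNorm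
  split_ifs
  · exact Real.iSup_nonneg fun i => abs_nonneg _
  · positivity

lemma lpNorm_neg (p : ℝ≥0∞) (z : Fin n → ℝ) : lpNorm p (-z) = lpNorm p z := by
  simp [_root_.lpNorm]

lemma lpNorm_sub_comm (p : ℝ≥0∞) (x y : Fin n → ℝ) : lpNorm p (x - y) = lpNorm p (y - x) := by
  rw [← lpNorm_neg, neg_sub]

lemma abs_apply_le_lpNorm (hp : 1 ≤ p) (z : Fin n → ℝ) (i : Fin n) : |z i| ≤ lpNorm p z := by
  unfold _root_.lpNorm
  split_ifs with h
  · exact le_ciSup (f := fun i => |z i|) (Set.finite_range _).bddAbove i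
  · have h1 := one_le_toReal_of_ne_top hp h
    have h2 : |z i| ^ p.toReal ≤ ∑ i, |z i| ^ p.toReal :=
      Finset.single_le_sum (f := fun i => |z i| ^ p.toReal)
        (fun j _ => by positivity) (Finset.mem_univ i)
    calc |z i| = (|z i| ^ p.toReal) ^ (1 / p.toReal) := by
          rw [← Real.rpow_mul (abs_nonneg _), mul_one_div_cancel (by linarith), Real.rpow_one]
      _ ≤ _ := Real.rpow_le_rpow (by positivity) h2 (by positivity)

lemma lpNorm_add_le (hp : 1 ≤ p) (x y : Fin n → ℝ) :
    lpNorm p (x + y) ≤ lpNorm p x + lpNorm p y := by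
  by_cases h : p = ⊤
  · rcases isEmpty_or_nonempty (Fin n) with hn | hn
    · simp [_root_.lpNorm, h]
    · have hx := abs_apply_le_lpNorm hp x
      have hy := abs_apply_le_lpNorm hp y
      conv_lhs => rw [_root_.lpNorm, if_pos h]
      exact ciSup_le fun i => (abs_add_le _ _).trans (add_le_add (hx i) (hy i))
  · simp only [_root_.lpNorm, if_neg h]
    exact Real.Lp_add_le _ x y (one_le_toReal_of_ne_top hp h)

lemma lpNorm_single (hp : 1 ≤ p) (i : Fin n) (t : ℝ) : lpNorm p (Pi.single i t) = |t| := by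
  refine le_antisymm ?_ (by simpa using abs_apply_le_lpNorm hp (Pi.single i t) i)
  unfold _root_.lpNorm
  have habs : ∀ j, |(Pi.single i t : Fin n → ℝ) j| = if j = i then |t| else 0 := by
    intro j
    by_cases hj : j = i
    · subst hj; simp
    · simp [hj]
  simp only [habs]
  split_ifs with h
  · have : Nonempty (Fin n) := ⟨i⟩
    refine ciSup_le fun j => ?_
    split_ifs
    · exact le_rfl
    · exact abs_nonneg t
  · have h1 := one_le_toReal_of_ne_top hp h
    have h2 : ∀ j, (if j = i then |t| else 0 : ℝ) ^ p.toReal =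
        if j = i then |t| ^ p.toReal else 0 := by
      intro j
      split_ifs
      · rfl
      · exact Real.zero_rpow (by linarith)
    simp only [h2, Finset.sum_ite_eq', Finset.mem_univ, if_true]
    rw [← Real.rpow_mul (abs_nonneg _), mul_one_div_cancel (by linarith), Real.rpow_one]

lemma lpNorm_zero (hp : 1 ≤ p) (hn : 0 < n) : lpNorm p (0 : Fin n → ℝ) = 0 := by
  have := lpNorm_single hp (⟨0, hn⟩ : Fin n) 0
  simpa using this

end LpNorm

/-- A lower bound for `r*_c` may be checked on each coupling with finite ratio, through the random
self-maps that it induces on finite sets of points. -/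
lemma le_lpOptRatio {n : ℕ} {p : ℝ≥0∞} (hp : 1 ≤ p) (hn : 0 < n) {q : ℝ} (hq : 0 < q) {B : ℝ≥0∞}
    (hB : ∀ R : ℝ, 1 ≤ R →
      (∀ (ι : Type) [Fintype ι] [DecidableEq ι], 1 < Fintype.card ι → ∀ e : ι → Fin n → ℝ,
        Function.Injective e → ∃ w : (ι → ι) → ℝ, (∀ φ, 0 ≤ w φ) ∧
        (∀ a (g : ι → ℝ), ∑ φ, w φ * g (φ a) =
          (∑ x ∈ Finset.univ.erase a, g x) / ((Fintype.card ι : ℝ) - 1)) ∧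
        ∀ a b, ∑ φ, w φ * lpNorm p (e (φ a) - e (φ b)) ^ q ≤
          R * (lpNorm p (e b - e a) ^ q / ((Fintype.card ι : ℝ) - 1))) →
      B ≤ ENNReal.ofReal R) :
    B ≤ lpOptRatio n p q := by
  unfold lpOptRatio optRatio
  refine le_iInf₂ fun f hf => le_sInf ?_
  rintro r ⟨hr1, hr⟩
  by_cases htop : r = ⊤
  · simp [htop]
  rw [← ENNReal.ofReal_toReal htop]
  refine hB r.toReal ?_ fun ι _ _ hι e he => ?_
  · rw [← ENNReal.toReal_one]
    exact ENNReal.toReal_mono htop hr1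
  · refine exists_weights hι (fun x y : Fin n → ℝ => lpNorm p (x - y) ^ q) ?_ ?_ e he hf htop hr
    · intro x
      simp only [sub_self, lpNorm_zero hp hn, Real.zero_rpow hq.ne']
    · exact fun x y => Real.rpow_nonneg (lpNorm_nonneg _ _) _

/-! ### Random self-maps without fixed points on a segment -/

lemma exists_ne_succ_of_ne {α : Type*} (g : ℕ → α) {a b : ℕ} (hab : a ≤ b) (h : g a ≠ g b) :
    ∃ i, a ≤ i ∧ i < b ∧ g i ≠ g (i + 1) := by
  by_contra! hcon
  refine h ?_
  induction b, hab using Nat.le_induction with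
  | base => rfl
  | succ b hb ih =>
    by_cases hgb : g a = g b
    · rw [hgb]
      exact hcon b hb (Nat.lt_succ_self b)
    · exact absurd (ih hgb fun i hi hib => hcon i hi (by omega)) hgb

lemma two_le_sum_of_fixedPointFree {k : ℕ} {c : Fin (k + 1) → Fin (k + 1) → ℝ}
    (hc : ∀ x y, 0 ≤ c x y) (hc1 : ∀ x y, x ≠ y → 1 ≤ c x y) (φ : Fin (k + 1) → Fin (k + 1))
    (hφ : ∀ a, φ a ≠ a) :
    2 ≤ ∑ i : Fin k, c (φ i.castSucc) (φ i.succ) + 2 * c (φ 0) (φ (Fin.last k)) := by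
  have hsum : 0 ≤ ∑ i : Fin k, c (φ i.castSucc) (φ i.succ) := Finset.sum_nonneg fun i _ => hc _ _
  by_cases h0 : φ 0 = φ (Fin.last k)
  swap
  · linarith [hc1 _ _ h0]
  set v := φ 0 with hv
  let g : ℕ → Fin (k + 1) := fun i => φ (Fin.ofNat (k + 1) i)
  have hg : ∀ x : Fin (k + 1), g x = φ x := fun x => by simp [g]
  have hg0 : g 0 = v := by simpa using hg 0
  have hgk : g k = v := by rw [h0]; simpa using hg (Fin.last k)
  have hgv : g v ≠ v := by rw [hg]; exact hφ v
  obtain ⟨i, -, hiv, hi⟩ := exists_ne_succ_of_ne g (Nat.zero_le v) (by rw [hg0]; exact hgv.symm)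
  obtain ⟨j, hjv, hjk, hj⟩ := exists_ne_succ_of_ne g (Nat.le_of_lt_succ v.2)
    (by rw [hgk]; exact hgv)
  have hik : i < k := by omega
  have hcast : ∀ l (hl : l < k),
      g l = φ (Fin.castSucc ⟨l, hl⟩) ∧ g (l + 1) = φ (Fin.succ ⟨l, hl⟩) :=
    fun l hl => ⟨hg (Fin.castSucc ⟨l, hl⟩), hg (Fin.succ ⟨l, hl⟩)⟩
  rw [(hcast i hik).1, (hcast i hik).2] at hi
  rw [(hcast j hjk).1, (hcast j hjk).2] at hj
  have hij : (⟨i, hik⟩ : Fin k) ≠ ⟨j, hjk⟩ := by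
    rw [ne_eq, Fin.mk.injEq]; omega
  have hpair : ∑ l ∈ {⟨i, hik⟩, ⟨j, hjk⟩}, c (φ (Fin.castSucc l)) (φ (Fin.succ l)) ≤
      ∑ l : Fin k, c (φ l.castSucc) (φ l.succ) :=
    Finset.sum_le_sum_of_subset_of_nonneg (Finset.subset_univ _) fun _ _ _ => hc _ _
  rw [Finset.sum_pair hij] at hpair
  linarith [hc1 _ _ hi, hc1 _ _ hj, hc v (φ (Fin.last k))]

section Weights

variable {ι : Type*} [Fintype ι] [DecidableEq ι] {w : (ι → ι) → ℝ}

lemma sum_weights_eq_one (hι : 1 < Fintype.card ι)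
    (hlaw : ∀ a (g : ι → ℝ), ∑ φ, w φ * g (φ a) =
      (∑ x ∈ Finset.univ.erase a, g x) / ((Fintype.card ι : ℝ) - 1)) :
    ∑ φ, w φ = 1 := by
  have hk : (1 : ℝ) < Fintype.card ι := by exact_mod_cast hι
  obtain ⟨a⟩ : Nonempty ι := Fintype.card_pos_iff.1 (by omega)
  have h := hlaw a fun _ => 1
  simp only [mul_one, Finset.sum_const, Finset.card_erase_of_mem (Finset.mem_univ a),
    Finset.card_univ, nsmul_eq_mul, Nat.cast_sub hι.le, Nat.cast_one] at h
  rw [h, div_self (by linarith)]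

lemma fixedPointFree_of_weight_ne_zero (hw : ∀ φ, 0 ≤ w φ)
    (hlaw : ∀ a (g : ι → ℝ), ∑ φ, w φ * g (φ a) =
      (∑ x ∈ Finset.univ.erase a, g x) / ((Fintype.card ι : ℝ) - 1))
    {φ : ι → ι} (hφ : w φ ≠ 0) (a : ι) : φ a ≠ a := by
  intro ha
  have h := hlaw a fun x => if x = a then 1 else 0
  rw [Finset.sum_eq_zero (s := Finset.univ.erase a)
    (fun x hx => if_neg (Finset.ne_of_mem_erase hx)), zero_div] at h
  have h2 := (Finset.sum_eq_zero_iff_of_nonneg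
    (fun ψ _ => mul_nonneg (hw ψ) (by split_ifs <;> norm_num))).1 h φ (Finset.mem_univ φ)
  simp [ha, hφ] at h2

end Weights

lemma two_le_of_weights_segment {k : ℕ} (hk : 0 < k) {c : Fin (k + 1) → Fin (k + 1) → ℝ}
    (hc : ∀ x y, 0 ≤ c x y) (hc1 : ∀ x y, x ≠ y → 1 ≤ c x y)
    {w : (Fin (k + 1) → Fin (k + 1)) → ℝ} (hw : ∀ φ, 0 ≤ w φ)
    (hlaw : ∀ a (g : Fin (k + 1) → ℝ), ∑ φ, w φ * g (φ a) =
      (∑ x ∈ Finset.univ.erase a, g x) / ((Fintype.card (Fin (k + 1)) : ℝ) - 1))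
    {A B : ℝ} (hA : ∀ i : Fin k, ∑ φ, w φ * c (φ i.castSucc) (φ i.succ) ≤ A)
    (hB : ∑ φ, w φ * c (φ 0) (φ (Fin.last k)) ≤ B) :
    2 ≤ k * A + 2 * B := by
  calc (2 : ℝ) = ∑ φ, w φ * 2 := by
        rw [← Finset.sum_mul, sum_weights_eq_one (by simp [hk]) hlaw, one_mul]
    _ ≤ ∑ φ, w φ * (∑ i : Fin k, c (φ i.castSucc) (φ i.succ) +
          2 * c (φ 0) (φ (Fin.last k))) := by
        refine Finset.sum_le_sum fun φ _ => ?_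
        by_cases hφ : w φ = 0
        · simp [hφ]
        · exact mul_le_mul_of_nonneg_left (two_le_sum_of_fixedPointFree hc hc1 φ
            (fixedPointFree_of_weight_ne_zero hw hlaw hφ)) (hw φ)
    _ = ∑ i : Fin k, ∑ φ, w φ * c (φ i.castSucc) (φ i.succ) +
          2 * ∑ φ, w φ * c (φ 0) (φ (Fin.last k)) := by
        rw [Finset.sum_comm, Finset.mul_sum, ← Finset.sum_add_distrib]
        refine Finset.sum_congr rfl fun φ _ => ?_
        rw [mul_add, Finset.mul_sum]
        ring
    _ ≤ k * A + 2 * B := by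
        refine add_le_add ?_ (by linarith)
        refine (Finset.sum_le_sum fun i _ => hA i).trans ?_
        simp

lemma one_le_abs_natCast_sub {a b : ℕ} (h : a ≠ b) : (1 : ℝ) ≤ |(a : ℝ) - b| := by
  have h1 : (1 : ℤ) ≤ |(a : ℤ) - b| := Int.one_le_abs (by omega)
  exact_mod_cast h1

theorem two_le_lpOptRatio {n : ℕ} {p : ℝ≥0∞} (hp : 1 ≤ p) (hn : 0 < n) {q : ℝ} (hq : 0 < q)
    (hq1 : q < 1) : 2 ≤ lpOptRatio n p q := by
  refine le_lpOptRatio hp hn hq fun R hR1 hR => ?_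
  suffices h : ∀ k : ℕ, 0 < k → 2 ≤ R * (1 + 2 * (k : ℝ) ^ (q - 1)) by
    have hlim : Filter.Tendsto (fun k : ℕ => R * (1 + 2 * (k : ℝ) ^ (q - 1))) Filter.atTop
        (nhds (R * (1 + 2 * 0))) := by
      refine (((Filter.Tendsto.const_mul 2 ?_).const_add 1).const_mul R)
      have h1 := (tendsto_rpow_neg_atTop (show 0 < 1 - q by linarith)).comp
        tendsto_natCast_atTop_atTop
      simpa [Function.comp_def] using h1
    have h2 : 2 ≤ R * (1 + 2 * 0) :=
      ge_of_tendsto hlim (Filter.eventually_atTop.2 ⟨1, fun k hk => h k hk⟩)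
    rw [show (2 : ℝ≥0∞) = ENNReal.ofReal 2 by simp]
    exact ENNReal.ofReal_le_ofReal (by linarith)
  intro k hk
  let e : Fin (k + 1) → Fin n → ℝ := fun i => Pi.single ⟨0, hn⟩ ((i : ℕ) : ℝ)
  have hdist : ∀ i j, lpNorm p (e i - e j) = |((i : ℕ) : ℝ) - ((j : ℕ) : ℝ)| := by
    intro i j
    rw [← Pi.single_sub, lpNorm_single hp]
  have he : Function.Injective e := by
    intro i j hij
    have := Pi.single_injective _ hij
    exact Fin.ext (by exact_mod_cast this)
  obtain ⟨w, hw, hlaw, hcost⟩ := hR (Fin (k + 1)) (by simp [hk]) e he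
  have hk0 : (0 : ℝ) < k := by exact_mod_cast hk
  have hcard : ((Fintype.card (Fin (k + 1)) : ℕ) : ℝ) - 1 = k := by simp
  have key := two_le_of_weights_segment hk (c := fun x y => lpNorm p (e x - e y) ^ q)
    (fun x y => Real.rpow_nonneg (lpNorm_nonneg _ _) _) ?_ hw hlaw (A := R / k)
    (B := R * ((k : ℝ) ^ q / k)) ?_ ?_
  · rw [Real.rpow_sub_one hk0.ne']
    refine key.trans_eq ?_
    field_simp
  · intro x y hxy
    rw [hdist]
    exact Real.one_le_rpow (one_le_abs_natCast_sub fun h => hxy (Fin.ext h)) hq.le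
  · intro i
    refine (hcost _ _).trans_eq ?_
    rw [hcard, hdist]
    simp [div_eq_mul_inv]
  · refine (hcost _ _).trans_eq ?_
    rw [hcard, hdist]
    simp

/-! ### A Sobolev inequality and random self-maps on a square grid -/

section Grid

variable {α : Type*} {d : α → α → ℝ}

lemma le_sum_range_of_triangle (hd : ∀ x y, 0 ≤ d x y) (hd0 : ∀ x, d x x = 0)
    (hsymm : ∀ x y, d x y = d y x) (htri : ∀ x y z, d x z ≤ d x y + d y z)
    {m : ℕ} (g : Fin (m + 1) → α) (i j : Fin (m + 1)) :
    d (g i) (g j) ≤ ∑ k : Fin m, d (g k.castSucc) (g k.succ) := by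
  wlog hij : i ≤ j generalizing i j
  · rw [hsymm]
    exact this j i (le_of_not_ge hij)
  have hstep : ∀ l : Fin (m + 1), i ≤ l →
      d (g i) (g l) ≤ ∑ k : Fin m with k.castSucc < l, d (g k.castSucc) (g k.succ) := by
    intro l
    induction l using Fin.induction with
    | zero =>
      intro h
      rw [Fin.le_zero_iff.1 h, hd0]
      exact Finset.sum_nonneg fun _ _ => hd _ _
    | succ l ih =>
      intro h
      rcases h.eq_or_lt with rfl | h
      · rw [hd0]
        exact Finset.sum_nonneg fun _ _ => hd _ _
      · have hset : (Finset.univ.filter fun k : Fin m => k.castSucc < l.succ) =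
            insert l (Finset.univ.filter fun k : Fin m => k.castSucc < l.castSucc) := by
          ext k
          simp only [Finset.mem_filter, Finset.mem_univ, true_and, Finset.mem_insert, Fin.lt_def,
            Fin.val_castSucc, Fin.val_succ, Fin.ext_iff]
          omega
        rw [hset, Finset.sum_insert (by simp)]
        have := ih (Fin.le_castSucc_iff.2 h)
        linarith [htri (g i) (g l.castSucc) (g l.succ)]
  refine (hstep j hij).trans ?_
  exact Finset.sum_le_sum_of_subset_of_nonneg (Finset.subset_univ _) fun _ _ _ => hd _ _

/-- The total variation of a map on the square grid: the sum of `d` over all pairs of neighbours. -/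
def gridVariation {m : ℕ} (d : α → α → ℝ) (φ : Fin (m + 1) × Fin (m + 1) → α) : ℝ :=
  ∑ i, ∑ k : Fin m, d (φ (i, k.castSucc)) (φ (i, k.succ)) +
    ∑ j, ∑ k : Fin m, d (φ (k.castSucc, j)) (φ (k.succ, j))

lemma gridVariation_nonneg (hd : ∀ x y, 0 ≤ d x y) {m : ℕ} (φ : Fin (m + 1) × Fin (m + 1) → α) :
    0 ≤ gridVariation d φ :=
  add_nonneg (Finset.sum_nonneg fun _ _ => Finset.sum_nonneg fun _ _ => hd _ _)
    (Finset.sum_nonneg fun _ _ => Finset.sum_nonneg fun _ _ => hd _ _)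

/-- A Poincaré–Sobolev inequality on the square grid. -/
lemma sum_sq_le_gridVariation_sq (hd : ∀ x y, 0 ≤ d x y) (hd0 : ∀ x, d x x = 0)
    (hsymm : ∀ x y, d x y = d y x) (htri : ∀ x y z, d x z ≤ d x y + d y z)
    {m : ℕ} (φ : Fin (m + 1) × Fin (m + 1) → α) :
    ∑ b, ∑ a, d (φ a) (φ b) ^ 2 ≤ ((m : ℝ) + 1) ^ 2 * gridVariation d φ ^ 2 := by
  set C : Fin (m + 1) → ℝ := fun i => ∑ k : Fin m, d (φ (i, k.castSucc)) (φ (i, k.succ)) with hC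
  set D : Fin (m + 1) → ℝ := fun j => ∑ k : Fin m, d (φ (k.castSucc, j)) (φ (k.succ, j)) with hD
  have hcol : ∀ i j j', d (φ (i, j)) (φ (i, j')) ≤ C i := fun i j j' =>
    le_sum_range_of_triangle hd hd0 hsymm htri (fun j => φ (i, j)) j j'
  have hrow : ∀ i i' j, d (φ (i, j)) (φ (i', j)) ≤ D j := fun i i' j =>
    le_sum_range_of_triangle hd hd0 hsymm htri (fun i => φ (i, j)) i i'
  calc ∑ b, ∑ a, d (φ a) (φ b) ^ 2
      ≤ ∑ b : Fin (m + 1) × Fin (m + 1), ∑ a : Fin (m + 1) × Fin (m + 1),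
          (C a.1 + D b.2) * (D a.2 + C b.1) := by
        refine Finset.sum_le_sum fun b _ => Finset.sum_le_sum fun a _ => ?_
        have h1 : d (φ a) (φ b) ≤ C a.1 + D b.2 :=
          (htri _ (φ (a.1, b.2)) _).trans (add_le_add (hcol _ _ _) (hrow _ _ _))
        have h2 : d (φ a) (φ b) ≤ D a.2 + C b.1 :=
          (htri _ (φ (b.1, a.2)) _).trans (add_le_add (hrow _ _ _) (hcol _ _ _))
        rw [sq]
        exact mul_le_mul h1 h2 (hd _ _) ((hd _ _).trans h1)
    _ = ((m : ℝ) + 1) ^ 2 * (∑ i, C i + ∑ j, D j) ^ 2 := by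
        simp only [Fintype.sum_prod_type, add_mul, mul_add, Finset.sum_add_distrib,
          ← Finset.mul_sum, ← Finset.sum_mul, Finset.sum_const, Finset.card_univ,
          Fintype.card_fin, Fintype.card_prod, nsmul_eq_mul, Nat.cast_mul,
          Nat.cast_add, Nat.cast_one]
        ring
    _ = ((m : ℝ) + 1) ^ 2 * gridVariation d φ ^ 2 := rfl

end Grid

lemma log_one_add_le_of_triangle {x y z : ℝ} (hy : 0 ≤ y) (hz : 0 ≤ z)
    (h : z ≤ x + y) : Real.log (1 + z) ≤ Real.log (1 + y) + x * (1 + y)⁻¹ := by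
  have hy1 : 0 < 1 + y := by linarith
  have h1 : Real.log (1 + z) - Real.log (1 + y) ≤ (1 + z) / (1 + y) - 1 := by
    rw [← Real.log_div (by linarith) hy1.ne']
    exact Real.log_le_sub_one_of_pos (by positivity)
  have h2 : (1 + z) / (1 + y) - 1 ≤ x * (1 + y)⁻¹ := by
    rw [← div_eq_mul_inv, div_sub_one hy1.ne']
    gcongr
    linarith
  linarith

/-- Logarithmic lower bound for random self-maps of the square grid. -/
lemma sum_log_le_of_weights_grid {m : ℕ} (hm : 0 < m)
    {d : Fin (m + 1) × Fin (m + 1) → Fin (m + 1) × Fin (m + 1) → ℝ}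
    (hd : ∀ x y, 0 ≤ d x y) (hd0 : ∀ x, d x x = 0)
    (hsymm : ∀ x y, d x y = d y x) (htri : ∀ x y z, d x z ≤ d x y + d y z)
    {w : (Fin (m + 1) × Fin (m + 1) → Fin (m + 1) × Fin (m + 1)) → ℝ} (hw : ∀ φ, 0 ≤ w φ)
    (hlaw : ∀ a (g : Fin (m + 1) × Fin (m + 1) → ℝ), ∑ φ, w φ * g (φ a) =
      (∑ x ∈ Finset.univ.erase a, g x) /
        ((Fintype.card (Fin (m + 1) × Fin (m + 1)) : ℝ) - 1))
    {R S : ℝ} (hR : 0 ≤ R)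
    (hcol : ∀ i (k : Fin m), ∑ φ, w φ * d (φ (i, k.castSucc)) (φ (i, k.succ)) ≤
      R / ((Fintype.card (Fin (m + 1) × Fin (m + 1)) : ℝ) - 1))
    (hrow : ∀ j (k : Fin m), ∑ φ, w φ * d (φ (k.castSucc, j)) (φ (k.succ, j)) ≤
      R / ((Fintype.card (Fin (m + 1) × Fin (m + 1)) : ℝ) - 1))
    (hS : ∀ x, ∑ a, ((1 + d x a)⁻¹) ^ 2 ≤ S) :
    ∑ a, ∑ x, Real.log (1 + d x a) ≤ ((m : ℝ) + 1) ^ 4 * (2 * √S * R) := by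
  have hm0 : (0 : ℝ) < m := by exact_mod_cast hm
  set N : ℝ := (Fintype.card (Fin (m + 1) × Fin (m + 1)) : ℝ) with hN
  have hNm : N = ((m : ℝ) + 1) ^ 2 := by
    simp only [hN, Fintype.card_prod, Fintype.card_fin]; push_cast; ring
  have hN1 : 0 < N - 1 := by rw [hNm]; nlinarith
  have hS0 : 0 ≤ S := (Finset.sum_nonneg fun _ _ => sq_nonneg _).trans (hS (0, 0))
  set Ψ := ∑ a, ∑ x, Real.log (1 + d x a) with hΨ
  -- pointwise comparison of the map with each of its values
  have hpt : ∀ φ : Fin (m + 1) × Fin (m + 1) → Fin (m + 1) × Fin (m + 1),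
      N * ∑ a, Real.log (1 + d (φ a) a) ≤
        ∑ b, ∑ a, Real.log (1 + d (φ b) a) + N * √S * gridVariation d φ := by
    intro φ
    have h1 : N * ∑ a, Real.log (1 + d (φ a) a) ≤ ∑ b, ∑ a, (Real.log (1 + d (φ b) a) +
        d (φ a) (φ b) * (1 + d (φ b) a)⁻¹) := by
      rw [hN, ← nsmul_eq_mul, ← Finset.card_univ, ← Finset.sum_const]
      exact Finset.sum_le_sum fun b _ => Finset.sum_le_sum fun a _ =>
        log_one_add_le_of_triangle (hd _ _) (hd _ _) (htri _ _ _)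
    have h2 : ∑ b, ∑ a, d (φ a) (φ b) * (1 + d (φ b) a)⁻¹ ≤ N * √S * gridVariation d φ := by
      have hcs := Real.sum_mul_le_sqrt_mul_sqrt Finset.univ
        (fun z : (Fin (m + 1) × Fin (m + 1)) × (Fin (m + 1) × Fin (m + 1)) => d (φ z.2) (φ z.1))
        (fun z => (1 + d (φ z.1) z.2)⁻¹)
      simp only [Fintype.sum_prod_type (α₁ := Fin (m + 1) × Fin (m + 1))] at hcs
      refine hcs.trans ?_
      have h3 : √(∑ b, ∑ a, d (φ a) (φ b) ^ 2) ≤ √N * gridVariation d φ := by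
        refine (Real.sqrt_le_sqrt (sum_sq_le_gridVariation_sq hd hd0 hsymm htri φ)).trans_eq ?_
        rw [← hNm, Real.sqrt_mul (by linarith), Real.sqrt_sq (gridVariation_nonneg hd φ)]
      have h4 : √(∑ b, ∑ a, ((1 + d (φ b) a)⁻¹) ^ 2) ≤ √N * √S := by
        rw [← Real.sqrt_mul (by linarith)]
        refine Real.sqrt_le_sqrt ((Finset.sum_le_sum fun b _ => hS (φ b)).trans_eq ?_)
        rw [Finset.sum_const, Finset.card_univ, nsmul_eq_mul]
      calc _ ≤ (√N * gridVariation d φ) * (√N * √S) :=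
            mul_le_mul h3 h4 (Real.sqrt_nonneg _)
              (mul_nonneg (Real.sqrt_nonneg _) (gridVariation_nonneg hd φ))
        _ = (√N * √N) * √S * gridVariation d φ := by ring
        _ = _ := by rw [Real.mul_self_sqrt (by linarith)]
    simp only [Finset.sum_add_distrib] at h1
    linarith
  have havg : ∑ φ, w φ * (N * ∑ a, Real.log (1 + d (φ a) a)) ≤
      ∑ φ, w φ * (∑ b, ∑ a, Real.log (1 + d (φ b) a) + N * √S * gridVariation d φ) :=
    Finset.sum_le_sum fun φ _ => mul_le_mul_of_nonneg_left (hpt φ) (hw φ)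
  have hL : ∑ φ, w φ * (N * ∑ a, Real.log (1 + d (φ a) a)) = N * (Ψ / (N - 1)) := by
    have : ∀ a, ∑ φ, w φ * Real.log (1 + d (φ a) a) = (∑ x, Real.log (1 + d x a)) / (N - 1) := by
      intro a
      rw [hlaw a fun x => Real.log (1 + d x a), ← Finset.sum_erase Finset.univ (a := a)]
      simp [hd0]
    rw [hΨ, Finset.sum_div, ← Finset.sum_congr rfl fun a _ => this a, Finset.sum_comm,
      Finset.mul_sum]
    refine Finset.sum_congr rfl fun φ _ => ?_
    rw [← Finset.mul_sum]
    ring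
  have hM : ∑ φ, w φ * ∑ b, ∑ a, Real.log (1 + d (φ b) a) = Ψ := by
    have : ∀ b, ∑ φ, w φ * ∑ a, Real.log (1 + d (φ b) a) =
        (Ψ - ∑ a, Real.log (1 + d b a)) / (N - 1) := by
      intro b
      rw [hlaw b fun x => ∑ a, Real.log (1 + d x a), Finset.sum_erase_eq_sub (Finset.mem_univ b),
        hΨ, Finset.sum_comm]
    have hswap : ∑ φ, w φ * ∑ b, ∑ a, Real.log (1 + d (φ b) a) =
        ∑ b, ∑ φ, w φ * ∑ a, Real.log (1 + d (φ b) a) := by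
      rw [Finset.sum_comm]
      exact Finset.sum_congr rfl fun φ _ => Finset.mul_sum _ _ _
    rw [hswap, Finset.sum_congr rfl fun b _ => this b, ← Finset.sum_div,
      Finset.sum_sub_distrib, Finset.sum_const, Finset.card_univ, nsmul_eq_mul, ← hN]
    have : ∑ b, ∑ a, Real.log (1 + d b a) = Ψ := by rw [hΨ, Finset.sum_comm]
    rw [this]
    field_simp
  have hV : ∑ φ, w φ * gridVariation d φ ≤ 2 * ((m + 1) * (m * (R / (N - 1)))) := by
    have h1 : ∑ φ, w φ * gridVariation d φ =
        ∑ i, ∑ k : Fin m, ∑ φ, w φ * d (φ (i, k.castSucc)) (φ (i, k.succ)) +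
        ∑ j, ∑ k : Fin m, ∑ φ, w φ * d (φ (k.castSucc, j)) (φ (k.succ, j)) := by
      simp only [gridVariation, mul_add, Finset.sum_add_distrib, Finset.mul_sum]
      congr 1
      · rw [Finset.sum_comm]
        exact Finset.sum_congr rfl fun i _ => Finset.sum_comm
      · rw [Finset.sum_comm]
        exact Finset.sum_congr rfl fun i _ => Finset.sum_comm
    rw [h1]
    have h2 := Finset.sum_le_sum fun i (_ : i ∈ Finset.univ) =>
      Finset.sum_le_sum fun k (_ : k ∈ Finset.univ) => hcol i k
    have h3 := Finset.sum_le_sum fun j (_ : j ∈ Finset.univ) =>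
      Finset.sum_le_sum fun k (_ : k ∈ Finset.univ) => hrow j k
    simp only [Finset.sum_const, Finset.card_univ, Fintype.card_fin, nsmul_eq_mul,
      Nat.cast_add, Nat.cast_one] at h2 h3
    linarith
  have hR' : ∑ φ, w φ * (∑ b, ∑ a, Real.log (1 + d (φ b) a) + N * √S * gridVariation d φ) ≤
      Ψ + N * √S * (2 * ((m + 1) * (m * (R / (N - 1))))) := by
    have h1 : ∑ φ, w φ * (∑ b, ∑ a, Real.log (1 + d (φ b) a) + N * √S * gridVariation d φ) =
        Ψ + N * √S * ∑ φ, w φ * gridVariation d φ := by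
      rw [← hM, Finset.mul_sum, ← Finset.sum_add_distrib]
      exact Finset.sum_congr rfl fun φ _ => by ring
    rw [h1]
    have : 0 ≤ N * √S := by positivity
    gcongr
  rw [hL] at havg
  have hfin : N * (Ψ / (N - 1)) - Ψ ≤ N * √S * (2 * ((m + 1) * (m * (R / (N - 1))))) := by
    linarith
  have h1 : N * (Ψ / (N - 1)) - Ψ = Ψ / (N - 1) := by field_simp; ring
  have h2 : N * √S * (2 * ((m + 1) * (m * (R / (N - 1))))) =
      (N * √S * (2 * ((m + 1) * (m * R)))) / (N - 1) := by ring
  rw [h1, h2, div_le_div_iff_of_pos_right hN1] at hfin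
  refine hfin.trans ?_
  have h3 : N * √S * (2 * ((m + 1) * (m * R))) = (N * (2 * √S * R)) * ((m + 1) * m) := by ring
  rw [h3, show ((m : ℝ) + 1) ^ 4 * (2 * √S * R) = (N * (2 * √S * R)) * ((m + 1) * (m + 1)) by
    rw [hNm]; ring]
  have : 0 ≤ N * (2 * √S * R) := by positivity
  gcongr
  linarith

/-! ### Estimates for sums over the square grid -/

lemma sum_natAbs_sub_le {M : ℕ} (x : Fin M) {g : ℕ → ℝ} (hg : ∀ k, 0 ≤ g k) :
    ∑ i : Fin M, g ((i : ℤ) - x).natAbs ≤ 2 * ∑ k ∈ Finset.range M, g k := by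
  have hmaps : ∀ i ∈ (Finset.univ : Finset (Fin M)), ((i : ℤ) - x).natAbs ∈ Finset.range M := by
    intro i _
    rw [Finset.mem_range]
    omega
  rw [← Finset.sum_fiberwise_of_maps_to hmaps, Finset.mul_sum]
  refine Finset.sum_le_sum fun k _ => ?_
  have hcard : (Finset.univ.filter fun i : Fin M => ((i : ℤ) - x).natAbs = k).card ≤ 2 := by
    refine (Finset.card_le_card_of_injOn (t := {(x : ℕ) + k, (x : ℕ) - k})
      (fun i : Fin M => (i : ℕ)) ?_ Fin.val_injective.injOn).trans Finset.card_le_two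
    intro i hi
    simp only [Finset.coe_filter, Finset.mem_univ, true_and, Set.mem_ofPred_eq] at hi
    simp only [Finset.coe_insert, Finset.coe_singleton, Set.mem_insert_iff, Set.mem_singleton_iff]
    omega
  calc _ = ∑ i ∈ Finset.univ.filter fun i : Fin M => ((i : ℤ) - x).natAbs = k, g k :=
        Finset.sum_congr rfl fun i hi => by rw [(Finset.mem_filter.1 hi).2]
    _ ≤ 2 * g k := by
        rw [Finset.sum_const, nsmul_eq_mul]
        exact mul_le_mul_of_nonneg_right (by exact_mod_cast hcard) (hg k)

lemma card_natAbs_sub_lt_le {M : ℕ} (x : Fin M) (K : ℕ) :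
    ∑ i : Fin M, (if ((i : ℤ) - x).natAbs < K then (1 : ℝ) else 0) ≤ 2 * K := by
  refine (sum_natAbs_sub_le x (g := fun k => if k < K then (1 : ℝ) else 0)
    fun k => by positivity).trans ?_
  rw [Finset.sum_boole]
  have : ((Finset.range M).filter fun k => k < K).card ≤ K := by
    simpa using Finset.card_le_card (s := (Finset.range M).filter fun k => k < K)
      (t := Finset.range K) fun k hk => Finset.mem_range.2 (Finset.mem_filter.1 hk).2
  have : (((Finset.range M).filter fun k => k < K).card : ℝ) ≤ K := by exact_mod_cast this
  linarith

lemma one_add_rpow_le {q u : ℝ} (hq : 0 < q) (hq1 : q ≤ 1) (hu : 0 ≤ u) :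
    (1 + u) ^ q ≤ 1 + u ^ q := by
  simpa using Real.rpow_add_le_add_rpow zero_le_one hu hq.le hq1

lemma inv_sq_one_add_le {q y : ℝ} (hq : 0 < q) (hq1 : q ≤ 1) {M k : ℕ} (hk : k < M)
    (hy : (k : ℝ) ^ q ≤ y) :
    ((1 + y)⁻¹) ^ 2 ≤ (M : ℝ) ^ (2 * (1 - q)) * (((1 : ℝ) + k)⁻¹) ^ 2 := by
  have hk0 : (0 : ℝ) < 1 + k := by positivity
  have hkM : (1 : ℝ) + k ≤ M := by exact_mod_cast (by omega : 1 + k ≤ M)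
  have h1 : ((1 : ℝ) + k) ^ q ≤ 1 + y := (one_add_rpow_le hq hq1 k.cast_nonneg).trans (by linarith)
  have h2 : ((1 + y)⁻¹) ^ 2 ≤ ((((1 : ℝ) + k) ^ q)⁻¹) ^ 2 := by
    have := inv_anti₀ (by positivity) h1
    have h3 : 0 ≤ (1 + y)⁻¹ := inv_nonneg.2 ((Real.rpow_nonneg hk0.le q).trans h1)
    gcongr
  have h3 : ((((1 : ℝ) + k) ^ q)⁻¹) ^ 2 =
      ((1 : ℝ) + k) ^ (2 * (1 - q)) * (((1 : ℝ) + k)⁻¹) ^ 2 := by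
    rw [show 2 * (1 - q) = (2 : ℕ) - (q + q) by push_cast; ring, Real.rpow_sub hk0,
      Real.rpow_natCast, Real.rpow_add hk0]
    field_simp
  rw [h3] at h2
  refine h2.trans ?_
  have : ((1 : ℝ) + k) ^ (2 * (1 - q)) ≤ (M : ℝ) ^ (2 * (1 - q)) :=
    Real.rpow_le_rpow hk0.le hkM (by linarith)
  gcongr

lemma sum_inv_one_add_le {M : ℕ} (x : Fin M) :
    ∑ i : Fin M, ((1 : ℝ) + (((i : ℤ) - x).natAbs : ℝ))⁻¹ ≤ 2 * (1 + Real.log M) := by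
  refine (sum_natAbs_sub_le x (g := fun k => ((1 : ℝ) + k)⁻¹) fun k => by positivity).trans ?_
  have := harmonic_le_one_add_log M
  rw [harmonic] at this
  push_cast at this
  simp only [add_comm (1 : ℝ)] at this ⊢
  linarith

section Grid

variable {M : ℕ} {q : ℝ} {d : Fin M × Fin M → Fin M × Fin M → ℝ}

lemma sum_inv_sq_grid_le (hq : 0 < q) (hq1 : q ≤ 1)
    (h1 : ∀ x a, (((a.1 : ℤ) - x.1).natAbs : ℝ) ^ q ≤ d x a)
    (h2 : ∀ x a, (((a.2 : ℤ) - x.2).natAbs : ℝ) ^ q ≤ d x a) (x : Fin M × Fin M) :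
    ∑ a, ((1 + d x a)⁻¹) ^ 2 ≤ 8 * (M : ℝ) ^ (2 * (1 - q)) * (1 + Real.log M) := by
  set B : ℝ := (M : ℝ) ^ (2 * (1 - q)) with hB
  have hB0 : 0 ≤ B := by positivity
  set t : Fin M → Fin M → ℕ := fun y i => ((i : ℤ) - y).natAbs with ht
  have htM : ∀ y i, t y i < M := fun y i => by simp only [ht]; omega
  set h : ℕ → ℝ := fun k => B * (((1 : ℝ) + k)⁻¹) ^ 2 with hh
  have hh0 : ∀ k, 0 ≤ h k := fun k => by positivity
  have hhalf : ∀ y z : Fin M, ∑ i, ∑ j, (if t z j < t y i + 1 then h (t y i) else 0) ≤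
      4 * B * (1 + Real.log M) := by
    intro y z
    calc ∑ i, ∑ j, (if t z j < t y i + 1 then h (t y i) else 0)
        = ∑ i, h (t y i) * ∑ j, (if t z j < t y i + 1 then (1 : ℝ) else 0) := by
          refine Finset.sum_congr rfl fun i _ => ?_
          rw [Finset.mul_sum]
          exact Finset.sum_congr rfl fun j _ => by rw [mul_ite, mul_one, mul_zero]
      _ ≤ ∑ i, h (t y i) * (2 * ((t y i + 1 : ℕ) : ℝ)) :=
          Finset.sum_le_sum fun i _ =>
            mul_le_mul_of_nonneg_left (card_natAbs_sub_lt_le z _) (hh0 _)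
      _ = 2 * B * ∑ i, ((1 : ℝ) + t y i)⁻¹ := by
          rw [Finset.mul_sum]
          refine Finset.sum_congr rfl fun i _ => ?_
          have : (1 : ℝ) + t y i ≠ 0 := by positivity
          simp only [hh]
          push_cast
          field_simp
          ring
      _ ≤ 2 * B * (2 * (1 + Real.log M)) :=
          mul_le_mul_of_nonneg_left (sum_inv_one_add_le y) (by positivity)
      _ = _ := by ring
  calc ∑ a, ((1 + d x a)⁻¹) ^ 2
      ≤ ∑ i, ∑ j, ((if t x.2 j < t x.1 i + 1 then h (t x.1 i) else 0) +
          (if t x.1 i < t x.2 j + 1 then h (t x.2 j) else 0)) := by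
        rw [Fintype.sum_prod_type]
        refine Finset.sum_le_sum fun i _ => Finset.sum_le_sum fun j _ => ?_
        rcases le_total (t x.2 j) (t x.1 i) with hij | hij
        · rw [if_pos (Nat.lt_succ_of_le hij)]
          have := inv_sq_one_add_le hq hq1 (htM x.1 i) (h1 x (i, j))
          have : (0 : ℝ) ≤ if t x.1 i < t x.2 j + 1 then h (t x.2 j) else 0 := by
            split_ifs
            exacts [hh0 _, le_rfl]
          linarith
        · rw [if_pos (Nat.lt_succ_of_le hij)]
          have := inv_sq_one_add_le hq hq1 (htM x.2 j) (h2 x (i, j))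
          have : (0 : ℝ) ≤ if t x.2 j < t x.1 i + 1 then h (t x.1 i) else 0 := by
            split_ifs
            exacts [hh0 _, le_rfl]
          linarith
    _ ≤ 8 * B * (1 + Real.log M) := by
        simp only [Finset.sum_add_distrib]
        have e1 := hhalf x.1 x.2
        have e2 := hhalf x.2 x.1
        rw [Finset.sum_comm] at e2
        linarith

lemma log_le_sum_log_grid (hq : 0 < q) (hq1 : q ≤ 1) {K : ℕ} (hM : M = 4 * K)
    (h1 : ∀ x a, (((a.1 : ℤ) - x.1).natAbs : ℝ) ^ q ≤ d x a) :
    (M : ℝ) ^ 4 * (q / 2 * Real.log (K + 1)) ≤ ∑ a, ∑ x, Real.log (1 + d x a) := by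
  have hL : 0 ≤ Real.log (K + 1) := Real.log_nonneg (by linarith [K.cast_nonneg (α := ℝ)])
  have hrow : ∀ i : Fin M, 2 * K * (q * Real.log (K + 1)) ≤
      ∑ y : Fin M, q * Real.log (1 + (((y : ℤ) - i).natAbs : ℝ)) := by
    intro i
    have hpt : ∀ y : Fin M, q * Real.log (K + 1) *
        (1 - if ((y : ℤ) - i).natAbs < K then (1 : ℝ) else 0) ≤
          q * Real.log (1 + (((y : ℤ) - i).natAbs : ℝ)) := by
      intro y
      split_ifs with h
      · have : 0 ≤ Real.log (1 + (((y : ℤ) - i).natAbs : ℝ)) :=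
          Real.log_nonneg (by linarith [((y : ℤ) - i).natAbs.cast_nonneg (α := ℝ)])
        rw [sub_self, mul_zero]
        positivity
      · rw [sub_zero, mul_one]
        have : (K : ℝ) ≤ (((y : ℤ) - i).natAbs : ℝ) := by exact_mod_cast not_lt.1 h
        have : Real.log (K + 1) ≤ Real.log (1 + (((y : ℤ) - i).natAbs : ℝ)) :=
          Real.log_le_log (by positivity) (by linarith)
        gcongr
    refine le_trans ?_ (Finset.sum_le_sum fun y _ => hpt y)
    rw [← Finset.mul_sum, Finset.sum_sub_distrib, Finset.sum_const, Finset.card_univ,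
      Fintype.card_fin, nsmul_eq_mul, mul_one, mul_comm (2 * (K : ℝ))]
    have := card_natAbs_sub_lt_le i K
    have hM' : (M : ℝ) = 4 * K := by exact_mod_cast hM
    refine mul_le_mul_of_nonneg_left ?_ (by positivity)
    linarith
  have hterm : ∀ a x : Fin M × Fin M,
      q * Real.log (1 + (((x.1 : ℤ) - a.1).natAbs : ℝ)) ≤ Real.log (1 + d x a) := by
    intro a x
    have hsymm : ((x.1 : ℤ) - a.1).natAbs = ((a.1 : ℤ) - x.1).natAbs := by omega
    rw [hsymm, ← Real.log_rpow (by positivity)]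
    exact Real.log_le_log (by positivity) ((one_add_rpow_le hq hq1 (Nat.cast_nonneg _)).trans
      (by linarith [h1 x a]))
  refine le_trans ?_ (Finset.sum_le_sum fun a _ => Finset.sum_le_sum fun x _ => hterm a x)
  have hM' : (M : ℝ) = 4 * K := by exact_mod_cast hM
  calc (M : ℝ) ^ 4 * (q / 2 * Real.log (K + 1))
      = ∑ a : Fin M × Fin M, M * (2 * K * (q * Real.log (K + 1))) := by
        rw [Finset.sum_const, Finset.card_univ, Fintype.card_prod, Fintype.card_fin, nsmul_eq_mul]
        push_cast
        rw [hM']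
        ring
    _ ≤ _ := by
        refine Finset.sum_le_sum fun a _ => ?_
        rw [Fintype.sum_prod_type, Finset.sum_comm]
        refine le_trans (le_of_eq ?_) (Finset.sum_le_sum fun j _ => hrow a.1)
        rw [Finset.sum_const, Finset.card_univ, Fintype.card_fin, nsmul_eq_mul]

end Grid

/-- The logarithmic obstruction to a finite coupling ratio in dimension at least two. -/
lemma log_le_of_weights_lpNorm {n : ℕ} {p : ℝ≥0∞} (hp : 1 ≤ p) (hn : 2 ≤ n) {q : ℝ} (hq : 0 < q)
    {R : ℝ} (hR1 : 1 ≤ R)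
    (hR : ∀ (ι : Type) [Fintype ι] [DecidableEq ι], 1 < Fintype.card ι → ∀ e : ι → Fin n → ℝ,
        Function.Injective e → ∃ w : (ι → ι) → ℝ, (∀ φ, 0 ≤ w φ) ∧
        (∀ a (g : ι → ℝ), ∑ φ, w φ * g (φ a) =
          (∑ x ∈ Finset.univ.erase a, g x) / ((Fintype.card ι : ℝ) - 1)) ∧
        ∀ a b, ∑ φ, w φ * lpNorm p (e (φ a) - e (φ b)) ^ q ≤
          R * (lpNorm p (e b - e a) ^ q / ((Fintype.card ι : ℝ) - 1)))
    {K : ℕ} (hK : 0 < K) :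
    min q 1 / 2 * Real.log (K + 1) ≤
      2 * √(8 * (4 * K : ℝ) ^ (2 * (1 - min q 1)) * (1 + Real.log (4 * K))) * R := by
  obtain ⟨m, hm⟩ : ∃ m, m + 1 = 4 * K := ⟨4 * K - 1, by omega⟩
  set r := min q 1 with hr
  have hr0 : 0 < r := lt_min hq one_pos
  have hr1 : r ≤ 1 := min_le_right _ _
  let i₀ : Fin n := ⟨0, by omega⟩
  let i₁ : Fin n := ⟨1, by omega⟩
  have hi : i₀ ≠ i₁ := by simp [i₀, i₁]
  let e : Fin (m + 1) × Fin (m + 1) → Fin n → ℝ := fun x =>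
    Pi.single i₀ ((x.1 : ℕ) : ℝ) + Pi.single i₁ ((x.2 : ℕ) : ℝ)
  have he0 : ∀ x, e x i₀ = ((x.1 : ℕ) : ℝ) := fun x => by simp [e, hi]
  have he1 : ∀ x, e x i₁ = ((x.2 : ℕ) : ℝ) := fun x => by simp [e, hi.symm]
  have he : Function.Injective e := by
    intro x y hxy
    have h0 := he0 x
    have h1 := he1 x
    rw [hxy, he0] at h0
    rw [hxy, he1] at h1
    exact Prod.ext (Fin.ext (by exact_mod_cast h0.symm)) (Fin.ext (by exact_mod_cast h1.symm))
  have habs : ∀ i j : Fin (m + 1),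
      (((j : ℤ) - i).natAbs : ℝ) = |((i : ℕ) : ℝ) - ((j : ℕ) : ℝ)| := by
    intro i j
    rw [Nat.cast_natAbs, abs_sub_comm]
    push_cast
    rfl
  have hfst : ∀ x a, (((a.1 : ℤ) - x.1).natAbs : ℝ) ≤ lpNorm p (e x - e a) := by
    intro x a
    rw [habs, ← he0, ← he0]
    exact abs_apply_le_lpNorm hp (e x - e a) i₀
  have hsnd : ∀ x a, (((a.2 : ℤ) - x.2).natAbs : ℝ) ≤ lpNorm p (e x - e a) := by
    intro x a
    rw [habs, ← he1, ← he1]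
    exact abs_apply_le_lpNorm hp (e x - e a) i₁
  have hge : ∀ x y, x ≠ y → 1 ≤ lpNorm p (e x - e y) := by
    intro x y hxy
    by_cases h : x.1 = y.1
    · have h2 : x.2 ≠ y.2 := fun h' => hxy (Prod.ext h h')
      refine le_trans ?_ (hsnd x y)
      rw [habs]
      exact one_le_abs_natCast_sub fun h' => h2 (Fin.ext h')
    · refine le_trans ?_ (hfst x y)
      rw [habs]
      exact one_le_abs_natCast_sub fun h' => h (Fin.ext h')
  have hself : ∀ x, lpNorm p (e x - e x) = 0 := fun x => by
    rw [sub_self, lpNorm_zero hp (by omega)]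
  set d : Fin (m + 1) × Fin (m + 1) → Fin (m + 1) × Fin (m + 1) → ℝ :=
    fun x y => lpNorm p (e x - e y) ^ r with hd
  have hdc : ∀ x y, d x y ≤ lpNorm p (e x - e y) ^ q := by
    intro x y
    by_cases hxy : x = y
    · subst hxy
      simp only [hd, hself, Real.zero_rpow hr0.ne', Real.zero_rpow hq.ne', le_refl]
    · exact Real.rpow_le_rpow_of_exponent_le (hge x y hxy) (min_le_left _ _)
  obtain ⟨w, hw, hlaw, hcost⟩ := hR (Fin (m + 1) × Fin (m + 1))
    (by simp only [Fintype.card_prod, Fintype.card_fin, hm]; nlinarith) e he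
  have hstep : ∀ a b, lpNorm p (e b - e a) = 1 → ∑ φ, w φ * d (φ a) (φ b) ≤
      R / ((Fintype.card (Fin (m + 1) × Fin (m + 1)) : ℝ) - 1) := by
    intro a b hab
    refine (Finset.sum_le_sum fun φ _ =>
      mul_le_mul_of_nonneg_left (hdc _ _) (hw φ)).trans ((hcost a b).trans_eq ?_)
    rw [hab, Real.one_rpow, mul_one_div]
  have hM : ((m : ℝ) + 1) = 4 * K := by exact_mod_cast hm
  have key := sum_log_le_of_weights_grid (m := m) (by omega) (d := d)
    (fun x y => Real.rpow_nonneg (lpNorm_nonneg _ _) _)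
    (fun x => by simp only [hd, hself, Real.zero_rpow hr0.ne'])
    (fun x y => by simp only [hd, lpNorm_sub_comm p (e x)])
    (fun x y z => by
      have h := lpNorm_add_le hp (e x - e y) (e y - e z)
      rw [sub_add_sub_cancel] at h
      exact (Real.rpow_le_rpow (lpNorm_nonneg _ _) h hr0.le).trans
        (Real.rpow_add_le_add_rpow (lpNorm_nonneg _ _) (lpNorm_nonneg _ _) hr0.le hr1))
    hw hlaw (by linarith)
    (fun i k => hstep _ _ (by
      have : e (i, k.succ) - e (i, k.castSucc) = Pi.single i₁ 1 := by
        simp only [e, add_sub_add_left_eq_sub, ← Pi.single_sub]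
        simp
      rw [this, lpNorm_single hp, abs_one]))
    (fun j k => hstep _ _ (by
      have : e (k.succ, j) - e (k.castSucc, j) = Pi.single i₀ 1 := by
        simp only [e, add_sub_add_right_eq_sub, ← Pi.single_sub]
        simp
      rw [this, lpNorm_single hp, abs_one]))
    (sum_inv_sq_grid_le hr0 hr1
      (fun x a => Real.rpow_le_rpow (Nat.cast_nonneg _) (hfst x a) hr0.le)
      fun x a => Real.rpow_le_rpow (Nat.cast_nonneg _) (hsnd x a) hr0.le)
  have hlow := log_le_sum_log_grid hr0 hr1 hm (d := d)
    fun x a => Real.rpow_le_rpow (Nat.cast_nonneg _) (hfst x a) hr0.le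
  have := hlow.trans key
  push_cast at this
  rw [hM] at this
  exact le_of_mul_le_mul_left this (by positivity)

lemma log_four_mul_le {K : ℕ} (hK : 0 < K) : Real.log (4 * K) ≤ 2 + Real.log (K + 1) := by
  have hK0 : (0 : ℝ) < K := by exact_mod_cast hK
  rw [Real.log_mul (by norm_num) hK0.ne']
  have h4 : Real.log 4 ≤ 2 := by
    rw [show (4 : ℝ) = 2 ^ 2 by norm_num, Real.log_pow]
    have := Real.log_two_lt_d9
    push_cast
    linarith
  linarith [Real.log_le_log hK0 (by linarith : (K : ℝ) ≤ K + 1)]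

lemma lpOptRatio_eq_top {n : ℕ} {p : ℝ≥0∞} (hp : 1 ≤ p) (hn : 2 ≤ n) {q : ℝ} (hq : 1 ≤ q) :
    lpOptRatio n p q = ⊤ := by
  refine top_le_iff.1 (le_lpOptRatio hp (by omega) (by linarith) fun R hR1 hR => ?_)
  exfalso
  obtain ⟨K, hK⟩ := exists_nat_gt (Real.exp (256 * R ^ 2 + 3))
  have hK0 : 0 < K := by
    have := (Real.exp_pos (256 * R ^ 2 + 3)).trans hK
    exact_mod_cast this
  have h := log_le_of_weights_lpNorm hp hn (by linarith) hR1 hR hK0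
  rw [min_eq_right hq, sub_self, mul_zero, Real.rpow_zero, mul_one] at h
  have hlog : 256 * R ^ 2 + 3 < Real.log (K + 1) := by
    rw [Real.lt_log_iff_exp_lt (by positivity)]
    linarith
  set L := Real.log (K + 1) with hL
  have h4 := log_four_mul_le hK0
  have hle : L / 2 ≤ 2 * √(8 * (3 + L)) * R := by
    have h3 : 1 + Real.log (4 * K) ≤ 3 + L := by linarith
    refine le_trans (by linarith) (h.trans ?_)
    gcongr
  have hRp : 0 < R ^ 2 := by positivity
  have hL0 : 0 ≤ L := by linarith
  have hsq : (L / 2) ^ 2 ≤ (2 * √(8 * (3 + L)) * R) ^ 2 := by gcongr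
  rw [mul_pow, mul_pow, Real.sq_sqrt (by linarith)] at hsq
  nlinarith

lemma inv_sqrt_le_lpOptRatio {n : ℕ} {p : ℝ≥0∞} (hp : 1 ≤ p) (hn : 2 ≤ n) {q : ℝ} (hq : 0 < q)
    (hq1 : q < 1) :
    ENNReal.ofReal (1 / (1000 * √(1 - q))) ≤ lpOptRatio n p q := by
  set δ := 1 - q with hδ
  have hδ0 : 0 < δ := by linarith
  have hs0 : 0 < √δ := Real.sqrt_pos.2 hδ0
  rcases le_or_gt (1 / (1000 * √δ)) 2 with hle | hgt
  · refine le_trans ?_ (two_le_lpOptRatio hp (by omega) hq hq1)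
    rw [show (2 : ℝ≥0∞) = ENNReal.ofReal 2 by simp]
    exact ENNReal.ofReal_le_ofReal hle
  have hδ1 : δ < 1 / 1000 := by
    rw [lt_div_iff₀ (by positivity)] at hgt
    have := Real.sq_sqrt hδ0.le
    nlinarith
  refine le_lpOptRatio hp (by omega) hq fun R hR1 hR => ENNReal.ofReal_le_ofReal ?_
  set E := Real.exp (1 / (2 * δ)) with hE
  have hbig : 500 < 1 / (2 * δ) := by
    rw [lt_div_iff₀ (by positivity)]
    linarith
  have hE4 : 4 ≤ E := by linarith [Real.add_one_le_exp (1 / (2 * δ))]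
  set K := ⌊E / 4⌋₊ with hKdef
  have hK0 : 0 < K := Nat.floor_pos.2 (by linarith)
  have hKR : (0 : ℝ) < K := by exact_mod_cast hK0
  have hKle : 4 * (K : ℝ) ≤ E := by
    have := Nat.floor_le (a := E / 4) (by positivity)
    linarith
  have hKlt : E / 4 < K + 1 := Nat.lt_floor_add_one _
  have h := log_le_of_weights_lpNorm hp hn hq hR1 hR hK0
  rw [min_eq_left hq1.le, ← hδ] at h
  have hpow : (4 * K : ℝ) ^ (2 * δ) ≤ 3 := by
    calc (4 * K : ℝ) ^ (2 * δ) ≤ E ^ (2 * δ) := by gcongr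
      _ = Real.exp 1 := by
          rw [hE, ← Real.exp_mul]
          congr 1
          field_simp
      _ ≤ 3 := by linarith [Real.exp_one_lt_d9]
  have hlog4K : Real.log (4 * K) ≤ 1 / (2 * δ) :=
    (Real.log_le_iff_le_exp (by positivity)).2 hKle
  have hlogK : 1 / (4 * δ) ≤ Real.log (K + 1) := by
    have h1 : Real.log (E / 4) ≤ Real.log (K + 1) := Real.log_le_log (by positivity) hKlt.le
    rw [Real.log_div (by positivity) (by norm_num), hE, Real.log_exp] at h1
    have h4 : Real.log 4 ≤ 3 := by
      linarith [Real.log_le_sub_one_of_pos (show (0 : ℝ) < 4 by norm_num)]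
    have : 1 / (2 * δ) = 2 * (1 / (4 * δ)) := by field_simp; norm_num
    linarith
  have hsqrt : √(8 * (4 * K : ℝ) ^ (2 * δ) * (1 + Real.log (4 * K))) ≤ 5 / √δ := by
    rw [Real.sqrt_le_left (by positivity), div_pow, Real.sq_sqrt hδ0.le]
    have hone : 1 + Real.log (4 * K) ≤ 1 / δ := by
      have : 1 / δ = 2 * (1 / (2 * δ)) := by field_simp
      linarith
    have hlog0 : 0 ≤ Real.log (4 * K) :=
      Real.log_nonneg (by linarith [show (1 : ℝ) ≤ K by exact_mod_cast hK0])
    calc 8 * (4 * K : ℝ) ^ (2 * δ) * (1 + Real.log (4 * K)) ≤ 8 * 3 * (1 / δ) := by gcongr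
      _ ≤ 5 ^ 2 / δ := by rw [← mul_one_div (5 ^ 2)]; gcongr; norm_num
  have hmain : 1 / 4 * (1 / (4 * δ)) ≤ 2 * (5 / √δ) * R := by
    refine le_trans ?_ (h.trans ?_)
    · exact mul_le_mul (by linarith) hlogK (by positivity) (by linarith)
    · gcongr
  have hδs : δ = √δ * √δ := (Real.mul_self_sqrt hδ0.le).symm
  have h1 : 1 / 4 * (1 / (4 * δ)) = 1 / (16 * √δ) * (1 / √δ) := by
    rw [hδs, Real.sqrt_mul_self hs0.le]
    field_simp
    norm_num
  have h2 : 2 * (5 / √δ) * R = (10 * R) * (1 / √δ) := by ring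
  rw [h1, h2] at hmain
  have h3 := le_of_mul_le_mul_right hmain (by positivity)
  rw [div_le_iff₀ (by positivity)] at h3 ⊢
  have : 0 < R * √δ := by positivity
  linarith

/-- `ℓ_p` costs on `ℝⁿ`, lower bounds. For `c(x,y) = ‖x − y‖_p^q`
with `p ∈ [1,∞]` and `q > 0`: (i) if `n = 1` and `q < 1` then `r*_c(P(ℝ)) ≥ 2`;
(ii) if `n ≥ 2` and `q < 1` then `r*_c(P(ℝⁿ)) ≥ max {2, 1/(1000 √(1−q))}`;
(iii) if `n ≥ 2` and `q ≥ 1` then `r*_c(P(ℝⁿ)) = ∞`. -/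
theorem lp_optRatio_lower_bounds (n : ℕ) (p : ℝ≥0∞) (hp : 1 ≤ p) (q : ℝ) (hq : 0 < q) :
    (n = 1 → q < 1 → 2 ≤ lpOptRatio n p q) ∧
      (2 ≤ n → q < 1 →
        max 2 (ENNReal.ofReal (1 / (1000 * Real.sqrt (1 - q)))) ≤ lpOptRatio n p q) ∧
      (2 ≤ n → 1 ≤ q → lpOptRatio n p q = ⊤) := by
  exact ⟨fun hn hq1 => two_le_lpOptRatio hp (by omega) hq hq1,
    fun hn hq1 => max_le (two_le_lpOptRatio hp (by omega) hq hq1)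
      (inv_sqrt_le_lpOptRatio hp hn hq hq1),
    fun hn hq1 => lpOptRatio_eq_top hp hn hq1⟩

end
end
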